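/- Let σ ≥ 1, Υ ≥ 1, l > 1, 0 < ε < 1, μ > 0, and let H(q,p,t) = h(p) + R(q,p) + f(q,p,t) be a Hamiltonian on 𝕋ⁿ × B₁ × ℝ such that: f and ∂_p f belong to D̄_{σ,2} (i.e. ∂_q^i f has C^{σ+2−i} Hölder regularity in q jointly continuously in (q,p,t) for 0 ≤ i ≤ 2); the smallness condition |f|_{σ+2,0,L(B₁)} + ‖∂_q f‖_{σ,1,l+2,L(B₁)} + ‖∂_p f‖_{σ,2,l+1,L(B₁)} < ε holds; D ⊂ B₁ is a subset with Leb(B₁ \ D) < μ; R ∈ C²(𝕋ⁿ × B₁) with R(q,p) = ∂_p R(q,p) = 0 for all (q,p) ∈ 𝕋ⁿ × D; ∂_p²H^t ∈ C^{σ+2}(𝕋ⁿ × B₁) for each fixed t; ∂^i_{qp}(∂_p²H) is continuous on 𝕋ⁿ × B₁ × ℝ for 0 ≤ i ≤ 2; and sup_{t∈ℝ}|∂_p²H^t|_{C^{σ+2}} ≤ Υ. Then there exists a time-dependent Hamiltonian h̃ such that, for ε small enough with respect to n, l, Υ, |∂_p h|_{L(D)} and μ, there exists a set W ⊂ 𝕋ⁿ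 × B₁ with Leb((𝕋ⁿ × B₁) \ W) ≤ 4μ such that for every (q,p) ∈ W there exist p₋, p₊ ∈ D and a biasymptotically quasiperiodic solution g associated to (X_H, X_{h̃}, φ_{0,p₊}, φ_{0,p₋}) with g(0) = (q,p), where φ_{0,p}(q) = (q,p). -/

import Mathlib

open scoped ENNReal NNReal Topology
open Filter Metric Set MeasureTheory

noncomputable section

namespace Bias

/-- ℝⁿ, the model space; functions on the torus 𝕋ⁿ = ℝⁿ/ℤⁿ are modelled as
ℤⁿ-periodic functions on ℝⁿ. -/
abbrev E (n : ℕ) := EuclideanSpace ℝ (Fin n)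

variable {n : ℕ}

/-- a lattice point of ℤⁿ inside ℝⁿ -/
def latt (k : Fin n → ℤ) : E n := (EuclideanSpace.equiv (Fin n) ℝ).symm fun i => (k i : ℝ)

/-- distance on the torus ℝⁿ/ℤⁿ between (representatives of) two points -/
def distT (x y : E n) : ℝ := ⨅ k : Fin n → ℤ, ‖x - y - latt k‖

/-- fundamental domain [0,1)ⁿ of the torus -/
def fund (n : ℕ) : Set (E n) := {x | ∀ i, 0 ≤ x i ∧ x i < 1}

variable {E' F : Type*} [NormedAddCommGroup E'] [NormedSpace ℝ E']
  [NormedAddCommGroup F] [NormedSpace ℝ F]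

/-- `C^k` norm of `f` on the set `s` (with extended-real value). -/
def cNormOn (k : ℕ) (s : Set E') (f : E' → F) : ℝ≥0∞ :=
  ⨆ i : Fin (k + 1), ⨆ x ∈ s, (‖iteratedFDerivWithin ℝ (i : ℕ) f s x‖₊ : ℝ≥0∞)

/-- Hölder `C^σ` norm of `f` on the set `s`: the `C^⌊σ⌋` norm, plus — when σ is not an
integer — the (σ - ⌊σ⌋)-Hölder seminorm of the ⌊σ⌋-th derivative. -/
def holderNormOn (σ : ℝ) (s : Set E') (f : E' → F) : ℝ≥0∞ :=
  cNormOn ⌊σ⌋₊ s f +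
    if (⌊σ⌋₊ : ℝ) = σ then 0 else
      ⨆ x ∈ s, ⨆ y ∈ s, ⨆ _ : x ≠ y,
        ENNReal.ofReal (‖iteratedFDerivWithin ℝ ⌊σ⌋₊ f s x -
          iteratedFDerivWithin ℝ ⌊σ⌋₊ f s y‖ / ‖x - y‖ ^ (σ - (⌊σ⌋₊ : ℝ)))

/-- membership in the Hölder class `C^σ` on `s`. -/
def HolderOn (σ : ℝ) (s : Set E') (f : E' → F) : Prop :=
  ContDiffOn ℝ ⌊σ⌋₊ f s ∧ holderNormOn σ s f < ⊤

/-- Lipschitz norm of a map on a set. -/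
def lipNormOn (s : Set E') (f : E' → F) : ℝ≥0∞ :=
  (⨆ x ∈ s, ⨆ y ∈ s, ⨆ _ : x ≠ y, ENNReal.ofReal (‖f x - f y‖ / ‖x - y‖)) +
    ⨆ x ∈ s, (‖f x‖₊ : ℝ≥0∞)

/-- Lipschitz (in the parameter) norm of a parametrised family `G z x` (`x` the parameter). -/
def lipParamNorm {α : Type*} (S : Set α) (A : Set (E n)) (G : α → E n → F) : ℝ≥0∞ :=
  (⨆ z ∈ S, ⨆ x ∈ A, ⨆ y ∈ A, ⨆ _ : x ≠ y, ENNReal.ofReal (‖G z x - G z y‖ / ‖x - y‖)) +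
    ⨆ z ∈ S, ⨆ x ∈ A, (‖G z x‖₊ : ℝ≥0∞)

/-- the time weights 1 + |t|^l  and  1 + |t|^(l-1) (equal to 1 for l = 0). -/
def w1 (l t : ℝ) : ℝ := if l = 0 then 1 else 1 + |t| ^ l
def w2 (l t : ℝ) : ℝ := if l = 0 then 1 else 1 + |t| ^ (l - 1)

/-- ℤⁿ-periodicity in the angular variable. -/
def Per (f : E n → E n → ℝ → F) : Prop :=
  ∀ (q p : E n) (t : ℝ) (k : Fin n → ℤ), f (q + latt k) p t = f q p t

/-- partial derivative in the action/parameter variable `p`. -/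
def pderiv (f : E n → E n → ℝ → F) (q p : E n) (t : ℝ) : E n →L[ℝ] F :=
  fderiv ℝ (fun p' => f q p' t) p

/-- i-th partial derivative in the angular variable `q`. -/
def qderiv (i : ℕ) (f : E n → E n → ℝ → F) :
    E n → E n → ℝ → ContinuousMultilinearMap ℝ (fun _ : Fin i => E n) F :=
  fun q p t => iteratedFDeriv ℝ i (fun q' => f q' p t) q

/-- the space `B_σ` of functions on 𝕋ⁿ × A × ℝ. -/
def MemB (σ : ℝ) (A : Set (E n)) (f : E n → E n → ℝ → F) : Prop :=
  ContinuousOn (fun x : E n × E n × ℝ => f x.1 x.2.1 x.2.2) (univ ×ˢ (A ×ˢ univ)) ∧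
  ContinuousOn (fun x : E n × E n × ℝ => pderiv f x.1 x.2.1 x.2.2) (univ ×ˢ (A ×ˢ univ)) ∧
  Per f ∧ ∀ p ∈ A, ∀ t : ℝ, HolderOn σ univ fun q => f q p t

/-- the weighted norm `|f|_{σ,l}`. -/
def wnormB (σ l : ℝ) (A : Set (E n)) (f : E n → E n → ℝ → F) : ℝ≥0∞ :=
  (⨆ p ∈ A, ⨆ t : ℝ, holderNormOn σ univ (fun q => f q p t) * ENNReal.ofReal (w1 l t)) +
    ⨆ p ∈ A, ⨆ t : ℝ, ⨆ q : E n, (‖pderiv f q p t‖₊ : ℝ≥0∞) * ENNReal.ofReal (w2 l t)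

/-- the space `B̄_{σ,k}`. -/
def MemBbar (σ : ℝ) (k : ℕ) (A : Set (E n)) (f : E n → E n → ℝ → F) : Prop :=
  ∀ i : ℕ, i ≤ k → MemB (σ + k - i) A (qderiv i f)

/-- the weighted norm `‖f‖_{σ,k,l}`. -/
def wnormBbar (σ : ℝ) (k : ℕ) (l : ℝ) (A : Set (E n)) (f : E n → E n → ℝ → F) : ℝ≥0∞ :=
  ⨆ i : Fin (k + 1), wnormB (σ + k - (i : ℕ)) l A (qderiv (i : ℕ) f)

/-- the space `D_σ` of functions on 𝕋ⁿ × A × ℝ (Lipschitz setting). -/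
def MemD (σ : ℝ) (A : Set (E n)) (f : E n → E n → ℝ → F) : Prop :=
  ContinuousOn (fun x : E n × E n × ℝ => f x.1 x.2.1 x.2.2) (univ ×ˢ (A ×ˢ univ)) ∧
  Per f ∧ ∀ p ∈ A, ∀ t : ℝ, HolderOn σ univ fun q => f q p t

/-- the Lipschitz norm `|f^t|_{L(A)}` of the time-t slice. -/
def lipT (A : Set (E n)) (f : E n → E n → ℝ → F) (t : ℝ) : ℝ≥0∞ :=
  (⨆ q : E n, ⨆ x ∈ A, ⨆ y ∈ A, ⨆ _ : x ≠ y, ENNReal.ofReal (‖f q x t - f q y t‖ / ‖x - y‖)) +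
    ⨆ q : E n, ⨆ p ∈ A, (‖f q p t‖₊ : ℝ≥0∞)

/-- the weighted Lipschitz norm `|f|_{σ,l,L(A)}`. -/
def wnormD (σ l : ℝ) (A : Set (E n)) (f : E n → E n → ℝ → F) : ℝ≥0∞ :=
  (⨆ p ∈ A, ⨆ t : ℝ, holderNormOn σ univ (fun q => f q p t) * ENNReal.ofReal (w1 l t)) +
    ⨆ t : ℝ, lipT A f t * ENNReal.ofReal (w2 l t)

/-- the space `D̄_{σ,k}`. -/
def MemDbar (σ : ℝ) (k : ℕ) (A : Set (E n)) (f : E n → E n → ℝ → F) : Prop :=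
  ∀ i : ℕ, i ≤ k → MemD (σ + k - i) A (qderiv i f)

/-- the weighted norm `‖f‖_{σ,k,l,L(A)}`. -/
def wnormDbar (σ : ℝ) (k : ℕ) (l : ℝ) (A : Set (E n)) (f : E n → E n → ℝ → F) : ℝ≥0∞ :=
  ⨆ i : Fin (k + 1), wnormD (σ + k - (i : ℕ)) l A (qderiv (i : ℕ) f)

/-! ### spaces of functions defined for positive times only -/

/-- the space `B⁺_σ` of functions on 𝕋ⁿ × ℝ⁺ × A (argument order: (θ, p₀, t)). -/
def MemBp (σ : ℝ) (A : Set (E n)) (f : E n → E n → ℝ → F) : Prop :=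
  ContinuousOn (fun x : E n × E n × ℝ => f x.1 x.2.1 x.2.2) (univ ×ˢ (A ×ˢ Ici 0)) ∧
  ContinuousOn (fun x : E n × E n × ℝ => pderiv f x.1 x.2.1 x.2.2) (univ ×ˢ (A ×ˢ Ici 0)) ∧
  (∀ (q p : E n), ∀ t ∈ Ici (0:ℝ), ∀ k : Fin n → ℤ, f (q + latt k) p t = f q p t) ∧
  ∀ p ∈ A, ∀ t ∈ Ici (0:ℝ), HolderOn σ univ fun q => f q p t

/-- the weighted norm `|f|⁺_{σ,l}`. -/
def wnormBp (σ l : ℝ) (A : Set (E n)) (f : E n → E n → ℝ → F) : ℝ≥0∞ :=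
  (⨆ p ∈ A, ⨆ t ∈ Ici (0:ℝ), holderNormOn σ univ (fun q => f q p t) * ENNReal.ofReal (w1 l t)) +
    ⨆ p ∈ A, ⨆ t ∈ Ici (0:ℝ), ⨆ q : E n, (‖pderiv f q p t‖₊ : ℝ≥0∞) * ENNReal.ofReal (w2 l t)

/-- the space `D⁺_σ` of functions on 𝕋ⁿ × ℝ⁺ × A (Lipschitz setting). -/
def MemDp (σ : ℝ) (A : Set (E n)) (f : E n → E n → ℝ → F) : Prop :=
  ContinuousOn (fun x : E n × E n × ℝ => f x.1 x.2.1 x.2.2) (univ ×ˢ (A ×ˢ Ici 0)) ∧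
  (∀ (q p : E n), ∀ t ∈ Ici (0:ℝ), ∀ k : Fin n → ℤ, f (q + latt k) p t = f q p t) ∧
  ∀ p ∈ A, ∀ t ∈ Ici (0:ℝ), HolderOn σ univ fun q => f q p t

/-- the weighted Lipschitz norm `|f|⁺_{σ,l,L(A)}`. -/
def wnormDp (σ l : ℝ) (A : Set (E n)) (f : E n → E n → ℝ → F) : ℝ≥0∞ :=
  (⨆ p ∈ A, ⨆ t ∈ Ici (0:ℝ), holderNormOn σ univ (fun q => f q p t) * ENNReal.ofReal (w1 l t)) +
    ⨆ t ∈ Ici (0:ℝ), lipT A f t * ENNReal.ofReal (w2 l t)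

/-! ### Hamiltonian vector fields, embedded tori -/

/-- the Hamiltonian vector field `X_H = (∂_p H, -∂_q H)` of a time-dependent Hamiltonian. -/
def XH (H : E n → E n → ℝ → ℝ) (q p : E n) (t : ℝ) : E n × E n :=
  (gradient (fun p' => H q p' t) p, -gradient (fun q' => H q' p t) q)

/-- a `C^σ` embedding of the torus 𝕋ⁿ into 𝕋ⁿ × B (written in the universal cover). -/
def TorusEmb (σ : ℝ) (B : Set (E n)) (φ : E n → E n × E n) : Prop :=
  (∀ (q : E n) (k : Fin n → ℤ), φ (q + latt k) = ((φ q).1 + latt k, (φ q).2)) ∧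
  (∀ q : E n, (φ q).2 ∈ B) ∧
  HolderOn σ univ (fun q : E n => φ q - (q, (0 : E n))) ∧
  (∀ (q q' : E n) (k : Fin n → ℤ), (φ q).1 = (φ q').1 + latt k → (φ q).2 = (φ q').2 →
    ∃ kk : Fin n → ℤ, q = q' + latt kk)

/-- a positive `C^σ`-asymptotic KAM torus associated to `(X, X₀, φ₀)` with frequency ω:
a family of `C^σ` embeddings, defined for t ≥ 0, converging in `C^σ` norm to φ₀ as t → +∞
and satisfying `X(φ(q,t),t) = ∂_q φ(q,t) ω + ∂_t φ(q,t)` (expressed along the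
characteristics `s ↦ φ^s(q + sω)`). -/
def AsymTorusPos (σ : ℝ) (B : Set (E n)) (X : E n → E n → ℝ → E n × E n)
    (φ₀ : E n → E n × E n) (ω : E n) (φ : ℝ → E n → E n × E n) : Prop :=
  (∀ t ∈ Ici (0:ℝ), TorusEmb σ B (φ t)) ∧
  Tendsto (fun t => holderNormOn σ univ fun q => φ t q - φ₀ q) atTop (𝓝 0) ∧
  ∀ q : E n, ∀ t ∈ Ici (0:ℝ),
    HasDerivWithinAt (fun s => φ s (q + s • ω))
      (X (φ t (q + t • ω)).1 (φ t (q + t • ω)).2 t) (Ici 0) t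

/-- a negative `C^σ`-asymptotic KAM torus. -/
def AsymTorusNeg (σ : ℝ) (B : Set (E n)) (X : E n → E n → ℝ → E n × E n)
    (φ₀ : E n → E n × E n) (ω : E n) (φ : ℝ → E n → E n × E n) : Prop :=
  (∀ t ∈ Iic (0:ℝ), TorusEmb σ B (φ t)) ∧
  Tendsto (fun t => holderNormOn σ univ fun q => φ t q - φ₀ q) atBot (𝓝 0) ∧
  ∀ q : E n, ∀ t ∈ Iic (0:ℝ),
    HasDerivWithinAt (fun s => φ s (q + s • ω))
      (X (φ t (q + t • ω)).1 (φ t (q + t • ω)).2 t) (Iic 0) t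


section Rad
variable {X Y : Type*} [NormedAddCommGroup X] [NormedSpace ℝ X] [FiniteDimensional ℝ X]
  [NormedAddCommGroup Y] [NormedSpace ℝ Y] [FiniteDimensional ℝ Y]

theorem rad_lip {U : Set X} (hU : IsOpen U) (hc : Convex ℝ U) {g : X → Y} {C : ℝ≥0}
    (hg : LipschitzOnWith C g U) {c : ℝ} (hb : ∀ x ∈ U, DifferentiableAt ℝ g x → ‖fderiv ℝ g x‖ ≤ c)
    (hc0 : 0 ≤ c)
    {x y : X} (hx : x ∈ U) (hy : y ∈ U) : ‖g y - g x‖ ≤ c * ‖y - x‖ := by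
  borelize X
  let μ : Measure X := Measure.addHaar
  set v := y - x with hv
  have hN : ∀ᵐ w ∂μ, w ∈ U → DifferentiableAt ℝ g w := by
    filter_upwards [hg.ae_differentiableWithinAt_of_mem (μ := μ)] with w hw hwU
    exact (hw hwU).differentiableAt (hU.mem_nhds hwU)
  let N' : Set X := toMeasurable μ {w | ¬ (w ∈ U → DifferentiableAt ℝ g w)}
  have hN' : μ N' = 0 := by rw [measure_toMeasurable]; exact hN
  have hN'm : MeasurableSet N' := measurableSet_toMeasurable _ _
  have hNs : ∀ w, w ∉ N' → w ∈ U → DifferentiableAt ℝ g w := by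
    intro w hw hwU
    by_contra hcon
    exact hw (subset_toMeasurable _ _ (by simp [hwU, hcon]))
  have h1 : ∀ᵐ z ∂μ, ∀ᵐ s ∂(volume : Measure ℝ), x + z + s • v ∉ N' := by
    rw [Measure.ae_ae_comm (p := fun z s => x + z + s • v ∉ N')]
    · refine Eventually.of_forall fun s => ?_
      have : (fun z => x + z + s • v) ⁻¹' N' = (fun z => z + (x + s • v)) ⁻¹' N' := by
        ext z; simp only [mem_preimage]; rw [show x + z + s • v = z + (x + s • v) by abel]
      rw [ae_iff]
      simp only [not_not]
      change μ ((fun z => x + z + s • v) ⁻¹' N') = 0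
      rw [this, measure_preimage_add_right, hN']
    · have : Measurable (fun p : X × ℝ => x + p.1 + p.2 • v) := by fun_prop
      exact (this hN'm).compl
  have h2 : ∀ᵐ z ∂μ, x + z ∈ U → y + z ∈ U → ‖g (y + z) - g (x + z)‖ ≤ c * ‖v‖ := by
    filter_upwards [h1] with z hz hxz hyz
    obtain ⟨ψ, hψ1, hψ⟩ := exists_dual_vector'' ℝ (g (y + z) - g (x + z))
    let φ : ℝ → ℝ := fun s => ψ (g (x + z + s • v))
    have hseg : ∀ s ∈ Icc (0:ℝ) 1, x + z + s • v ∈ U := by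
      intro s hs
      have := hc hxz hyz (a := 1 - s) (b := s) (by linarith [hs.2]) hs.1 (by ring)
      convert this using 1
      rw [hv]; module
    have hL : LipschitzOnWith (‖ψ‖₊ * (C * ‖v‖₊)) φ (uIcc 0 1) := by
      rw [uIcc_of_le zero_le_one]
      have hA : LipschitzOnWith ‖v‖₊ (fun s : ℝ => x + z + s • v) (Icc 0 1) := by
        refine LipschitzOnWith.of_dist_le_mul fun a _ b _ => ?_
        rw [dist_add_left, dist_eq_norm, ← sub_smul, norm_smul, dist_eq_norm]
        simp [mul_comm]
      exact ψ.lipschitz.comp_lipschitzOnWith (hg.comp hA hseg)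
    have hI := hL.absolutelyContinuousOnInterval.integral_deriv_eq_sub
    have hbd : ‖∫ s in (0:ℝ)..1, deriv φ s‖ ≤ (c * ‖v‖) * |1 - 0| := by
      apply intervalIntegral.norm_integral_le_of_norm_le_const_ae
      filter_upwards [hz] with s hs hsm
      rw [uIoc_of_le zero_le_one] at hsm
      have hsU := hseg s ⟨hsm.1.le, hsm.2⟩
      have hd := hNs _ hs hsU
      have h3 : HasDerivAt (fun s : ℝ => x + z + s • v) v s := by
        simpa using ((hasDerivAt_id s).smul_const v).const_add (x + z)
      have h4 : HasDerivAt φ (ψ (fderiv ℝ g (x + z + s • v) v)) s :=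
        (ψ.hasFDerivAt (x := g (x + z + s • v))).comp_hasDerivAt s
          (hd.hasFDerivAt.comp_hasDerivAt s h3)
      rw [h4.deriv]
      calc ‖ψ (fderiv ℝ g (x + z + s • v) v)‖ ≤ ‖ψ‖ * ‖fderiv ℝ g (x + z + s • v) v‖ := ψ.le_opNorm _
        _ ≤ 1 * (‖fderiv ℝ g (x + z + s • v)‖ * ‖v‖) := by
            gcongr; exact ContinuousLinearMap.le_opNorm _ _
        _ ≤ c * ‖v‖ := by rw [one_mul]; gcongr; exact hb _ hsU hd
    rw [hI] at hbd
    have h5 : φ 1 - φ 0 = ‖g (y + z) - g (x + z)‖ := by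
      simp only [φ]
      rw [← map_sub, one_smul, zero_smul, add_zero, show x + z + v = y + z by rw [hv]; abel, hψ]
      simp
    rw [h5] at hbd
    simpa using hbd
  -- pass to the limit z → 0
  have hcx : ContinuousAt (fun z => g (x + z)) 0 := by
    have : ContinuousAt g (x + 0) := by simpa using hg.continuousOn.continuousAt (hU.mem_nhds hx)
    exact this.comp (by fun_prop)
  have hcy : ContinuousAt (fun z => g (y + z)) 0 := by
    have : ContinuousAt g (y + 0) := by simpa using hg.continuousOn.continuousAt (hU.mem_nhds hy)
    exact this.comp (by fun_prop)
  have hcc : ContinuousAt (fun z => ‖g (y + z) - g (x + z)‖) 0 := (hcy.sub hcx).norm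
  by_contra hcon
  push Not at hcon
  have e1 : ∀ᶠ z in 𝓝 (0:X), c * ‖v‖ < ‖g (y + z) - g (x + z)‖ := by
    apply hcc.eventually (lt_mem_nhds _)
    simpa using hcon
  have e2 : ∀ᶠ z in 𝓝 (0:X), x + z ∈ U := by
    have : ContinuousAt (fun z : X => x + z) 0 := by fun_prop
    exact this.eventually (by simpa using hU.mem_nhds hx)
  have e3 : ∀ᶠ z in 𝓝 (0:X), y + z ∈ U := by
    have : ContinuousAt (fun z : X => y + z) 0 := by fun_prop
    exact this.eventually (by simpa using hU.mem_nhds hy)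
  obtain ⟨V, hV, hVo, hV0⟩ := _root_.eventually_nhds_iff.1 (e1.and (e2.and e3))
  have hpos : 0 < μ V := hVo.measure_pos μ ⟨0, hV0⟩
  have : μ V = 0 := by
    apply measure_mono_null _ h2
    intro z hz
    obtain ⟨a, b, d⟩ := hV z hz
    simp only [mem_compl_iff, mem_setOf_eq]
    intro hh
    exact absurd (hh b d) (not_le.2 a)
  exact hpos.ne' this

theorem rad_diff {U : Set X} (hU : IsOpen U) {g : X → Y}
    (hg : ∀ x ∈ U, ∃ C : ℝ≥0, ∃ t ∈ 𝓝 x, LipschitzOnWith C g t) (hG : ContinuousOn (fderiv ℝ g) U) :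
    DifferentiableOn ℝ g U := by
  intro x hx
  apply DifferentiableAt.differentiableWithinAt
  refine HasFDerivAt.differentiableAt (f' := fderiv ℝ g x) ?_
  obtain ⟨C, t, ht, hL⟩ := hg x hx
  rw [hasFDerivAt_iff_isLittleO, Asymptotics.isLittleO_iff]
  intro c hc
  have hG' : ContinuousAt (fderiv ℝ g) x := hG.continuousAt (hU.mem_nhds hx)
  have e1 : ∀ᶠ y in 𝓝 x, ‖fderiv ℝ g y - fderiv ℝ g x‖ ≤ c := by
    have := Metric.continuousAt_iff'.1 hG' c hc
    filter_upwards [this] with y hy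
    rw [dist_eq_norm] at hy; exact hy.le
  obtain ⟨r, hr, hball⟩ := Metric.eventually_nhds_iff_ball.1 (e1.and (ht : ∀ᶠ y in 𝓝 x, y ∈ t))
  set A := fderiv ℝ g x with hA
  have hL' : LipschitzOnWith (C + ‖A‖₊) (fun y => g y - A y) (ball x r) :=
    (hL.mono fun y hy => (hball y hy).2).sub (A.lipschitz.lipschitzOnWith)
  have hb : ∀ y ∈ ball x r, DifferentiableAt ℝ (fun y => g y - A y) y →
      ‖fderiv ℝ (fun y => g y - A y) y‖ ≤ c := by
    intro y hy hd
    have hdg : DifferentiableAt ℝ g y := by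
      have := hd.add A.differentiableAt
      refine this.congr_of_eventuallyEq (Eventually.of_forall fun z => ?_)
      simp
    rw [fderiv_fun_sub hdg A.differentiableAt, ContinuousLinearMap.fderiv]
    exact (hball y hy).1
  filter_upwards [ball_mem_nhds x hr] with y hy
  have := rad_lip isOpen_ball (convex_ball x r) hL' hb hc.le (mem_ball_self hr) hy
  rwa [show g y - g x - A (y - x) = g y - A y - (g x - A x) by rw [map_sub]; abel]
end Rad


section Half
/-- time weights -/
def bw (m t : ℝ) : ℝ := (1 + |t|) ^ (-m)

theorem bw_pos (m t : ℝ) : 0 < bw m t := Real.rpow_pos_of_pos (by positivity) _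

theorem bw_le_one {m : ℝ} (hm : 0 ≤ m) (t : ℝ) : bw m t ≤ 1 :=
  Real.rpow_le_one_of_one_le_of_nonpos (by linarith [abs_nonneg t]) (by linarith)

theorem bw_add (m a t : ℝ) : bw (m + a) t = bw m t * bw a t := by
  unfold bw; rw [neg_add, Real.rpow_add (by positivity)]

theorem bw_one (t : ℝ) : bw 1 t = (1 + |t|)⁻¹ := by
  unfold bw; rw [Real.rpow_neg_one]

theorem bw_cont (m : ℝ) : Continuous (bw m) := by
  unfold bw
  exact Continuous.rpow_const (by fun_prop) fun t => Or.inl (by positivity)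

theorem bw_integrable {m : ℝ} (hm : 1 < m) : Integrable (bw m) := by
  have := integrable_one_add_norm (E := ℝ) (μ := volume) (r := m) (by simpa using hm)
  exact this

theorem bw_tendsto {m : ℝ} (hm : 0 < m) : Tendsto (bw m) atTop (𝓝 0) := by
  unfold bw
  refine (tendsto_rpow_neg_atTop hm).comp ?_
  exact tendsto_atTop_add_const_left _ _ tendsto_abs_atTop_atTop

theorem bw_tail {m : ℝ} (hm : 1 < m) {t : ℝ} (ht : 0 ≤ t) :
    ∫ s in Ioi t, bw m s = bw (m - 1) t / (m - 1) := by
  have key : ∀ x ∈ Ici t, HasDerivAt (fun s => -((1 + s) ^ (-(m-1)) / (m - 1)))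
      ((1 + x) ^ (-m)) x := by
    intro x hx
    have hx0 : (0:ℝ) ≤ x := le_trans ht hx
    have h1 : HasDerivAt (fun s : ℝ => 1 + s) 1 x := (hasDerivAt_id x).const_add 1
    have h2 := ((h1.rpow_const (p := -(m-1)) (Or.inl (by positivity))).div_const (m-1)).neg
    have h3 : m - 1 ≠ 0 := by linarith
    have h4 : -(1 * -(m - 1) * (1 + x) ^ (-(m - 1) - 1) / (m - 1)) = (1 + x) ^ (-m) := by
      rw [show -(m - 1) - 1 = -m by ring]
      field_simp
    rw [h4] at h2
    exact h2
  have hlim : Tendsto (fun s : ℝ => -((1 + s) ^ (-(m-1)) / (m - 1))) atTop (𝓝 (-(0 / (m-1)))) := by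
    refine Tendsto.neg (Tendsto.div_const ?_ _)
    exact (tendsto_rpow_neg_atTop (by linarith)).comp (tendsto_atTop_add_const_left _ _ tendsto_id)
  have heq : EqOn (bw m) (fun s => (1 + s) ^ (-m)) (Ioi t) := by
    intro s hs
    simp only [bw]; rw [abs_of_nonneg (le_trans ht (le_of_lt hs))]
  have := integral_Ioi_of_hasDerivAt_of_tendsto' key
    ((bw_integrable hm).integrableOn.congr_fun heq measurableSet_Ioi) hlim
  rw [setIntegral_congr_fun measurableSet_Ioi heq, this, bw, abs_of_nonneg ht]
  ring

variable {X : Type*} [NormedAddCommGroup X] [NormedSpace ℝ X]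

/-- weighted tail integral -/
def Jop (m : ℝ) (φ : ℝ → X) (t : ℝ) : X := ∫ s in Ioi t, bw m s • φ s

theorem Jop_integrable {m : ℝ} (hm : 1 < m) {φ : ℝ → X} (hφ : Continuous φ) {B : ℝ}
    (hB : ∀ s, ‖φ s‖ ≤ B) : Integrable (fun s => bw m s • φ s) :=
  (bw_integrable hm).smul_bdd B hφ.aestronglyMeasurable (Eventually.of_forall hB)

theorem Jop_norm {m : ℝ} (hm : 1 < m) {φ : ℝ → X}  {B : ℝ}
    (hB : ∀ s, ‖φ s‖ ≤ B) {t : ℝ} (ht : 0 ≤ t) : ‖Jop m φ t‖ ≤ bw (m - 1) t / (m - 1) * B := by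
  rw [← bw_tail hm ht, ← integral_mul_const]
  refine norm_integral_le_of_norm_le ((bw_integrable hm).integrableOn.mul_const B) ?_
  refine Eventually.of_forall fun s => ?_
  rw [norm_smul, Real.norm_of_nonneg (bw_pos m s).le]
  exact mul_le_mul_of_nonneg_left (hB s) (bw_pos m s).le

theorem Jop_sub {m : ℝ} (hm : 1 < m) {φ ψ : ℝ → X} (hφ : Continuous φ) (hψ : Continuous ψ) {B B' : ℝ}
    (hB : ∀ s, ‖φ s‖ ≤ B) (hB' : ∀ s, ‖ψ s‖ ≤ B') (t : ℝ) :
    Jop m φ t - Jop m ψ t = Jop m (fun s => φ s - ψ s) t := by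
  unfold Jop
  rw [← integral_sub (Jop_integrable hm hφ hB).integrableOn (Jop_integrable hm hψ hB').integrableOn]
  simp only [smul_sub]

theorem Jop_deriv [CompleteSpace X] {m : ℝ} (hm : 1 < m) {φ : ℝ → X} (hφ : Continuous φ) {B : ℝ}
    (hB : ∀ s, ‖φ s‖ ≤ B) (t : ℝ) : HasDerivAt (Jop m φ) (-(bw m t • φ t)) t := by
  have hi := Jop_integrable hm hφ hB
  have hc : Continuous (fun s => bw m s • φ s) := (bw_cont m).smul hφ
  have heq : Jop m φ = fun t => (∫ s in Ioi (0:ℝ), bw m s • φ s) - ∫ s in (0:ℝ)..t, bw m s • φ s := by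
    funext t
    unfold Jop
    rw [← intervalIntegral.integral_interval_add_Ioi (a := 0) (b := t) hi.integrableOn hi.integrableOn]
    abel
  rw [heq]
  exact (intervalIntegral.integral_hasDerivAt_right (hc.intervalIntegrable _ _)
    hc.stronglyMeasurable.stronglyMeasurableAtFilter hc.continuousAt).const_sub _

theorem Jop_tendsto {m : ℝ} (hm : 1 < m) {φ : ℝ → X}  {B : ℝ}
    (hB : ∀ s, ‖φ s‖ ≤ B) : Tendsto (Jop m φ) atTop (𝓝 0) := by
  have h : Tendsto (fun t => bw (m - 1) t / (m - 1) * B) atTop (𝓝 0) := by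
    simpa using ((bw_tendsto (m := m - 1) (by linarith)).div_const (m-1)).mul_const B
  refine squeeze_zero_norm' ?_ h
  filter_upwards [eventually_ge_atTop 0] with t ht using Jop_norm hm hB ht

/-- radial retraction -/
def retr (r : ℝ) (x : X) : X := (r / max r ‖x‖) • x

theorem retr_norm {r : ℝ} (hr : 0 < r) (x : X) : ‖retr r x‖ ≤ r := by
  have h : 0 < max r ‖x‖ := lt_max_of_lt_left hr
  rw [retr, norm_smul, Real.norm_of_nonneg (by positivity), div_mul_eq_mul_div, div_le_iff₀ h]
  exact mul_le_mul_of_nonneg_left (le_max_right _ _) hr.le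

theorem retr_eq {r : ℝ} (hr : 0 < r) {x : X} (hx : ‖x‖ ≤ r) : retr r x = x := by
  rw [retr, max_eq_left hx, div_self hr.ne', one_smul]

theorem retr_lip {r : ℝ} (hr : 0 < r) (x y : X) : ‖retr r x - retr r y‖ ≤ 2 * ‖x - y‖ := by
  have hx : 0 < max r ‖x‖ := lt_max_of_lt_left hr
  have hy : 0 < max r ‖y‖ := lt_max_of_lt_left hr
  have e : retr r x - retr r y = (r / max r ‖x‖) • (x - y)
      + (r / max r ‖x‖ - r / max r ‖y‖) • y := by unfold retr; module
  have h1 : r / max r ‖x‖ ≤ 1 := (div_le_one hx).2 (le_max_left _ _)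
  have h2 : ‖y‖ / max r ‖y‖ ≤ 1 := (div_le_one hy).2 (le_max_right _ _)
  have h3 : |max r ‖y‖ - max r ‖x‖| ≤ ‖x - y‖ := by
    rw [max_comm r ‖y‖, max_comm r ‖x‖, norm_sub_rev]
    exact (abs_max_sub_max_le_abs _ _ _ ).trans (abs_norm_sub_norm_le y x)
  have h4 : ‖(r / max r ‖x‖ - r / max r ‖y‖) • y‖ ≤ ‖x - y‖ := by
    rw [norm_smul, Real.norm_eq_abs]
    have : r / max r ‖x‖ - r / max r ‖y‖ = (r / max r ‖x‖) * ((max r ‖y‖ - max r ‖x‖) / max r ‖y‖) := by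
      field_simp
    rw [this, abs_mul, abs_of_nonneg (by positivity : 0 ≤ r / max r ‖x‖), abs_div, abs_of_pos hy]
    calc r / max r ‖x‖ * (|max r ‖y‖ - max r ‖x‖| / max r ‖y‖) * ‖y‖
        = r / max r ‖x‖ * |max r ‖y‖ - max r ‖x‖| * (‖y‖ / max r ‖y‖) := by ring
      _ ≤ 1 * ‖x - y‖ * 1 := by gcongr
      _ = _ := by ring
  have h5 : ‖(r / max r ‖x‖) • (x - y)‖ ≤ ‖x - y‖ := by
    rw [norm_smul, Real.norm_of_nonneg (by positivity)]
    exact mul_le_of_le_one_left (norm_nonneg _) h1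
  rw [e]
  calc _ ≤ _ := norm_add_le _ _
    _ ≤ _ := by linarith
end Half


section Half2
variable {X : Type*} [NormedAddCommGroup X] [NormedSpace ℝ X]

/-- hypotheses of the forward lemma -/
structure HF (l K C M ε : ℝ) (D : Set X) (ω : X → X) (F G : X → X → X → ℝ → X) : Prop where
  om : ∀ p ∈ D, ∀ p' ∈ D, ‖ω p - ω p'‖ ≤ K * ‖p - p'‖
  cF : ∀ p ∈ D, ContinuousOn (fun x : X × X × ℝ => F x.1 p x.2.1 x.2.2)
    {x | 0 ≤ x.2.2 ∧ ‖x.2.1‖ ≤ ε * M * bw (l + 1) x.2.2}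
  cG : ∀ p ∈ D, ContinuousOn (fun x : X × X × ℝ => G x.1 p x.2.1 x.2.2)
    {x | 0 ≤ x.2.2 ∧ ‖x.2.1‖ ≤ ε * M * bw (l + 1) x.2.2}
  bF : ∀ p ∈ D, ∀ q η t, 0 ≤ t → ‖η‖ ≤ ε * M * bw (l + 1) t → ‖F q p η t‖ ≤ ε * C * bw (l + 1) t
  bG : ∀ p ∈ D, ∀ q η t, 0 ≤ t → ‖η‖ ≤ ε * M * bw (l + 1) t → ‖G q p η t‖ ≤ ε * M * bw (l + 2) t
  dF : ∀ p ∈ D, ∀ p' ∈ D, ∀ q q' η η' t, 0 ≤ t → ‖η‖ ≤ ε * M * bw (l + 1) t →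
    ‖η'‖ ≤ ε * M * bw (l + 1) t →
    ‖F q p η t - F q' p' η' t‖ ≤ C * ‖η - η'‖ + ε * C * (bw (l + 1) t * ‖q - q'‖ + bw l t * ‖p - p'‖)
  dG : ∀ p ∈ D, ∀ p' ∈ D, ∀ q q' η η' t, 0 ≤ t → ‖η‖ ≤ ε * M * bw (l + 1) t →
    ‖η'‖ ≤ ε * M * bw (l + 1) t →
    ‖G q p η t - G q' p' η' t‖ ≤
      ε * C * (bw (l + 2) t * ‖q - q'‖ + bw (l + 1) t * (‖p - p'‖ + ‖η - η'‖))

theorem retr_cont {Y : Type*} [TopologicalSpace Y] {r : Y → ℝ} {g : Y → X} (hr : Continuous r)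
    (h0 : ∀ y, 0 < r y) (hg : Continuous g) : Continuous fun y => retr (r y) (g y) := by
  unfold retr
  refine Continuous.smul (hr.div (hr.max hg.norm) fun y => ?_) hg
  exact (lt_max_of_lt_left (h0 y)).ne'

theorem half_T [CompleteSpace X] {l K C M ε : ℝ} (hl : 1 < l) (hC : 1 ≤ C) (hM : 0 < M)
    (hε : 0 < ε) {D : Set X}
    {ω : X → X} {F G : X → X → X → ℝ → X} (hF : HF l K C M ε D ω F G)
    (q : X) {p : X} (hp : p ∈ D) (Ψ : BoundedContinuousFunction ℝ (X × X)) :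
    ∃ T : BoundedContinuousFunction ℝ (X × X), ∀ t, T t =
      ((ε * (8 * C) * bw l (max t 0))⁻¹ • F (q + (max t 0) • ω p -
          (ε * (8 * C)) • Jop l (fun s => (Ψ s).1) (max t 0)) p
          (retr (ε * M * bw (l + 1) (max t 0)) (- ε • Jop (l + 1) (fun s => (Ψ s).2) (max t 0))) (max t 0),
       (ε * bw (l + 1) (max t 0))⁻¹ • G (q + (max t 0) • ω p -
          (ε * (8 * C)) • Jop l (fun s => (Ψ s).1) (max t 0)) p
          (retr (ε * M * bw (l + 1) (max t 0)) (- ε • Jop (l + 1) (fun s => (Ψ s).2) (max t 0))) (max t 0)) := by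
  have hb : ∀ s, ‖Ψ s‖ ≤ ‖Ψ‖ := Ψ.norm_coe_le_norm
  have hΨc := Ψ.continuous
  have c1 : Continuous (Jop l (fun s => (Ψ s).1)) := by
    rw [continuous_iff_continuousAt]; intro t
    exact (Jop_deriv hl (by fun_prop) (B := ‖Ψ‖) (fun s => (norm_fst_le _).trans (hb s)) t).continuousAt
  have c2 : Continuous (Jop (l + 1) (fun s => (Ψ s).2)) := by
    rw [continuous_iff_continuousAt]; intro t
    exact (Jop_deriv (by linarith) (by fun_prop) (B := ‖Ψ‖)
      (fun s => (norm_snd_le _).trans (hb s)) t).continuousAt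
  have cm : Continuous (fun t : ℝ => max t 0) := by fun_prop
  have hrp : ∀ t, 0 < ε * M * bw (l + 1) (max t 0) := fun t => by have := bw_pos (l+1) (max t 0); positivity
  have carg : Continuous (fun t : ℝ => ((q + (max t 0) • ω p -
          (ε * (8 * C)) • Jop l (fun s => (Ψ s).1) (max t 0)),
          (retr (ε * M * bw (l + 1) (max t 0)) (- ε • Jop (l + 1) (fun s => (Ψ s).2) (max t 0))), (max t 0))) := by
    refine Continuous.prodMk ?_ (Continuous.prodMk ?_ cm)
    · exact (continuous_const.add (cm.smul continuous_const)).sub ((c1.comp cm).const_smul _)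
    · exact retr_cont (((bw_cont (l+1)).comp cm).const_mul _) hrp ((c2.comp cm).const_smul _)
  have hmem : ∀ t, ((q + (max t 0) • ω p -
          (ε * (8 * C)) • Jop l (fun s => (Ψ s).1) (max t 0)),
          (retr (ε * M * bw (l + 1) (max t 0)) (- ε • Jop (l + 1) (fun s => (Ψ s).2) (max t 0))), (max t 0)) ∈
        {x : X × X × ℝ | 0 ≤ x.2.2 ∧ ‖x.2.1‖ ≤ ε * M * bw (l + 1) x.2.2} := fun t =>
    ⟨le_max_right _ _, retr_norm (hrp t) _⟩
  have cF := (hF.cF p hp).comp_continuous carg hmem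
  have cG := (hF.cG p hp).comp_continuous carg hmem
  refine ⟨BoundedContinuousFunction.ofNormedAddCommGroup _ ?_ (C + M) ?_, fun t => rfl⟩
  · refine Continuous.prodMk (Continuous.smul ?_ cF) (Continuous.smul ?_ cG)
    · refine Continuous.inv₀ (((bw_cont l).comp cm).const_mul _) fun t => ?_
      have := bw_pos l (max t 0); positivity
    · refine Continuous.inv₀ (((bw_cont _).comp cm).const_mul _) fun t => ?_
      have := bw_pos (l+1) (max t 0); positivity
  · intro t
    have h1 := hF.bF p hp (q + (max t 0) • ω p -
          (ε * (8 * C)) • Jop l (fun s => (Ψ s).1) (max t 0)) _ _ (hmem t).1 (hmem t).2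
    have h2 := hF.bG p hp (q + (max t 0) • ω p -
          (ε * (8 * C)) • Jop l (fun s => (Ψ s).1) (max t 0)) _ _ (hmem t).1 (hmem t).2
    have b0 := bw_pos l (max t 0)
    have b1 := bw_pos (l+1) (max t 0)
    have e1 := bw_add l 1 (max t 0)
    have e2 := bw_add (l+1) 1 (max t 0)
    rw [show l + 1 + 1 = l + 2 by ring] at e2
    have u := bw_le_one (m := 1) zero_le_one (max t 0)
    refine norm_prod_le_iff.2 ⟨?_, ?_⟩
    · rw [norm_smul, norm_inv, Real.norm_of_nonneg (by positivity), inv_mul_le_iff₀ (by positivity)]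
      refine h1.trans ?_
      rw [e1]
      calc ε * C * (bw l (max t 0) * bw 1 (max t 0)) ≤ ε * C * (bw l (max t 0) * 1) := by gcongr
        _ = ε * (1 * C) * bw l (max t 0) * 1 := by ring
        _ ≤ ε * (8 * C) * bw l (max t 0) * (C + M) := by gcongr <;> linarith
    · rw [norm_smul, norm_inv, Real.norm_of_nonneg (by positivity), inv_mul_le_iff₀ (by positivity)]
      refine h2.trans ?_
      rw [e2]
      calc ε * M * (bw (l+1) (max t 0) * bw 1 (max t 0)) ≤ ε * M * (bw (l+1) (max t 0) * 1) := by gcongr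
        _ = ε * bw (l+1) (max t 0) * M := by ring
        _ ≤ ε * bw (l+1) (max t 0) * (C + M) := by gcongr; linarith

/-- pointwise difference estimate -/
theorem half_est {l K C M ε : ℝ} (hl : 1 < l) (hC : 1 ≤ C) (hK : 0 ≤ K)
    (hε : 0 < ε) (hε1 : ε * (C * (8 * C / (l - 1) + 2)) ≤ 1 / 4) {D : Set X}
    {ω : X → X} {F G : X → X → X → ℝ → X} (hF : HF l K C M ε D ω F G)
    {q q' p p' : X} (hp : p ∈ D) (hp' : p' ∈ D) {x x' y y' : X} {t d δ : ℝ} (ht : 0 ≤ t)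
    (hq : ‖q - q'‖ ≤ d) (hpd : ‖p - p'‖ ≤ d)
    (hy : ‖y‖ ≤ ε * M * bw (l + 1) t) (hy' : ‖y'‖ ≤ ε * M * bw (l + 1) t)
    (hx : ‖x - x'‖ ≤ ε * (8 * C) / (l - 1) * δ) (hyy : ‖y - y'‖ ≤ 2 * ε * bw l t * δ) (hδ : 0 ≤ δ) :
    ‖(ε * (8 * C) * bw l t)⁻¹ • F (q + t • ω p - x) p y t -
      (ε * (8 * C) * bw l t)⁻¹ • F (q' + t • ω p' - x') p' y' t‖ ≤ C * (2 + K) * d + δ / 2 ∧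
    ‖(ε * bw (l + 1) t)⁻¹ • G (q + t • ω p - x) p y t -
      (ε * bw (l + 1) t)⁻¹ • G (q' + t • ω p' - x') p' y' t‖ ≤ C * (2 + K) * d + δ / 2 := by
  have hd : 0 ≤ d := (norm_nonneg _).trans hq
  have hl1 : 0 < l - 1 := by linarith
  have b0 := bw_pos l t
  have b1 := bw_pos (l+1) t
  have b2 := bw_pos 1 t
  have e1 := bw_add l 1 t
  have e2 := bw_add (l+1) 1 t
  rw [show l + 1 + 1 = l + 2 by ring] at e2
  have u := bw_le_one (m := 1) zero_le_one t
  have u0 := bw_le_one (m := l) (by linarith) t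
  have ut : bw 1 t * t ≤ 1 := by
    rw [bw_one, abs_of_nonneg ht, inv_mul_le_iff₀ (by positivity)]; linarith
  have hQ : ‖(q + t • ω p - x) - (q' + t • ω p' - x')‖ ≤ d + t * (K * d) + ε * (8 * C) / (l - 1) * δ := by
    rw [show (q + t • ω p - x) - (q' + t • ω p' - x') = (q - q') + t • (ω p - ω p') - (x - x') by module]
    refine (norm_sub_le _ _).trans (add_le_add ((norm_add_le _ _).trans (add_le_add hq ?_)) hx)
    rw [norm_smul, Real.norm_of_nonneg ht]
    have := hF.om p hp p' hp'
    gcongr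
    exact this.trans (by gcongr)
  have hQ' : bw 1 t * ‖(q + t • ω p - x) - (q' + t • ω p' - x')‖ ≤ (1 + K) * d + ε * (8 * C) / (l - 1) * δ := by
    calc bw 1 t * ‖(q + t • ω p - x) - (q' + t • ω p' - x')‖
        ≤ bw 1 t * (d + t * (K * d) + ε * (8 * C) / (l - 1) * δ) := by gcongr
      _ = bw 1 t * (d + ε * (8 * C) / (l - 1) * δ) + (bw 1 t * t) * (K * d) := by ring
      _ ≤ 1 * (d + ε * (8 * C) / (l - 1) * δ) + 1 * (K * d) := by gcongr
      _ = _ := by ring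
  have k1 : ε * (C * (8 * C / (l - 1) + 2)) * δ ≤ 1 / 4 * δ := by gcongr
  have k2 : ε * (8 * C) / (l - 1) * δ * C + 2 * ε * δ * C ≤ δ / 4 := by
    have : ε * (8 * C) / (l - 1) * δ * C + 2 * ε * δ * C = ε * (C * (8 * C / (l - 1) + 2)) * δ := by ring
    linarith
  have k3 : 0 ≤ ε * (8 * C) / (l - 1) * δ := by positivity
  have k4 : 0 ≤ 2 * ε * δ * C := by positivity
  constructor
  · rw [← smul_sub, norm_smul, norm_inv, Real.norm_of_nonneg (by positivity), inv_mul_le_iff₀ (by positivity)]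
    refine (hF.dF p hp p' hp' _ _ _ _ t ht hy hy').trans ?_
    rw [e1]
    calc C * ‖y - y'‖ + ε * C * (bw l t * bw 1 t * ‖(q + t • ω p - x) - (q' + t • ω p' - x')‖ + bw l t * ‖p - p'‖)
        = C * ‖y - y'‖ + ε * C * bw l t * (bw 1 t * ‖(q + t • ω p - x) - (q' + t • ω p' - x')‖ + ‖p - p'‖) := by ring
      _ ≤ C * (2 * ε * bw l t * δ) + ε * C * bw l t * ((1 + K) * d + ε * (8 * C) / (l - 1) * δ + d) := by gcongr
      _ = ε * (8 * C) * bw l t * (δ / 4 + ((2 + K) * d + ε * (8 * C) / (l - 1) * δ) / 8) := by ring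
      _ ≤ ε * (8 * C) * bw l t * (C * (2 + K) * d + δ / 2) := by
          have a1 : (2 + K) * d ≤ C * (2 + K) * d := by
            rw [mul_assoc]; exact le_mul_of_one_le_left (by positivity) hC
          have a2 : ε * (8 * C) / (l - 1) * δ ≤ ε * (8 * C) / (l - 1) * δ * C := le_mul_of_one_le_right k3 hC
          have a3 : 0 ≤ (2 + K) * d := by positivity
          refine mul_le_mul_of_nonneg_left ?_ (by positivity)
          linarith
  · rw [← smul_sub, norm_smul, norm_inv, Real.norm_of_nonneg (by positivity), inv_mul_le_iff₀ (by positivity)]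
    refine (hF.dG p hp p' hp' _ _ _ _ t ht hy hy').trans ?_
    rw [e2]
    have a1 : ‖y - y'‖ ≤ 2 * ε * δ := hyy.trans (by
      calc 2 * ε * bw l t * δ ≤ 2 * ε * 1 * δ := by gcongr
        _ = _ := by ring)
    calc ε * C * (bw (l+1) t * bw 1 t * ‖(q + t • ω p - x) - (q' + t • ω p' - x')‖ + bw (l+1) t * (‖p - p'‖ + ‖y - y'‖))
        = ε * C * bw (l+1) t * (bw 1 t * ‖(q + t • ω p - x) - (q' + t • ω p' - x')‖ + (‖p - p'‖ + ‖y - y'‖)) := by ring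
      _ ≤ ε * C * bw (l+1) t * ((1 + K) * d + ε * (8 * C) / (l - 1) * δ + (d + 2 * ε * δ)) := by gcongr
      _ = ε * bw (l+1) t * (C * (2 + K) * d + (ε * (8 * C) / (l - 1) * δ * C + 2 * ε * δ * C)) := by ring
      _ ≤ ε * bw (l+1) t * (C * (2 + K) * d + δ / 2) := by gcongr; linarith

theorem half [CompleteSpace X] {l K C M : ℝ} (hl : 1 < l) (hC : 1 ≤ C) (hM : 0 < M) (hK : 0 ≤ K) :
    ∃ A > 0, ∀ ε : ℝ, 0 < ε → ε * (C * (8 * C / (l - 1) + 2)) ≤ 1 / 4 →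
    ∀ (D : Set X) (ω : X → X) (F G : X → X → X → ℝ → X), HF l K C M ε D ω F G →
    ∃ ξ η : X → X → ℝ → X, ∀ p ∈ D, ∀ q,
      (∀ t, 0 ≤ t → ‖η q p t‖ ≤ ε * M * bw (l + 1) t) ∧
      (∀ t, 0 ≤ t → HasDerivAt (ξ q p) (F (q + t • ω p + ξ q p t) p (η q p t) t) t) ∧
      (∀ t, 0 ≤ t → HasDerivAt (η q p) (G (q + t • ω p + ξ q p t) p (η q p t) t) t) ∧
      Tendsto (ξ q p) atTop (𝓝 0) ∧ Tendsto (η q p) atTop (𝓝 0) ∧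
      ‖ξ q p 0‖ ≤ ε * A ∧
      ∀ p' ∈ D, ∀ q', ‖ξ q p 0 - ξ q' p' 0‖ ≤ ε * A * max ‖q - q'‖ ‖p - p'‖ ∧
        ‖η q p 0 - η q' p' 0‖ ≤ ε * A * max ‖q - q'‖ ‖p - p'‖ := by
  have hl1 : 0 < l - 1 := by linarith
  refine ⟨(8 * C) / (l - 1) * (C + M) + (8 * C / (l - 1) + 1) * (2 * (C * (2 + K))), by positivity, ?_⟩
  intro ε hε hε1 D ω F G hF
  have hT := fun q p hp Ψ => half_T hl hC hM hε hF q (p := p) hp Ψ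
  choose T hT using hT
  have hrp : ∀ t, 0 < ε * M * bw (l + 1) t := fun t => by have := bw_pos (l+1) t; positivity
  -- main estimate
  have jd : ∀ {m : ℝ}, 1 < m → ∀ {φ ψ : ℝ → X}, Continuous φ → Continuous ψ → ∀ {B B' δ : ℝ},
      (∀ s, ‖φ s‖ ≤ B) → (∀ s, ‖ψ s‖ ≤ B') → (∀ s, ‖φ s - ψ s‖ ≤ δ) → ∀ t, 0 ≤ t →
      ‖Jop m φ t - Jop m ψ t‖ ≤ bw (m - 1) t / (m - 1) * δ := by
    intro m hm φ ψ hφ hψ B B' δ h1 h2 h3 t ht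
    rw [Jop_sub hm hφ hψ h1 h2]
    exact Jop_norm hm h3 ht
  have jdΨ : ∀ Ψ Ψ' : BoundedContinuousFunction ℝ (X × X), ∀ t, 0 ≤ t →
      ‖(ε * (8 * C)) • Jop l (fun s => (Ψ s).1) t - (ε * (8 * C)) • Jop l (fun s => (Ψ' s).1) t‖
        ≤ ε * (8 * C) / (l - 1) * dist Ψ Ψ' ∧
      ‖-ε • Jop (l+1) (fun s => (Ψ s).2) t - -ε • Jop (l+1) (fun s => (Ψ' s).2) t‖
        ≤ ε * bw l t * dist Ψ Ψ' := by
    intro Ψ Ψ' t ht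
    have hd : ∀ s, ‖Ψ s - Ψ' s‖ ≤ dist Ψ Ψ' := fun s => by
      rw [← dist_eq_norm]; exact BoundedContinuousFunction.dist_coe_le_dist s
    have a1 := jd hl (φ := fun s => (Ψ s).1) (ψ := fun s => (Ψ' s).1) (by fun_prop) (by fun_prop)
      (B := ‖Ψ‖) (B' := ‖Ψ'‖) (δ := dist Ψ Ψ') (fun s => (norm_fst_le _).trans (Ψ.norm_coe_le_norm s))
      (fun s => (norm_fst_le _).trans (Ψ'.norm_coe_le_norm s))
      (fun s => (norm_fst_le (Ψ s - Ψ' s)).trans (hd s)) t ht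
    have a2 := jd (m := l + 1) (by linarith) (φ := fun s => (Ψ s).2) (ψ := fun s => (Ψ' s).2) (by fun_prop) (by fun_prop)
      (B := ‖Ψ‖) (B' := ‖Ψ'‖) (δ := dist Ψ Ψ') (fun s => (norm_snd_le _).trans (Ψ.norm_coe_le_norm s))
      (fun s => (norm_snd_le _).trans (Ψ'.norm_coe_le_norm s))
      (fun s => (norm_snd_le (Ψ s - Ψ' s)).trans (hd s)) t ht
    have hdd : 0 ≤ dist Ψ Ψ' := dist_nonneg
    constructor
    · rw [← smul_sub, norm_smul, Real.norm_of_nonneg (by positivity)]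
      have := bw_le_one (m := l - 1) hl1.le t
      calc _ ≤ ε * (8 * C) * (bw (l - 1) t / (l - 1) * dist Ψ Ψ') := by gcongr
        _ ≤ ε * (8 * C) * (1 / (l - 1) * dist Ψ Ψ') := by gcongr
        _ = _ := by ring
    · rw [← smul_sub, norm_smul, norm_neg, Real.norm_of_nonneg hε.le]
      rw [show l + 1 - 1 = l by ring] at a2
      have b := bw_pos l t
      calc _ ≤ ε * (bw l t / l * dist Ψ Ψ') := by gcongr
        _ ≤ ε * (bw l t * dist Ψ Ψ') := by
            gcongr; exact div_le_self b.le hl.le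
        _ = _ := by ring
  have main : ∀ q p (hp : p ∈ D) q' p' (hp' : p' ∈ D) (Ψ Ψ'),
      dist (T q p hp Ψ) (T q' p' hp' Ψ') ≤ C * (2 + K) * max ‖q - q'‖ ‖p - p'‖ + dist Ψ Ψ' / 2 := by
    intro q p hp q' p' hp' Ψ Ψ'
    refine (BoundedContinuousFunction.dist_le (by positivity)).2 fun t => ?_
    rw [hT, hT, dist_eq_norm, Prod.mk_sub_mk]
    set τ := max t 0 with hτ
    have h0 : 0 ≤ τ := le_max_right _ _
    obtain ⟨j1, j2⟩ := jdΨ Ψ Ψ' τ h0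
    have := half_est hl hC hK hε hε1 hF (q := q) (q' := q') hp hp' h0 (le_max_left _ _) (le_max_right ‖q - q'‖ ‖p - p'‖)
      (retr_norm (hrp τ) (-ε • Jop (l+1) (fun s => (Ψ s).2) τ))
      (retr_norm (hrp τ) (-ε • Jop (l+1) (fun s => (Ψ' s).2) τ)) j1 (δ := dist Ψ Ψ')
      (by refine (retr_lip (hrp τ) _ _).trans ?_
          calc _ ≤ 2 * (ε * bw l τ * dist Ψ Ψ') := by gcongr
            _ = _ := by ring) dist_nonneg
    exact norm_prod_le_iff.2 this
  have hcon : ∀ q p hp, ContractingWith (1/2) (T q p hp) := by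
    intro q p hp
    refine ⟨by rw [← NNReal.coe_lt_coe]; norm_num, LipschitzWith.of_dist_le_mul fun Ψ Ψ' => ?_⟩
    have := main q p hp q p hp Ψ Ψ'
    simp only [sub_self, norm_zero, max_self, mul_zero, zero_add] at this
    refine this.trans (le_of_eq ?_)
    norm_num; ring
  have hfix : ∀ q p, ∃ Ψ, ∀ hp : p ∈ D, T q p hp Ψ = Ψ := by
    intro q p
    by_cases hp : p ∈ D
    · exact ⟨(hcon q p hp).fixedPoint, fun _ => (hcon q p hp).fixedPoint_isFixedPt⟩
    · exact ⟨0, fun h => absurd h hp⟩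
  choose Φ hΦ using hfix
  have hlip : ∀ q, ∀ p ∈ D, ∀ q', ∀ p' ∈ D,
      dist (Φ q p) (Φ q' p') ≤ 2 * (C * (2 + K)) * max ‖q - q'‖ ‖p - p'‖ := by
    intro q p hp q' p' hp'
    have := main q p hp q' p' hp' (Φ q p) (Φ q' p')
    rw [hΦ, hΦ] at this
    linarith
  have hval : ∀ q, ∀ p ∈ D, ∀ t, 0 ≤ t → Φ q p t =
      ((ε * (8 * C) * bw l t)⁻¹ • F (q + t • ω p -
          (ε * (8 * C)) • Jop l (fun s => (Φ q p s).1) t) p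
          (retr (ε * M * bw (l + 1) t) (- ε • Jop (l + 1) (fun s => (Φ q p s).2) t)) t,
       (ε * bw (l + 1) t)⁻¹ • G (q + t • ω p -
          (ε * (8 * C)) • Jop l (fun s => (Φ q p s).1) t) p
          (retr (ε * M * bw (l + 1) t) (- ε • Jop (l + 1) (fun s => (Φ q p s).2) t)) t) := by
    intro q p hp t ht
    have := hT q p hp (Φ q p) t
    rw [hΦ, max_eq_left ht] at this
    exact this
  have hη : ∀ q, ∀ p ∈ D, ∀ t, 0 ≤ t → ‖- ε • Jop (l + 1) (fun s => (Φ q p s).2) t‖ ≤ ε * M * bw (l+1) t := by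
    intro q p hp t ht
    have e : -ε • Jop (l+1) (fun s => (Φ q p s).2) t =
        - ∫ s in Ioi t, G (q + s • ω p -
          (ε * (8 * C)) • Jop l (fun s => (Φ q p s).1) s) p
          (retr (ε * M * bw (l + 1) s) (- ε • Jop (l + 1) (fun s => (Φ q p s).2) s)) s := by
      rw [neg_smul, Jop, ← integral_smul]
      congr 1
      refine setIntegral_congr_fun measurableSet_Ioi fun s hs => ?_
      have hs0 : 0 ≤ s := ht.trans (le_of_lt hs)
      have b := bw_pos (l+1) s
      rw [hval q p hp s hs0]
      simp only [smul_smul]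
      rw [show ε * (bw (l + 1) s * (ε * bw (l + 1) s)⁻¹) = 1 by field_simp, one_smul]
    rw [e, norm_neg]
    have : ∀ s ∈ Ioi t, ‖G (q + s • ω p -
          (ε * (8 * C)) • Jop l (fun s => (Φ q p s).1) s) p
          (retr (ε * M * bw (l + 1) s) (- ε • Jop (l + 1) (fun s => (Φ q p s).2) s)) s‖ ≤ ε * M * bw (l + 2) s := by
      intro s hs
      exact hF.bG p hp _ _ s (ht.trans (le_of_lt hs)) (retr_norm (hrp s) _)
    refine (norm_integral_le_of_norm_le (((bw_integrable (m := l + 2) (by linarith)).const_mul (ε * M)).integrableOn)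
      ((ae_restrict_iff' measurableSet_Ioi).2 (Eventually.of_forall this))).trans ?_
    rw [integral_const_mul, bw_tail (by linarith) ht, show l + 2 - 1 = l + 1 by ring]
    gcongr
    exact div_le_self (bw_pos _ _).le (by linarith)
  have bΦ : ∀ q p, ∀ s, ‖Φ q p s‖ ≤ ‖Φ q p‖ := fun q p s => (Φ q p).norm_coe_le_norm s
  have nΦ : ∀ q, ∀ p ∈ D, ∀ s, ‖(Φ q p s)‖ ≤ C + M := by
    intro q p hp s
    have h0 := hT q p hp (Φ q p) s
    rw [hΦ q p hp] at h0
    set t := max s 0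
    have ht : 0 ≤ t := le_max_right _ _
    have h1 := hF.bF p hp (q + t • ω p - (ε * (8 * C)) • Jop l (fun s => (Φ q p s).1) t) _ t ht
      (retr_norm (hrp t) (- ε • Jop (l + 1) (fun s => (Φ q p s).2) t))
    have h2 := hF.bG p hp (q + t • ω p - (ε * (8 * C)) • Jop l (fun s => (Φ q p s).1) t) _ t ht
      (retr_norm (hrp t) (- ε • Jop (l + 1) (fun s => (Φ q p s).2) t))
    have b0 := bw_pos l t
    have b1 := bw_pos (l+1) t
    have e1 := bw_add l 1 t
    have e2 := bw_add (l+1) 1 t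
    rw [show l + 1 + 1 = l + 2 by ring] at e2
    have u := bw_le_one (m := 1) zero_le_one t
    rw [h0]
    refine norm_prod_le_iff.2 ⟨?_, ?_⟩
    · rw [norm_smul, norm_inv, Real.norm_of_nonneg (by positivity), inv_mul_le_iff₀ (by positivity)]
      refine h1.trans ?_
      rw [e1]
      calc ε * C * (bw l t * bw 1 t) ≤ ε * C * (bw l t * 1) := by gcongr
        _ = ε * (1 * C) * bw l t * 1 := by ring
        _ ≤ ε * (8 * C) * bw l t * (C + M) := by gcongr <;> linarith
    · rw [norm_smul, norm_inv, Real.norm_of_nonneg (by positivity), inv_mul_le_iff₀ (by positivity)]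
      refine h2.trans ?_
      rw [e2]
      calc ε * M * (bw (l+1) t * bw 1 t) ≤ ε * M * (bw (l+1) t * 1) := by gcongr
        _ = ε * bw (l+1) t * M := by ring
        _ ≤ ε * bw (l+1) t * (C + M) := by gcongr; linarith
  refine ⟨fun q p t => - ((ε * (8 * C)) • Jop l (fun s => (Φ q p s).1) t),
    fun q p t => - ε • Jop (l + 1) (fun s => (Φ q p s).2) t, fun p hp q => ?_⟩
  have B1 : ∀ s, ‖(Φ q p s).1‖ ≤ C + M := fun s => (norm_fst_le _).trans (nΦ q p hp s)
  have B2 : ∀ s, ‖(Φ q p s).2‖ ≤ C + M := fun s => (norm_snd_le _).trans (nΦ q p hp s)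
  have dd := dist_nonneg (x := (0:ℝ)) (y := 0)
  refine ⟨hη q p hp, ?_, ?_, ?_, ?_, ?_, ?_⟩
  · intro t ht
    have := ((Jop_deriv hl (φ := fun s => (Φ q p s).1) (by fun_prop) B1 t).const_smul (ε * (8 * C))).neg
    simp only [← sub_eq_add_neg]
    have hv := hval q p hp t ht
    rw [retr_eq (hrp t) (hη q p hp t ht)] at hv
    have b := bw_pos l t
    have e : -((ε * (8 * C)) • -(bw l t • (Φ q p t).1)) = F (q + t • ω p - (ε * (8 * C)) • Jop l (fun s => ((Φ q p) s).1) t) p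
      (-ε • Jop (l + 1) (fun s => ((Φ q p) s).2) t) t := by
      rw [hv]
      simp only [smul_neg, neg_neg, smul_smul]
      rw [show ε * (8 * C) * (bw l t * (ε * (8 * C) * bw l t)⁻¹) = 1 by field_simp, one_smul]
    rw [e] at this
    exact this
  · intro t ht
    have := ((Jop_deriv (m := l + 1) (by linarith) (φ := fun s => (Φ q p s).2) (by fun_prop) B2 t).const_smul (-ε))
    simp only [← sub_eq_add_neg]
    have hv := hval q p hp t ht
    rw [retr_eq (hrp t) (hη q p hp t ht)] at hv
    have b := bw_pos (l+1) t
    have e : (-ε) • -(bw (l+1) t • (Φ q p t).2) = G (q + t • ω p - (ε * (8 * C)) • Jop l (fun s => ((Φ q p) s).1) t) p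
      (-ε • Jop (l + 1) (fun s => ((Φ q p) s).2) t) t := by
      rw [hv]
      simp only [smul_neg, smul_smul]
      rw [← neg_smul, show -(-ε * (bw (l+1) t * (ε * bw (l+1) t)⁻¹)) = 1 by field_simp, one_smul]
    rw [e] at this
    exact this
  · simpa using ((Jop_tendsto hl B1).const_smul (ε * (8 * C))).neg
  · simpa using ((Jop_tendsto (m := l + 1) (by linarith) B2).const_smul (-ε))
  · have := Jop_norm hl B1 (le_refl (0:ℝ))
    have w := bw_le_one (m := l - 1) hl1.le 0
    rw [norm_neg, norm_smul, Real.norm_of_nonneg (by positivity)]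
    have z : 0 ≤ (8 * C / (l - 1) + 1) * (2 * (C * (2 + K))) := by positivity
    calc _ ≤ ε * (8 * C) * (bw (l - 1) 0 / (l - 1) * (C + M)) := by gcongr
      _ ≤ ε * (8 * C) * (1 / (l - 1) * (C + M)) := by gcongr
      _ = ε * (8 * C / (l - 1) * (C + M)) := by ring
      _ ≤ _ := by gcongr; linarith
  · intro p' hp' q'
    obtain ⟨j1, j2⟩ := jdΨ (Φ q p) (Φ q' p') 0 le_rfl
    have hL := hlip q p hp q' p' hp'
    have w := bw_le_one (m := l) (by linarith) 0
    have z : 0 ≤ 8 * C / (l - 1) * (C + M) := by positivity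
    have z1 : 0 ≤ 8 * C / (l - 1) := by positivity
    set d := max ‖q - q'‖ ‖p - p'‖
    have hd : 0 ≤ d := le_max_of_le_left (norm_nonneg _)
    constructor
    · rw [← neg_sub', norm_neg]
      refine j1.trans ?_
      calc ε * (8 * C) / (l - 1) * dist (Φ q p) (Φ q' p') ≤ ε * (8 * C) / (l - 1) * (2 * (C * (2 + K)) * d) := by gcongr
        _ = ε * ((8 * C / (l - 1)) * (2 * (C * (2 + K)))) * d := by ring
        _ ≤ ε * (8 * C / (l - 1) * (C + M) + (8 * C / (l - 1) + 1) * (2 * (C * (2 + K)))) * d := by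
            have z3 : 0 ≤ 2 * (C * (2 + K)) := by positivity
            gcongr; nlinarith
    · refine j2.trans ?_
      calc ε * bw l 0 * dist (Φ q p) (Φ q' p') ≤ ε * 1 * (2 * (C * (2 + K)) * d) := by gcongr
        _ = ε * (1 * (2 * (C * (2 + K)))) * d := by ring
        _ ≤ ε * (8 * C / (l - 1) * (C + M) + (8 * C / (l - 1) + 1) * (2 * (C * (2 + K)))) * d := by
            have z3 : 0 ≤ 2 * (C * (2 + K)) := by positivity
            gcongr; nlinarith
end Half2


section Extract
variable {X Y : Type*} [NormedAddCommGroup X] [NormedSpace ℝ X] [NormedAddCommGroup Y] [NormedSpace ℝ Y]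

theorem holder_ge (σ : ℝ) (s : Set X) (g : X → Y) {i : ℕ} (hi : i ≤ ⌊σ⌋₊) {x : X} (hx : x ∈ s) :
    ENNReal.ofReal ‖iteratedFDerivWithin ℝ i g s x‖ ≤ holderNormOn σ s g := by
  unfold holderNormOn cNormOn
  rw [ofReal_norm, enorm_eq_nnnorm]
  refine le_add_right (le_trans ?_ (le_iSup _ (⟨i, by omega⟩ : Fin (⌊σ⌋₊ + 1))))
  exact le_iSup₂ (f := fun x (_ : x ∈ s) => (‖iteratedFDerivWithin ℝ i g s x‖₊ : ℝ≥0∞)) x hx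

theorem holder_le {σ ε : ℝ} {s : Set X} {g : X → Y} (h : holderNormOn σ s g ≤ ENNReal.ofReal ε) (hε : 0 ≤ ε)
    {i : ℕ} (hi : i ≤ ⌊σ⌋₊) {x : X} (hx : x ∈ s) : ‖iteratedFDerivWithin ℝ i g s x‖ ≤ ε :=
  (ENNReal.ofReal_le_ofReal_iff hε).1 ((holder_ge σ s g hi hx).trans h)

theorem w1_nonneg (l t : ℝ) : 0 ≤ w1 l t := by unfold w1; split_ifs <;> positivity
theorem w2_nonneg (l t : ℝ) : 0 ≤ w2 l t := by unfold w2; split_ifs <;> positivity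

theorem wD_holder {σ l ε : ℝ} {A : Set (E n)} {g : E n → E n → ℝ → Y}
    (h : wnormD σ l A g ≤ ENNReal.ofReal ε) (hε : 0 ≤ ε) {i : ℕ} (hi : i ≤ ⌊σ⌋₊) {p : E n} (hp : p ∈ A)
    (t : ℝ) (q : E n) : ‖iteratedFDeriv ℝ i (fun q => g q p t) q‖ * w1 l t ≤ ε := by
  have h1 : holderNormOn σ univ (fun q => g q p t) * ENNReal.ofReal (w1 l t) ≤ ENNReal.ofReal ε := by
    refine le_trans (le_trans ?_ le_self_add) h
    exact le_trans (le_iSup (fun t => holderNormOn σ univ (fun q => g q p t) * ENNReal.ofReal (w1 l t)) t)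
      (le_iSup₂ (f := fun p (_ : p ∈ A) => ⨆ t : ℝ, holderNormOn σ univ (fun q => g q p t) * ENNReal.ofReal (w1 l t)) p hp)
  rw [← ENNReal.ofReal_le_ofReal_iff hε, ENNReal.ofReal_mul (norm_nonneg _)]
  refine le_trans ?_ h1
  gcongr
  rw [← iteratedFDerivWithin_univ]
  exact holder_ge σ univ _ hi (mem_univ q)

theorem wD_lip {σ l ε : ℝ} {A : Set (E n)} {g : E n → E n → ℝ → Y}
    (h : wnormD σ l A g ≤ ENNReal.ofReal ε) (hε : 0 ≤ ε) {x y : E n} (hx : x ∈ A) (hy : y ∈ A)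
    (t : ℝ) (q : E n) : ‖g q x t - g q y t‖ * w2 l t ≤ ε * ‖x - y‖ := by
  by_cases hxy : x = y
  · simp [hxy]
  have hn : 0 < ‖x - y‖ := norm_pos_iff.2 (sub_ne_zero.2 hxy)
  have h1 : ENNReal.ofReal (‖g q x t - g q y t‖ / ‖x - y‖) * ENNReal.ofReal (w2 l t) ≤ ENNReal.ofReal ε := by
    refine le_trans (le_trans ?_ le_add_self) h
    refine le_trans ?_ (le_iSup (fun t => lipT A g t * ENNReal.ofReal (w2 l t)) t)
    gcongr
    unfold lipT
    refine le_add_right ?_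
    refine le_trans ?_ (le_iSup _ q)
    refine le_trans ?_ (le_iSup₂ x hx)
    refine le_trans ?_ (le_iSup₂ y hy)
    exact le_iSup (fun _ : x ≠ y => ENNReal.ofReal (‖g q x t - g q y t‖ / ‖x - y‖)) hxy
  rw [← ENNReal.ofReal_mul (by positivity), ENNReal.ofReal_le_ofReal_iff hε] at h1
  rwa [div_mul_eq_mul_div, div_le_iff₀ hn] at h1

theorem w_bw {m a b t : ℝ} (hm : 0 < m) (hb : 0 ≤ b) (h : a * (1 + |t| ^ m) ≤ b) :
    a ≤ b * 2 ^ m * bw m t := by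
  have ht := abs_nonneg t
  have h1 : (1 + |t|) ^ m ≤ 2 ^ m * (1 + |t| ^ m) := by
    rcases le_total |t| 1 with h | h
    · calc (1 + |t|) ^ m ≤ 2 ^ m := by
            apply Real.rpow_le_rpow (by positivity) (by linarith) hm.le
        _ ≤ _ := by
            have : 0 ≤ |t| ^ m := by positivity
            exact le_mul_of_one_le_right (by positivity) (by linarith)
    · calc (1 + |t|) ^ m ≤ (2 * |t|) ^ m := by
            apply Real.rpow_le_rpow (by positivity) (by linarith) hm.le
        _ = 2 ^ m * |t| ^ m := Real.mul_rpow (by norm_num) ht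
        _ ≤ _ := by gcongr; linarith
  have h2 : 0 < 1 + |t| ^ m := by positivity
  have h3 : 0 < (1 + |t|) ^ m := by positivity
  rw [bw, Real.rpow_neg (by positivity), ← div_eq_mul_inv, le_div_iff₀ h3]
  rcases le_total a 0 with ha | ha
  · exact (mul_nonpos_of_nonpos_of_nonneg ha h3.le).trans (by positivity)
  calc a * (1 + |t|) ^ m ≤ a * (2 ^ m * (1 + |t| ^ m)) := by gcongr
    _ = 2 ^ m * (a * (1 + |t| ^ m)) := by ring
    _ ≤ 2 ^ m * b := by gcongr
    _ = _ := by ring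

theorem bw_anti {m m' : ℝ} (h : m ≤ m') (t : ℝ) : bw m' t ≤ bw m t := by
  unfold bw
  exact Real.rpow_le_rpow_of_exponent_le (by linarith [abs_nonneg t]) (by linarith)

theorem qderiv0_eq (g : E n → E n → ℝ → Y) (p : E n) (t : ℝ) :
    (fun q => qderiv 0 g q p t) = (continuousMultilinearCurryFin0 ℝ (E n) Y).symm ∘ fun q => g q p t := by
  funext q
  simp [qderiv, iteratedFDeriv_zero_eq_comp]

theorem qderiv1_eq (g : E n → E n → ℝ → Y) (q p : E n) (t : ℝ) :
    qderiv 1 g q p t = (continuousMultilinearCurryFin1 ℝ (E n) Y).symm (fderiv ℝ (fun q => g q p t) q) := by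
  ext m
  simp [qderiv, iteratedFDeriv_one_apply]

/-- bounds on `q`-derivatives -/
theorem wDbar_holder {σ l ε : ℝ} {k : ℕ} {A : Set (E n)} {g : E n → E n → ℝ → Y} (hσ : 0 ≤ σ)
    (h : wnormDbar σ k l A g ≤ ENNReal.ofReal ε) (hε : 0 ≤ ε) (hl : 0 < l) {i : ℕ} (hi : i ≤ ⌊σ⌋₊ + k) {p : E n} (hp : p ∈ A)
    (t : ℝ) (q : E n) : ‖iteratedFDeriv ℝ i (fun q => g q p t) q‖ ≤ ε * 2 ^ l * bw l t := by
  have h0 : wnormD (σ + k - (0:ℕ)) l A (qderiv 0 g) ≤ ENNReal.ofReal ε :=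
    (le_iSup (fun i : Fin (k+1) => wnormD (σ + k - (i : ℕ)) l A (qderiv (i : ℕ) g)) 0).trans h
  have h1 := wD_holder h0 hε (i := i) (by
    rw [Nat.cast_zero, sub_zero, Nat.floor_add_natCast hσ]; exact hi) hp t q
  rw [qderiv0_eq, LinearIsometryEquiv.norm_iteratedFDeriv_comp_left, w1, if_neg hl.ne'] at h1
  exact w_bw hl hε h1

theorem wDbar_lip {σ l ε : ℝ} {k : ℕ} {A : Set (E n)} {g : E n → E n → ℝ → Y}
    (h : wnormDbar σ k l A g ≤ ENNReal.ofReal ε) (hε : 0 ≤ ε) (hl : 1 < l) {p p' : E n} (hp : p ∈ A)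
    (hp' : p' ∈ A) (t : ℝ) (q : E n) : ‖g q p t - g q p' t‖ ≤ ε * 2 ^ (l-1) * bw (l-1) t * ‖p - p'‖ := by
  have h0 : wnormD (σ + k - (0:ℕ)) l A (qderiv 0 g) ≤ ENNReal.ofReal ε :=
    (le_iSup (fun i : Fin (k+1) => wnormD (σ + k - (i : ℕ)) l A (qderiv (i : ℕ) g)) 0).trans h
  have h1 := wD_lip h0 hε hp hp' t q
  have e := fun p => congrFun (qderiv0_eq g p t) q
  simp only [Function.comp] at e
  rw [e, e, ← map_sub, LinearIsometryEquiv.norm_map, w2, if_neg (by linarith)] at h1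
  refine (w_bw (m := l - 1) (by linarith) (by positivity) h1).trans (le_of_eq (by ring))

theorem wDbar_lip1 {σ l ε : ℝ} {k : ℕ} (hk : 1 ≤ k) {A : Set (E n)} {g : E n → E n → ℝ → Y}
    (h : wnormDbar σ k l A g ≤ ENNReal.ofReal ε) (hε : 0 ≤ ε) (hl : 1 < l) {p p' : E n} (hp : p ∈ A)
    (hp' : p' ∈ A) (t : ℝ) (q : E n) : ‖fderiv ℝ (fun q => g q p t) q - fderiv ℝ (fun q => g q p' t) q‖
      ≤ ε * 2 ^ (l-1) * bw (l-1) t * ‖p - p'‖ := by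
  have h0 : wnormD (σ + k - (1:ℕ)) l A (qderiv 1 g) ≤ ENNReal.ofReal ε :=
    (le_iSup (fun i : Fin (k+1) => wnormD (σ + k - (i : ℕ)) l A (qderiv (i : ℕ) g)) ⟨1, by omega⟩).trans h
  have h1 := wD_lip h0 hε hp hp' t q
  rw [qderiv1_eq, qderiv1_eq, ← map_sub, LinearIsometryEquiv.norm_map, w2, if_neg (by linarith)] at h1
  refine (w_bw (m := l - 1) (by linarith) (by positivity) h1).trans (le_of_eq (by ring))

theorem mDbar_contDiff {σ : ℝ} {k : ℕ} {A : Set (E n)} {g : E n → E n → ℝ → Y} (hσ : 0 ≤ σ)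
    (h : MemDbar σ k A g) {p : E n} (hp : p ∈ A) (t : ℝ) :
    ContDiff ℝ ((⌊σ⌋₊ + k : ℕ)) (fun q => g q p t) := by
  have h0 := ((h 0 (Nat.zero_le _)).2.2 p hp t).1
  rw [Nat.cast_zero, sub_zero, Nat.floor_add_natCast hσ, contDiffOn_univ, qderiv0_eq] at h0
  exact (ContinuousLinearEquiv.comp_contDiff_iff (continuousMultilinearCurryFin0 ℝ (E n) Y).symm.toContinuousLinearEquiv).1 h0

theorem mDbar_cont0 {σ : ℝ} {k : ℕ} {A : Set (E n)} {g : E n → E n → ℝ → Y}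
    (h : MemDbar σ k A g) :
    ContinuousOn (fun x : E n × E n × ℝ => g x.1 x.2.1 x.2.2) (univ ×ˢ (A ×ˢ univ)) := by
  have h0 := (h 0 (Nat.zero_le _)).1
  have e := fun q p t => congrFun (qderiv0_eq g p t) q
  simp only [Function.comp] at e
  simp only [e] at h0
  have := (continuousMultilinearCurryFin0 ℝ (E n) Y).continuous.comp_continuousOn h0
  refine this.congr fun x _ => ?_
  simp

theorem mDbar_cont1 {σ : ℝ} {k : ℕ} (hk : 1 ≤ k) {A : Set (E n)} {g : E n → E n → ℝ → Y}
    (h : MemDbar σ k A g) :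
    ContinuousOn (fun x : E n × E n × ℝ => fderiv ℝ (fun q => g q x.2.1 x.2.2) x.1) (univ ×ˢ (A ×ˢ univ)) := by
  have h0 := (h 1 hk).1
  simp only [qderiv1_eq] at h0
  have := (continuousMultilinearCurryFin1 ℝ (E n) Y).continuous.comp_continuousOn h0
  refine this.congr fun x _ => ?_
  simp

/-- bilinear form of a 2-multilinear map -/
def J2 {X : Type*} [NormedAddCommGroup X] [NormedSpace ℝ X] :=
  (ContinuousLinearMap.compL ℝ X _ _
    ((continuousMultilinearCurryFin1 ℝ X ℝ).toContinuousLinearEquiv.toContinuousLinearMap)).comp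
  ((continuousMultilinearCurryLeftEquiv ℝ (fun _ : Fin 2 => X) ℝ).toContinuousLinearEquiv.toContinuousLinearMap)

theorem J2_apply (U : ContinuousMultilinearMap ℝ (fun _ : Fin 2 => X) ℝ) (a b : X) :
    J2 U a b = U ![a, b] := by
  simp only [J2, ContinuousLinearMap.comp_apply, ContinuousLinearMap.compL_apply]
  simp

theorem J2_norm (U : ContinuousMultilinearMap ℝ (fun _ : Fin 2 => X) ℝ) : ‖J2 U‖ ≤ ‖U‖ := by
  refine ContinuousLinearMap.opNorm_le_bound₂ _ (by positivity) fun a b => ?_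
  rw [J2_apply]
  refine (U.le_opNorm _).trans (le_of_eq ?_)
  simp [Fin.prod_univ_two]; ring

theorem J2_iterW {Z : Type*} [NormedAddCommGroup Z] [NormedSpace ℝ Z] {s : Set Z} (hs : UniqueDiffOn ℝ s)
    {g : Z → ContinuousMultilinearMap ℝ (fun _ : Fin 2 => X) ℝ} {N : ℕ} (hg : ContDiffOn ℝ N g s)
    {i : ℕ} (hi : i ≤ N) {z : Z} (hz : z ∈ s) :
    ‖iteratedFDerivWithin ℝ i (fun z => J2 (g z)) s z‖ ≤ ‖iteratedFDerivWithin ℝ i g s z‖ := by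
  have := ContinuousLinearMap.iteratedFDerivWithin_comp_left (G := X →L[ℝ] X →L[ℝ] ℝ) (J2 (X := X)) (hg z hz) hs hz (i := i) (by exact_mod_cast hi)
  rw [show (fun z => J2 (g z)) = J2 ∘ g from rfl, this]
  refine ContinuousMultilinearMap.opNorm_le_bound (norm_nonneg _) fun m => ?_
  rw [ContinuousLinearMap.compContinuousMultilinearMap_coe, Function.comp]
  exact (J2_norm _).trans (ContinuousMultilinearMap.le_opNorm _ _)

theorem J2_iter (g : X → ℝ) (z : X) : J2 (iteratedFDeriv ℝ 2 g z) = fderiv ℝ (fderiv ℝ g) z := by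
  ext a b
  rw [J2_apply, iteratedFDeriv_two_apply]
  rfl
end Extract


section RegSec
set_option maxSynthPendingDepth 3

/-- second derivative in `p` as a bilinear form -/
def SS (H : E n → E n → ℝ → ℝ) (t : ℝ) (x : E n × E n) : E n →L[ℝ] E n →L[ℝ] ℝ :=
  fderiv ℝ (fderiv ℝ (fun p' => H x.1 p' t)) x.2

/-- derived regularity facts -/
structure Reg (k : ℕ) (Υ l e : ℝ) (h : E n → ℝ) (R : E n → E n → ℝ) (f H : E n → E n → ℝ → ℝ)
    (u v : E n → E n → ℝ → E n) : Prop where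
  hH : H = fun q p t => h p + R q p + f q p t
  hh : ContDiffOn ℝ 2 h (ball 0 1)
  hR : ContDiffOn ℝ 2 (fun x : E n × E n => R x.1 x.2) (univ ×ˢ ball 0 1)
  fC : ∀ p ∈ ball (0 : E n) 1, ∀ t, ContDiff ℝ ((k + 2 : ℕ)) (fun q => f q p t)
  uC : ∀ p ∈ ball (0 : E n) 1, ∀ t, ContDiff ℝ ((k + 2 : ℕ)) (fun q => u q p t)
  fp : ∀ p ∈ ball (0 : E n) 1, ∀ q t, HasGradientAt (fun p' => f q p' t) (u q p t) p
  fq : ∀ p ∈ ball (0 : E n) 1, ∀ q t, HasGradientAt (fun q' => f q' p t) (v q p t) q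
  vB : ∀ p ∈ ball (0 : E n) 1, ∀ t q, ∀ i ≤ k + 1, ‖iteratedFDeriv ℝ i (fun q => v q p t) q‖ ≤ e * bw (l + 2) t
  uB : ∀ p ∈ ball (0 : E n) 1, ∀ t q, ∀ i ≤ k + 2, ‖iteratedFDeriv ℝ i (fun q => u q p t) q‖ ≤ e * bw (l + 1) t
  vL : ∀ p ∈ ball (0 : E n) 1, ∀ p' ∈ ball (0 : E n) 1, ∀ t q, ‖v q p t - v q p' t‖ ≤ e * bw (l + 1) t * ‖p - p'‖
  uL : ∀ p ∈ ball (0 : E n) 1, ∀ p' ∈ ball (0 : E n) 1, ∀ t q, ‖u q p t - u q p' t‖ ≤ e * bw l t * ‖p - p'‖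
  duL : ∀ p ∈ ball (0 : E n) 1, ∀ p' ∈ ball (0 : E n) 1, ∀ t q,
    ‖fderiv ℝ (fun q => u q p t) q - fderiv ℝ (fun q => u q p' t) q‖ ≤ e * bw l t * ‖p - p'‖
  cu : ContinuousOn (fun x : E n × E n × ℝ => u x.1 x.2.1 x.2.2) (univ ×ˢ (ball 0 1 ×ˢ univ))
  cv : ContinuousOn (fun x : E n × E n × ℝ => v x.1 x.2.1 x.2.2) (univ ×ˢ (ball 0 1 ×ˢ univ))
  SC : ∀ t, ContDiffOn ℝ ((k + 2 : ℕ)) (SS H t) (univ ×ˢ ball 0 1)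
  SB : ∀ t, ∀ x ∈ (univ : Set (E n)) ×ˢ ball (0 : E n) 1, ∀ i ≤ k + 2,
    ‖iteratedFDerivWithin ℝ i (SS H t) (univ ×ˢ ball 0 1) x‖ ≤ Υ
  SH : ∀ t q, ∀ p ∈ ball (0 : E n) 1, DifferentiableAt ℝ (fderiv ℝ (fun p' => H q p' t)) p

theorem isOpen_Om : IsOpen ((univ : Set (E n)) ×ˢ ball (0 : E n) 1) := isOpen_univ.prod isOpen_ball
theorem convex_Om : Convex ℝ ((univ : Set (E n)) ×ˢ ball (0 : E n) 1) := convex_univ.prod (convex_ball _ _)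

theorem toDual_sub (x : E n) : ‖(InnerProductSpace.toDual ℝ (E n)) x‖ = ‖x‖ := LinearIsometryEquiv.norm_map _ _

theorem grad_fderiv (g : E n → ℝ) (x : E n) : fderiv ℝ g x = InnerProductSpace.toDual ℝ (E n) (gradient g x) := by
  simp [gradient]

theorem slice_R {R : E n → E n → ℝ} (hR : ContDiffOn ℝ 2 (fun x : E n × E n => R x.1 x.2) (univ ×ˢ ball 0 1))
    (q : E n) : ContDiffOn ℝ 2 (fun p => R q p) (ball 0 1) := by
  refine hR.comp (f := fun p : E n => (q, p)) (by fun_prop) fun p hp => ⟨mem_univ _, hp⟩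

theorem loc_lip {g : E n → ℝ} (hg : ContDiffOn ℝ 2 g (ball 0 1)) {x : E n} (hx : x ∈ ball (0 : E n) 1) :
    ∃ C : ℝ≥0, ∃ t ∈ 𝓝 x, LipschitzOnWith C (fderiv ℝ g) t := by
  have h1 : ContDiffOn ℝ 1 (fderiv ℝ g) (ball 0 1) := hg.fderiv_of_isOpen isOpen_ball (by norm_num)
  have h2 : ContDiffAt ℝ 1 (fderiv ℝ g) x := h1.contDiffAt (isOpen_ball.mem_nhds hx)
  exact h2.exists_lipschitzOnWith

theorem reg_of_hyp {σ Υ l ε : ℝ} (hσ : 1 ≤ σ) (hΥ : 1 ≤ Υ) (hl : 1 < l)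
    {h : E n → ℝ} {R : E n → E n → ℝ} {f H : E n → E n → ℝ → ℝ} (hε : 0 < ε)
    (hH : H = (fun q p t => h p + R q p + f q p t))
    (hh : ContDiffOn ℝ 2 h (ball 0 1))
    (hf : MemDbar σ 2 (ball 0 1) f)
    (hu : MemDbar σ 2 (ball 0 1) (fun q p t => gradient (fun p' => f q p' t) p))
    (hs : wnormD (σ + 2) 0 (ball 0 1) f
          + wnormDbar σ 1 (l + 2) (ball 0 1) (fun q p t => gradient (fun q' => f q' p t) q)
          + wnormDbar σ 2 (l + 1) (ball 0 1) (fun q p t => gradient (fun p' => f q p' t) p)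
        < ENNReal.ofReal ε)
    (hR : ContDiffOn ℝ 2 (fun x : E n × E n => R x.1 x.2) (univ ×ˢ ball 0 1))
    (hU : ∀ t : ℝ, HolderOn (σ + 2) (univ ×ˢ ball 0 1)
          (fun x : E n × E n => iteratedFDeriv ℝ 2 (fun p' => H x.1 p' t) x.2))
    (hUb : (⨆ t : ℝ, holderNormOn (σ + 2) (univ ×ˢ ball 0 1)
          (fun x : E n × E n => iteratedFDeriv ℝ 2 (fun p' => H x.1 p' t) x.2))
        ≤ ENNReal.ofReal Υ) :
    Reg ⌊σ⌋₊ Υ l (ε * 2 ^ (l + 2)) h R f H (fun q p t => gradient (fun p' => f q p' t) p)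
      (fun q p t => gradient (fun q' => f q' p t) q) := by
  have hσ0 : 0 ≤ σ := by linarith
  have sf : wnormD (σ + 2) 0 (ball 0 1) f ≤ ENNReal.ofReal ε := (le_add_right (le_add_right le_rfl)).trans hs.le
  have sv : wnormDbar σ 1 (l + 2) (ball 0 1) (fun q p t => gradient (fun q' => f q' p t) q) ≤ ENNReal.ofReal ε :=
    (le_add_right (le_add_left le_rfl)).trans hs.le
  have su : wnormDbar σ 2 (l + 1) (ball 0 1) (fun q p t => gradient (fun p' => f q p' t) p) ≤ ENNReal.ofReal ε :=
    (le_add_left le_rfl).trans hs.le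
  have pw : ∀ {m : ℝ}, m ≤ l + 2 → (2:ℝ) ^ m ≤ 2 ^ (l + 2) := fun hm =>
    Real.rpow_le_rpow_of_exponent_le (by norm_num) hm
  have cu := mDbar_cont0 hu
  have fC := fun p (hp : p ∈ ball (0 : E n) 1) t => mDbar_contDiff hσ0 hf hp t
  have uL : ∀ p ∈ ball (0 : E n) 1, ∀ p' ∈ ball (0 : E n) 1, ∀ t q,
      ‖gradient (fun p' => f q p' t) p - gradient (fun p' => f q p' t) p'‖ ≤ ε * 2 ^ (l + 2) * bw l t * ‖p - p'‖ := by
    intro p hp p' hp' t q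
    have := wDbar_lip su hε.le (by linarith) hp hp' t q
    refine this.trans ?_
    rw [show l + 1 - 1 = l by ring]
    have := bw_pos l t
    gcongr
    · norm_num
    · linarith
  have cslice : ∀ q t, ContinuousOn (fderiv ℝ (fun p' => f q p' t)) (ball 0 1) := by
    intro q t
    have h1 : ContinuousOn (fun p => gradient (fun p' => f q p' t) p) (ball 0 1) :=
      cu.comp (f := fun p : E n => (q, p, t)) (by fun_prop) fun p hp => ⟨mem_univ _, hp, mem_univ _⟩
    have h2 := (InnerProductSpace.toDual ℝ (E n)).continuous.comp_continuousOn h1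
    exact h2.congr fun p _ => grad_fderiv _ _
  have fd : ∀ q t, DifferentiableOn ℝ (fun p' => f q p' t) (ball 0 1) := by
    intro q t
    refine rad_diff isOpen_ball (fun x hx => ⟨⟨ε, hε.le⟩, ball 0 1, isOpen_ball.mem_nhds hx, ?_⟩) (cslice q t)
    refine LipschitzOnWith.of_dist_le_mul fun x hx y hy => ?_
    have := wD_lip sf hε.le hx hy t q
    rw [w2, if_pos rfl, mul_one] at this
    rw [dist_eq_norm, dist_eq_norm]; exact this
  have Hfd : ∀ q t, EqOn (fderiv ℝ (fun p' => H q p' t)) (fun p => fderiv ℝ h p + fderiv ℝ (fun p => R q p) p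
      + fderiv ℝ (fun p' => f q p' t) p) (ball 0 1) := by
    intro q t p hp
    have a1 : DifferentiableAt ℝ h p := (hh.differentiableOn (by norm_num)).differentiableAt (isOpen_ball.mem_nhds hp)
    have a2 : DifferentiableAt ℝ (fun p => R q p) p :=
      ((slice_R hR q).differentiableOn (by norm_num)).differentiableAt (isOpen_ball.mem_nhds hp)
    have a3 := (fd q t).differentiableAt (isOpen_ball.mem_nhds hp)
    rw [hH]
    exact ((a1.hasFDerivAt.add a2.hasFDerivAt).add a3.hasFDerivAt).fderiv
  have SSe : ∀ t, SS H t = fun x => J2 (iteratedFDeriv ℝ 2 (fun p' => H x.1 p' t) x.2) := by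
    intro t; funext x; rw [J2_iter]; rfl
  have UC : ∀ t, ContDiffOn ℝ ((⌊σ⌋₊ + 2 : ℕ)) (fun x : E n × E n => iteratedFDeriv ℝ 2 (fun p' => H x.1 p' t) x.2)
      (univ ×ˢ ball 0 1) := by
    intro t
    have := (hU t).1
    rwa [show σ + 2 = σ + (2:ℕ) by norm_num, Nat.floor_add_natCast hσ0] at this
  have SC : ∀ t, ContDiffOn ℝ ((⌊σ⌋₊ + 2 : ℕ)) (SS H t) (univ ×ˢ ball 0 1) := by
    intro t; rw [SSe]
    exact ((J2 (X := E n)).contDiff).comp_contDiffOn (UC t)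
  refine ⟨hH, hh, hR, fC, fun p hp t => mDbar_contDiff hσ0 hu hp t, ?_, ?_, ?_, ?_, ?_, uL, ?_, cu, ?_, SC, ?_, ?_⟩
  · intro p hp q t
    exact ((fd q t).differentiableAt (isOpen_ball.mem_nhds hp)).hasGradientAt
  · intro p hp q t
    exact (((fC p hp t).differentiable (by simp)) q).hasGradientAt
  · intro p hp t q i hi
    have := wDbar_holder hσ0 sv hε.le (by linarith) hi hp t q
    exact this
  · intro p hp t q i hi
    have := wDbar_holder hσ0 su hε.le (by linarith) hi hp t q
    refine this.trans ?_
    have := bw_pos (l+1) t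
    gcongr
    · norm_num
    · linarith
  · intro p hp p' hp' t q
    have := wDbar_lip sv hε.le (by linarith) hp hp' t q
    refine this.trans ?_
    rw [show l + 2 - 1 = l + 1 by ring]
    have := bw_pos (l+1) t
    gcongr
    · norm_num
    · linarith
  · intro p hp p' hp' t q
    have := wDbar_lip1 (by norm_num) su hε.le (by linarith) hp hp' t q
    refine this.trans ?_
    rw [show l + 1 - 1 = l by ring]
    have := bw_pos l t
    gcongr
    · norm_num
    · linarith
  · have := (InnerProductSpace.toDual ℝ (E n)).symm.continuous.comp_continuousOn (mDbar_cont1 (by norm_num) hf)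
    exact this
  · intro t x hx i hi
    rw [SSe]
    refine (J2_iterW isOpen_Om.uniqueDiffOn (UC t) hi hx).trans ?_
    refine holder_le (σ := σ + 2) ((le_iSup _ t).trans hUb) (by linarith) ?_ hx
    rw [show σ + 2 = σ + (2:ℕ) by norm_num, Nat.floor_add_natCast hσ0]; exact hi
  · intro t q p hp
    refine (rad_diff (U := ball (0 : E n) 1) isOpen_ball (g := fderiv ℝ (fun p' => H q p' t)) ?_ ?_).differentiableAt (isOpen_ball.mem_nhds hp)
    · intro x hx
      obtain ⟨C1, t1, ht1, L1⟩ := loc_lip hh hx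
      obtain ⟨C2, t2, ht2, L2⟩ := loc_lip (slice_R hR q) hx
      have L3 : LipschitzOnWith ⟨ε * 2 ^ (l + 2) * bw l t, by have := bw_pos l t; positivity⟩
          (fderiv ℝ (fun p' => f q p' t)) (ball 0 1) := by
        refine LipschitzOnWith.of_dist_le_mul fun x hx y hy => ?_
        rw [dist_eq_norm, dist_eq_norm, grad_fderiv, grad_fderiv, ← map_sub, LinearIsometryEquiv.norm_map]
        exact uL x hx y hy t q
      have LL := ((L1.mono (s := t1 ∩ t2 ∩ ball 0 1) fun p hp => hp.1.1).add (L2.mono fun p hp => hp.1.2)).add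
        (L3.mono fun p hp => hp.2)
      refine ⟨C1 + C2 + ⟨ε * 2 ^ (l + 2) * bw l t, by have := bw_pos l t; positivity⟩, t1 ∩ t2 ∩ ball 0 1,
        inter_mem (inter_mem ht1 ht2) (isOpen_ball.mem_nhds hx), fun x hx y hy => ?_⟩
      rw [Hfd q t hx.2, Hfd q t hy.2]
      exact LL hx hy
    · have : ContinuousOn (fun p => SS H t (q, p)) (ball 0 1) :=
        (SC t).continuousOn.comp (by fun_prop) fun p hp => ⟨mem_univ _, hp⟩
      exact this
end RegSec


section DynSec
set_option maxSynthPendingDepth 3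
set_option linter.unusedVariables false
set_option linter.deprecated false

theorem lip_of_iter {X Y : Type*} [NormedAddCommGroup X] [NormedSpace ℝ X] [NormedAddCommGroup Y] [NormedSpace ℝ Y]
    {Ω : Set X} (ho : IsOpen Ω) (hc : Convex ℝ Ω) {g : X → Y} {C : ℝ} (hg : DifferentiableOn ℝ g Ω)
    (hb : ∀ x ∈ Ω, ‖iteratedFDerivWithin ℝ 1 g Ω x‖ ≤ C) {x y : X} (hx : x ∈ Ω) (hy : y ∈ Ω) :
    ‖g x - g y‖ ≤ C * ‖x - y‖ := by
  refine hc.norm_image_sub_le_of_norm_fderivWithin_le (𝕜 := ℝ) hg (fun z hz => ?_) hy hx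
  have := hb z hz
  rwa [norm_iteratedFDerivWithin_one g (ho.uniqueDiffOn z hz)] at this

theorem tay0 {Y : Type*} [NormedAddCommGroup Y] [NormedSpace ℝ Y] {φ φ' : ℝ → Y} {C : ℝ}
    (h1 : ∀ s ∈ Icc (0:ℝ) 1, HasDerivAt φ (φ' s) s) (hb : ∀ s ∈ Icc (0:ℝ) 1, ‖φ' s‖ ≤ C) {s : ℝ}
    (hs : s ∈ Icc (0:ℝ) 1) : ‖φ s - φ 0‖ ≤ C := by
  have h0 : (0:ℝ) ∈ Icc (0:ℝ) 1 := by simp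
  have hC : 0 ≤ C := (norm_nonneg _).trans (hb 0 h0)
  have := (convex_Icc (0:ℝ) 1).norm_image_sub_le_of_norm_hasDerivWithin_le
    (fun s hs => (h1 s hs).hasDerivWithinAt) hb h0 hs
  refine this.trans ?_
  rw [sub_zero, Real.norm_of_nonneg hs.1]
  nlinarith [hs.2]

theorem tay1 {Y : Type*} [NormedAddCommGroup Y] [NormedSpace ℝ Y] {φ φ' φ'' : ℝ → Y} {C : ℝ}
    (h1 : ∀ s ∈ Icc (0:ℝ) 1, HasDerivAt φ (φ' s) s) (h2 : ∀ s ∈ Icc (0:ℝ) 1, HasDerivAt φ' (φ'' s) s)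
    (hb : ∀ s ∈ Icc (0:ℝ) 1, ‖φ'' s‖ ≤ C) : ‖φ 1 - φ 0 - φ' 0‖ ≤ C := by
  have := tay0 (φ := fun s => φ s - s • φ' 0) (φ' := fun s => φ' s - φ' 0) (C := C) (s := 1)
    (fun s hs => by
      have := (h1 s hs).sub ((hasDerivAt_id s).smul_const (φ' 0))
      rw [one_smul] at this; exact this)
    (fun s hs => tay0 h2 hb hs) (by simp)
  simp only [one_smul, zero_smul, sub_zero] at this
  rwa [sub_right_comm] at this

/-- fixed-time data -/
structure Dat (Υ : ℝ) (H : E n → E n → ℝ) (S : E n × E n → E n →L[ℝ] E n →L[ℝ] ℝ) : Prop where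
  H1 : ∀ q, ∀ p ∈ ball (0:E n) 1, HasFDerivAt (fun p' => H q p') (fderiv ℝ (fun p' => H q p') p) p
  H2 : ∀ q, ∀ p ∈ ball (0:E n) 1, HasFDerivAt (fderiv ℝ (fun p' => H q p')) (S (q, p)) p
  Hq : ∀ q, ∀ p ∈ ball (0:E n) 1, DifferentiableAt ℝ (fun q' => H q' p) q
  S0 : ∀ q, ∀ p ∈ ball (0:E n) 1, ‖S (q, p)‖ ≤ Υ
  S1 : ∀ q q', ∀ p ∈ ball (0:E n) 1, ∀ p' ∈ ball (0:E n) 1, ‖S (q, p) - S (q', p')‖ ≤ Υ * (‖q - q'‖ + ‖p - p'‖)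
  S2 : ∀ a q q', ∀ p ∈ ball (0:E n) 1, ∀ p' ∈ ball (0:E n) 1,
    ‖(S (q + a, p) - S (q, p)) - (S (q' + a, p') - S (q', p'))‖ ≤ Υ * ‖a‖ * (‖q - q'‖ + ‖p - p'‖)

theorem seg_mem {p η : E n} (hp : p ∈ ball (0:E n) 1) (hη : p + η ∈ ball (0:E n) 1) {s : ℝ} (hs : s ∈ Icc (0:ℝ) 1) :
    p + s • η ∈ ball (0:E n) 1 := by
  have := (convex_ball (0:E n) 1).add_smul_sub_mem hp hη hs
  simpa using this

variable {Υ : ℝ} {H : E n → E n → ℝ} {S : E n × E n → E n →L[ℝ] E n →L[ℝ] ℝ}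

theorem Dat.dP (h : Dat Υ H S) {q p η : E n} (hp : p ∈ ball (0:E n) 1) (hη : p + η ∈ ball (0:E n) 1) {s : ℝ} (hs : s ∈ Icc (0:ℝ) 1) :
    HasDerivAt (fun s : ℝ => fderiv ℝ (fun p' => H q p') (p + s • η)) (S (q, p + s • η) η) s := by
  have h1 := h.H2 q _ (seg_mem hp hη hs)
  have h2 : HasDerivAt (fun s : ℝ => p + s • η) η s := by
    simpa using ((hasDerivAt_id s).smul_const η).const_add p
  exact h1.comp_hasDerivAt s h2

theorem Dat.dH (h : Dat Υ H S) {q p η : E n} (hp : p ∈ ball (0:E n) 1) (hη : p + η ∈ ball (0:E n) 1) {s : ℝ} (hs : s ∈ Icc (0:ℝ) 1) :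
    HasDerivAt (fun s : ℝ => H q (p + s • η)) (fderiv ℝ (fun p' => H q p') (p + s • η) η) s := by
  have h1 := h.H1 q _ (seg_mem hp hη hs)
  have h2 : HasDerivAt (fun s : ℝ => p + s • η) η s := by
    simpa using ((hasDerivAt_id s).smul_const η).const_add p
  exact h1.comp_hasDerivAt s h2

theorem Dat.P0 (h : Dat Υ H S) {q p η : E n} (hp : p ∈ ball (0:E n) 1) (hη : p + η ∈ ball (0:E n) 1) :
    ‖fderiv ℝ (fun p' => H q p') (p + η) - fderiv ℝ (fun p' => H q p') p‖ ≤ Υ * ‖η‖ := by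
  have := tay0 (C := Υ * ‖η‖) (fun s hs => h.dP (q := q) hp hη hs) (fun s hs => ?_) (s := 1) (by simp)
  · simpa using this
  · refine (ContinuousLinearMap.le_opNorm _ _).trans ?_
    gcongr; exact h.S0 _ _ (seg_mem hp hη hs)

theorem Dat.Sseg (h : Dat Υ H S) (hΥ : 0 ≤ Υ) {q p η q' p' η' : E n} (hp : p ∈ ball (0:E n) 1) (hη : p + η ∈ ball (0:E n) 1)
    (hp' : p' ∈ ball (0:E n) 1) (hη' : p' + η' ∈ ball (0:E n) 1) {s : ℝ} (hs : s ∈ Icc (0:ℝ) 1) :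
    ‖(p + s • η) - (p' + s • η')‖ ≤ ‖p - p'‖ + ‖η - η'‖ := by
  rw [show (p + s • η) - (p' + s • η') = (p - p') + s • (η - η') by module]
  refine (norm_add_le _ _).trans ?_
  rw [norm_smul, Real.norm_of_nonneg hs.1]
  nlinarith [hs.2, norm_nonneg (η - η')]

theorem Dat.P1 (h : Dat Υ H S) (hΥ : 0 ≤ Υ) {q p η q' p' η' : E n} (hp : p ∈ ball (0:E n) 1) (hη : p + η ∈ ball (0:E n) 1)
    (hp' : p' ∈ ball (0:E n) 1) (hη' : p' + η' ∈ ball (0:E n) 1) :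
    ‖(fderiv ℝ (fun p' => H q p') (p + η) - fderiv ℝ (fun p' => H q p') p) -
      (fderiv ℝ (fun p => H q' p) (p' + η') - fderiv ℝ (fun p => H q' p) p')‖ ≤
      Υ * ‖η - η'‖ + Υ * (‖q - q'‖ + (‖p - p'‖ + ‖η - η'‖)) * ‖η'‖ := by
  have := tay0 (C := Υ * ‖η - η'‖ + Υ * (‖q - q'‖ + (‖p - p'‖ + ‖η - η'‖)) * ‖η'‖)
    (fun s hs => (h.dP (q := q) hp hη hs).sub (h.dP (q := q') hp' hη' hs)) (fun s hs => ?_) (s := 1) (by simp)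
  · simp only [Pi.sub_apply, one_smul, zero_smul, add_zero] at this
    rwa [sub_sub_sub_comm] at this
  · rw [show S (q, p + s • η) η - S (q', p' + s • η') η' = S (q, p + s • η) (η - η') +
        (S (q, p + s • η) - S (q', p' + s • η')) η' by simp]
    refine (norm_add_le _ _).trans (add_le_add ?_ ?_)
    · refine (ContinuousLinearMap.le_opNorm _ _).trans ?_
      gcongr; exact h.S0 _ _ (seg_mem hp hη hs)
    · refine (ContinuousLinearMap.le_opNorm _ _).trans ?_
      gcongr
      refine (h.S1 _ _ _ (seg_mem hp hη hs) _ (seg_mem hp' hη' hs)).trans ?_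
      gcongr; exact h.Sseg hΥ (q := q) (q' := q') hp hη hp' hη' hs

/-- quadratic remainder -/
def th (H : E n → E n → ℝ) (p η q : E n) : ℝ := H q (p + η) - H q p - fderiv ℝ (fun p' => H q p') p η

theorem Dat.th0 (h : Dat Υ H S) (hΥ : 0 ≤ Υ) {q p η : E n} (hp : p ∈ ball (0:E n) 1) (hη : p + η ∈ ball (0:E n) 1) (a : E n) :
    ‖th H p η (q + a) - th H p η q‖ ≤ Υ * ‖η‖ ^ 2 * ‖a‖ := by
  have e1 := fun s (hs : s ∈ Icc (0:ℝ) 1) => (h.dH (q := q + a) hp hη hs).sub (h.dH (q := q) hp hη hs)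
  have e2 := fun s (hs : s ∈ Icc (0:ℝ) 1) => ((h.dP (q := q + a) hp hη hs).sub (h.dP (q := q) hp hη hs)).clm_apply (hasDerivAt_const s η)
  have := tay1 (C := Υ * ‖η‖ ^ 2 * ‖a‖) e1 e2 (fun s hs => ?_)
  · simp only [Pi.sub_apply, one_smul, zero_smul, add_zero] at this
    refine le_trans (le_of_eq ?_) this
    congr 1; simp only [th]; ring
  · rw [map_zero, add_zero]
    have h1 := h.S1 (q + a) q _ (seg_mem hp hη hs) _ (seg_mem hp hη hs)
    rw [sub_self, norm_zero, add_zero, add_sub_cancel_left] at h1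
    have h2 := ContinuousLinearMap.le_opNorm₂ (S (q + a, p + s • η) - S (q, p + s • η)) η η
    simp only [ContinuousLinearMap.sub_apply] at h2 ⊢
    refine h2.trans ?_
    calc _ ≤ (Υ * ‖a‖) * ‖η‖ * ‖η‖ := by gcongr
      _ = _ := by ring

theorem Dat.th1 (h : Dat Υ H S) (hΥ : 0 ≤ Υ) {q p η q' p' η' : E n} (hp : p ∈ ball (0:E n) 1) (hη : p + η ∈ ball (0:E n) 1)
    (hp' : p' ∈ ball (0:E n) 1) (hη' : p' + η' ∈ ball (0:E n) 1) (a : E n) :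
    ‖(th H p η (q + a) - th H p η q) - (th H p' η' (q' + a) - th H p' η' q')‖ ≤
      (Υ * (‖q - q'‖ + (‖p - p'‖ + ‖η - η'‖)) * ‖η‖ ^ 2 + Υ * ‖η - η'‖ * (‖η‖ + ‖η'‖)) * ‖a‖ := by
  have e1 := fun s (hs : s ∈ Icc (0:ℝ) 1) => ((h.dH (q := q + a) hp hη hs).sub (h.dH (q := q) hp hη hs)).sub
    ((h.dH (q := q' + a) hp' hη' hs).sub (h.dH (q := q') hp' hη' hs))
  have e2 := fun s (hs : s ∈ Icc (0:ℝ) 1) => (((h.dP (q := q + a) hp hη hs).sub (h.dP (q := q) hp hη hs)).clm_apply (hasDerivAt_const s η)).sub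
    (((h.dP (q := q' + a) hp' hη' hs).sub (h.dP (q := q') hp' hη' hs)).clm_apply (hasDerivAt_const s η'))
  have := tay1 (C := (Υ * (‖q - q'‖ + (‖p - p'‖ + ‖η - η'‖)) * ‖η‖ ^ 2 + Υ * ‖η - η'‖ * (‖η‖ + ‖η'‖)) * ‖a‖) e1 e2 (fun s hs => ?_)
  · simp only [Pi.sub_apply, one_smul, zero_smul, add_zero] at this
    refine le_trans (le_of_eq ?_) this
    congr 1; simp only [th, ContinuousLinearMap.sub_apply]; ring
  · rw [map_zero, add_zero, map_zero, add_zero]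
    have h1 := h.S1 (q' + a) q' _ (seg_mem hp' hη' hs) _ (seg_mem hp' hη' hs)
    rw [sub_self, norm_zero, add_zero, add_sub_cancel_left] at h1
    have h3 := h.S2 a q q' _ (seg_mem hp hη hs) _ (seg_mem hp' hη' hs)
    have h4 := h.Sseg hΥ (q := q) (q' := q') hp hη hp' hη' hs
    set A := S (q + a, p + s • η) - S (q, p + s • η) with hA
    set B := S (q' + a, p' + s • η') - S (q', p' + s • η') with hB
    have hAB : ((S (q + a, p + s • η) η - S (q, p + s • η) η) η - (S (q' + a, p' + s • η') η' - S (q', p' + s • η') η') η')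
       = (A - B) η η + (B (η - η') η + B η' (η - η')) := by
      simp only [hA, hB, map_sub, ContinuousLinearMap.sub_apply]; ring
    refine (le_of_eq (congrArg _ hAB)).trans ?_
    refine (norm_add_le _ _).trans ?_
    have k1 := ContinuousLinearMap.le_opNorm₂ (A - B) η η
    have k2 := ContinuousLinearMap.le_opNorm₂ B (η - η') η
    have k3 := ContinuousLinearMap.le_opNorm₂ B η' (η - η')
    have k4 : ‖A - B‖ ≤ Υ * ‖a‖ * (‖q - q'‖ + (‖p - p'‖ + ‖η - η'‖)) := h3.trans (by gcongr)
    calc _ ≤ (Υ * ‖a‖ * (‖q - q'‖ + (‖p - p'‖ + ‖η - η'‖))) * ‖η‖ * ‖η‖ + ((Υ * ‖a‖) * ‖η - η'‖ * ‖η‖ + (Υ * ‖a‖) * ‖η'‖ * ‖η - η'‖) := by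
          refine add_le_add (k1.trans (by gcongr)) ((norm_add_le _ _).trans (add_le_add (k2.trans (by gcongr)) (k3.trans (by gcongr))))
      _ = _ := by ring

theorem fderiv_le_of_shift {g : E n → ℝ} {q : E n} {C : ℝ} (hC : 0 ≤ C) (hb : ∀ a, ‖g (q + a) - g q‖ ≤ C * ‖a‖) :
    ‖fderiv ℝ g q‖ ≤ C := by
  refine norm_fderiv_le_of_lip' ℝ hC (Eventually.of_forall fun x => ?_)
  simpa using hb (x - q)

theorem Dat.Dth0 (h : Dat Υ H S) (hΥ : 0 ≤ Υ) {q p η : E n} (hp : p ∈ ball (0:E n) 1) (hη : p + η ∈ ball (0:E n) 1) :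
    ‖fderiv ℝ (th H p η) q‖ ≤ Υ * ‖η‖ ^ 2 :=
  fderiv_le_of_shift (by positivity) fun a => h.th0 hΥ hp hη a

theorem Dat.Dth1 (h : Dat Υ H S) (hΥ : 0 ≤ Υ) {q p η q' p' η' : E n} (hp : p ∈ ball (0:E n) 1) (hη : p + η ∈ ball (0:E n) 1)
    (hp' : p' ∈ ball (0:E n) 1) (hη' : p' + η' ∈ ball (0:E n) 1)
    (d1 : DifferentiableAt ℝ (th H p η) q) (d2 : DifferentiableAt ℝ (th H p' η') q') :
    ‖fderiv ℝ (th H p η) q - fderiv ℝ (th H p' η') q'‖ ≤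
      Υ * (‖q - q'‖ + (‖p - p'‖ + ‖η - η'‖)) * ‖η‖ ^ 2 + Υ * ‖η - η'‖ * (‖η‖ + ‖η'‖) := by
  have e1 : HasFDerivAt (fun a => th H p η (q + a)) (fderiv ℝ (th H p η) q) 0 := by
    rw [hasFDerivAt_comp_add_left, add_zero]; exact d1.hasFDerivAt
  have e2 : HasFDerivAt (fun a => th H p' η' (q' + a)) (fderiv ℝ (th H p' η') q') 0 := by
    rw [hasFDerivAt_comp_add_left, add_zero]; exact d2.hasFDerivAt
  rw [← (e1.sub e2).fderiv]
  refine fderiv_le_of_shift (by positivity) fun a => ?_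
  have := h.th1 hΥ hp hη hp' hη' (q := q) (q' := q') a
  refine le_trans (le_of_eq ?_) this
  congr 1; simp only [Pi.sub_apply, zero_add, add_zero]; ring

end DynSec


section Dyn2Sec
set_option maxSynthPendingDepth 3
set_option linter.unusedVariables false
set_option linter.deprecated false

variable {k : ℕ} {Υ l e : ℝ} {h : E n → ℝ} {R : E n → E n → ℝ} {f H : E n → E n → ℝ → ℝ}
    {u v : E n → E n → ℝ → E n}

theorem prod_le (a b : E n) : ‖(a, b)‖ ≤ ‖a‖ + ‖b‖ := by
  rw [Prod.norm_def]; exact max_le (by simp) (by simp)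

theorem Reg.Hp (r : Reg k Υ l e h R f H u v) (t : ℝ) (q : E n) {p : E n} (hp : p ∈ ball (0:E n) 1) :
    HasFDerivAt (fun p' => H q p' t) (fderiv ℝ h p + fderiv ℝ (fun p' => R q p') p + InnerProductSpace.toDual ℝ (E n) (u q p t)) p := by
  have a1 : DifferentiableAt ℝ h p := (r.hh.differentiableOn (by norm_num)).differentiableAt (isOpen_ball.mem_nhds hp)
  have a2 : DifferentiableAt ℝ (fun p => R q p) p :=
      ((slice_R r.hR q).differentiableOn (by norm_num)).differentiableAt (isOpen_ball.mem_nhds hp)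
  rw [r.hH]
  exact (a1.hasFDerivAt.add a2.hasFDerivAt).add (r.fp p hp q t).hasFDerivAt

theorem Reg.Rd (r : Reg k Υ l e h R f H u v) (q : E n) {p : E n} (hp : p ∈ ball (0:E n) 1) :
    DifferentiableAt ℝ (fun x : E n × E n => R x.1 x.2) (q, p) :=
  (r.hR.differentiableOn (by norm_num)).differentiableAt (isOpen_Om.mem_nhds ⟨mem_univ _, hp⟩)

theorem Reg.Hq (r : Reg k Υ l e h R f H u v) (t : ℝ) (q : E n) {p : E n} (hp : p ∈ ball (0:E n) 1) :
    HasFDerivAt (fun q' => H q' p t) (fderiv ℝ (fun q' => R q' p) q + InnerProductSpace.toDual ℝ (E n) (v q p t)) q := by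
  have a2 : DifferentiableAt ℝ (fun q' => R q' p) q :=
    (r.Rd q hp).comp (f := fun q' : E n => (q', p)) q (by fun_prop)
  rw [r.hH]
  exact (a2.hasFDerivAt.const_add (h p)).add (r.fq p hp q t).hasFDerivAt

theorem shift_diff {Y : Type*} [NormedAddCommGroup Y] [NormedSpace ℝ Y] {S : E n × E n → Y} {Υ : ℝ} (hΥ : 0 ≤ Υ)
    (sd : DifferentiableOn ℝ S (univ ×ˢ ball 0 1))
    (dL : ∀ x ∈ (univ : Set (E n)) ×ˢ ball (0 : E n) 1, ∀ y ∈ (univ : Set (E n)) ×ˢ ball (0 : E n) 1,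
      ‖fderivWithin ℝ S (univ ×ˢ ball 0 1) x - fderivWithin ℝ S (univ ×ˢ ball 0 1) y‖ ≤ Υ * ‖x - y‖)
    (a : E n) (y : E n × E n) (hy : y ∈ (univ : Set (E n)) ×ˢ ball (0 : E n) 1)
    (x : E n × E n) (hx : x ∈ (univ : Set (E n)) ×ˢ ball (0 : E n) 1) :
    ‖(S (x + (a, 0)) - S x) - (S (y + (a, 0)) - S y)‖ ≤ Υ * ‖a‖ * ‖x - y‖ := by
  have mm : ∀ x ∈ (univ : Set (E n)) ×ˢ ball (0 : E n) 1, x + (a, 0) ∈ (univ : Set (E n)) ×ˢ ball (0 : E n) 1 := by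
    rintro x ⟨-, hx⟩; exact ⟨mem_univ _, by simpa using hx⟩
  have hd : ∀ x ∈ (univ : Set (E n)) ×ˢ ball (0 : E n) 1, HasFDerivWithinAt (fun x => S (x + (a, 0)) - S x)
      (fderivWithin ℝ (S) (univ ×ˢ ball 0 1) (x + (a, 0)) - fderivWithin ℝ (S) (univ ×ˢ ball 0 1) x) (univ ×ˢ ball 0 1) x := by
    intro x hx
    refine HasFDerivWithinAt.sub ?_ (sd x hx).hasFDerivWithinAt
    have h1 := (sd _ (mm x hx)).hasFDerivWithinAt
    have h2 : HasFDerivWithinAt (fun x : E n × E n => x + (a, 0)) (ContinuousLinearMap.id ℝ _) (univ ×ˢ ball 0 1) x :=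
      (hasFDerivWithinAt_id x _).add_const _
    exact h1.comp x h2 mm
  have := convex_Om.norm_image_sub_le_of_norm_hasFDerivWithin_le (C := Υ * ‖a‖) hd (fun x hx => by
    have := dL _ (mm x hx) _ hx
    rw [add_sub_cancel_left] at this
    refine this.trans (le_of_eq ?_)
    simp [Prod.norm_def]) hy hx
  exact this

theorem Reg.dat (r : Reg k Υ l e h R f H u v) (hΥ : 0 ≤ Υ) (t : ℝ) : Dat Υ (fun q p => H q p t) (SS H t) := by
  have sd : DifferentiableOn ℝ (SS H t) (univ ×ˢ ball 0 1) := (r.SC t).differentiableOn (by simp)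
  have sL : ∀ x ∈ (univ : Set (E n)) ×ˢ ball (0 : E n) 1, ∀ y ∈ (univ : Set (E n)) ×ˢ ball (0 : E n) 1,
      ‖SS H t x - SS H t y‖ ≤ Υ * ‖x - y‖ := fun x hx y hy =>
    lip_of_iter isOpen_Om convex_Om sd (fun x hx => r.SB t x hx 1 (by omega)) hx hy
  have dd : DifferentiableOn ℝ (fderivWithin ℝ (SS H t) (univ ×ˢ ball 0 1)) (univ ×ˢ ball 0 1) := by
    have := (r.SC t).fderivWithin (m := 1) isOpen_Om.uniqueDiffOn (by norm_cast; omega)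
    exact this.differentiableOn (by simp)
  have dL : ∀ x ∈ (univ : Set (E n)) ×ˢ ball (0 : E n) 1, ∀ y ∈ (univ : Set (E n)) ×ˢ ball (0 : E n) 1,
      ‖fderivWithin ℝ (SS H t) (univ ×ˢ ball 0 1) x - fderivWithin ℝ (SS H t) (univ ×ˢ ball 0 1) y‖ ≤ Υ * ‖x - y‖ := fun x hx y hy =>
    lip_of_iter isOpen_Om convex_Om dd (fun x hx => by
      rw [norm_iteratedFDerivWithin_fderivWithin isOpen_Om.uniqueDiffOn hx]
      exact r.SB t x hx 2 (by omega)) hx hy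
  refine ⟨?_, ?_, ?_, ?_, ?_, ?_⟩
  · intro q p hp
    exact (r.Hp t q hp).differentiableAt.hasFDerivAt
  · intro q p hp
    exact (r.SH t q p hp).hasFDerivAt
  · intro q p hp
    exact (r.Hq t q hp).differentiableAt
  · intro q p hp
    have := r.SB t (q, p) ⟨mem_univ _, hp⟩ 0 (by omega)
    rwa [norm_iteratedFDerivWithin_zero] at this
  · intro q q' p hp p' hp'
    refine (sL (q, p) ⟨mem_univ _, hp⟩ (q', p') ⟨mem_univ _, hp'⟩).trans ?_
    gcongr; exact prod_le _ _
  · intro a q q' p hp p' hp'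
    have := shift_diff hΥ sd dL a (q', p') ⟨mem_univ _, hp'⟩ (q, p) ⟨mem_univ _, hp⟩
    simp only [Prod.mk_add_mk, add_zero] at this
    refine this.trans ?_
    gcongr; exact prod_le _ _

variable {D : Set (E n)}

theorem Reg.PD (r : Reg k Υ l e h R f H u v) (hD : D ⊆ ball 0 1)
    (h0 : ∀ q : E n, ∀ p ∈ D, R q p = 0 ∧ fderiv ℝ (fun p' => R q p') p = 0) (t : ℝ) (q : E n) {p : E n} (hp : p ∈ D) :
    fderiv ℝ (fun p' => H q p' t) p = fderiv ℝ h p + InnerProductSpace.toDual ℝ (E n) (u q p t) := by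
  have := (r.Hp t q (hD hp)).fderiv
  rw [this, (h0 q p hp).2, add_zero]

theorem Reg.F0 (r : Reg k Υ l e h R f H u v) (hΥ : 0 ≤ Υ) (hD : D ⊆ ball 0 1)
    (h0 : ∀ q : E n, ∀ p ∈ D, R q p = 0 ∧ fderiv ℝ (fun p' => R q p') p = 0) (t : ℝ) (q : E n) {p η : E n} (hp : p ∈ D)
    (hη : p + η ∈ ball (0:E n) 1) :
    ‖fderiv ℝ (fun p' => H q p' t) (p + η) - fderiv ℝ h p‖ ≤ e * bw (l + 1) t + Υ * ‖η‖ := by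
  have h1 := (r.dat hΥ t).P0 (q := q) (hD hp) hη
  have h2 := r.uB p (hD hp) t q 0 (by omega)
  rw [norm_iteratedFDeriv_zero] at h2
  rw [r.PD hD h0 t q hp] at h1
  rw [show fderiv ℝ (fun p' => H q p' t) (p + η) - fderiv ℝ h p = InnerProductSpace.toDual ℝ (E n) (u q p t) +
    (fderiv ℝ (fun p' => H q p' t) (p + η) - (fderiv ℝ h p + InnerProductSpace.toDual ℝ (E n) (u q p t))) by abel]
  refine (norm_add_le _ _).trans (add_le_add ?_ h1)
  rw [toDual_sub]; exact h2

theorem lip_of_iterU {g : E n → E n} {C : ℝ} (hg : Differentiable ℝ g) 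
    (hb : ∀ x, ‖iteratedFDeriv ℝ 1 g x‖ ≤ C) (x y : E n) : ‖g x - g y‖ ≤ C * ‖x - y‖ :=
  lip_of_iter isOpen_univ convex_univ hg.differentiableOn (fun x _ => by rw [iteratedFDerivWithin_univ]; exact hb x) (mem_univ x) (mem_univ y)

theorem Reg.du (r : Reg k Υ l e h R f H u v) (t : ℝ) (q q' : E n) {p p' : E n} (hp : p ∈ ball (0:E n) 1)
    (hp' : p' ∈ ball (0:E n) 1) : ‖u q p t - u q' p' t‖ ≤ e * bw (l + 1) t * ‖q - q'‖ + e * bw l t * ‖p - p'‖ := by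
  rw [show u q p t - u q' p' t = (u q p t - u q' p t) + (u q' p t - u q' p' t) by abel]
  refine (norm_add_le _ _).trans (add_le_add ?_ (r.uL p hp p' hp' t q'))
  exact lip_of_iterU (g := fun q => u q p t) ((r.uC p hp t).differentiable (by simp)) (fun x => r.uB p hp t x 1 (by omega)) q q'

theorem Reg.vC (r : Reg k Υ l e h R f H u v) (t : ℝ) {p : E n} (hp : p ∈ ball (0:E n) 1) : ContDiff ℝ ((k + 1 : ℕ)) (fun q => v q p t) := by
  have h1 : (fun q => v q p t) = fun q => (InnerProductSpace.toDual ℝ (E n)).symm (fderiv ℝ (fun q => f q p t) q) := by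
    funext q
    rw [(r.fq p hp q t).hasFDerivAt.fderiv, LinearIsometryEquiv.symm_apply_apply]
  rw [h1]
  exact (InnerProductSpace.toDual ℝ (E n)).symm.contDiff.comp ((r.fC p hp t).fderiv_right (by norm_cast))

theorem Reg.dv (r : Reg k Υ l e h R f H u v) (t : ℝ) (q q' : E n) {p p' : E n} (hp : p ∈ ball (0:E n) 1)
    (hp' : p' ∈ ball (0:E n) 1) : ‖v q p t - v q' p' t‖ ≤ e * bw (l + 2) t * ‖q - q'‖ + e * bw (l + 1) t * ‖p - p'‖ := by
  rw [show v q p t - v q' p' t = (v q p t - v q' p t) + (v q' p t - v q' p' t) by abel]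
  refine (norm_add_le _ _).trans (add_le_add ?_ (r.vL p hp p' hp' t q'))
  exact lip_of_iterU (g := fun q => v q p t) ((r.vC t hp).differentiable (by simp)) (fun x => r.vB p hp t x 1 (by omega)) q q'

theorem Reg.ddu (r : Reg k Υ l e h R f H u v) (t : ℝ) (q q' : E n) {p p' : E n} (hp : p ∈ ball (0:E n) 1)
    (hp' : p' ∈ ball (0:E n) 1) : ‖fderiv ℝ (fun q => u q p t) q - fderiv ℝ (fun q => u q p' t) q'‖ ≤ e * bw (l + 1) t * ‖q - q'‖ + e * bw l t * ‖p - p'‖ := by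
  rw [show fderiv ℝ (fun q => u q p t) q - fderiv ℝ (fun q => u q p' t) q' = (fderiv ℝ (fun q => u q p t) q - fderiv ℝ (fun q => u q p t) q') +
    (fderiv ℝ (fun q => u q p t) q' - fderiv ℝ (fun q => u q p' t) q') by abel]
  refine (norm_add_le _ _).trans (add_le_add ?_ (r.duL p hp p' hp' t q'))
  have hd : ContDiff ℝ 1 (fderiv ℝ (fun q => u q p t)) := (r.uC p hp t).fderiv_right (by norm_cast; omega)
  refine lip_of_iter isOpen_univ convex_univ (hd.differentiable (by simp)).differentiableOn (fun x _ => ?_) (mem_univ q) (mem_univ q')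
  rw [iteratedFDerivWithin_univ, norm_iteratedFDeriv_fderiv]
  exact r.uB p hp t x 2 (by omega)

theorem Reg.F1 (r : Reg k Υ l e h R f H u v) (hΥ : 0 ≤ Υ) (hD : D ⊆ ball 0 1)
    (h0 : ∀ q : E n, ∀ p ∈ D, R q p = 0 ∧ fderiv ℝ (fun p' => R q p') p = 0) (t : ℝ) (q q' : E n) {p η p' η' : E n} (hp : p ∈ D)
    (hη : p + η ∈ ball (0:E n) 1) (hp' : p' ∈ D) (hη' : p' + η' ∈ ball (0:E n) 1) :
    ‖(fderiv ℝ (fun p' => H q p' t) (p + η) - fderiv ℝ h p) - (fderiv ℝ (fun p => H q' p t) (p' + η') - fderiv ℝ h p')‖ ≤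
      (e * bw (l + 1) t * ‖q - q'‖ + e * bw l t * ‖p - p'‖) +
      (Υ * ‖η - η'‖ + Υ * (‖q - q'‖ + (‖p - p'‖ + ‖η - η'‖)) * ‖η'‖) := by
  have h1 := (r.dat hΥ t).P1 hΥ (q := q) (q' := q') (hD hp) hη (hD hp') hη'
  have h2 := r.du t q q' (hD hp) (hD hp')
  rw [r.PD hD h0 t q hp, r.PD hD h0 t q' hp'] at h1
  rw [show (fderiv ℝ (fun p' => H q p' t) (p + η) - fderiv ℝ h p) - (fderiv ℝ (fun p => H q' p t) (p' + η') - fderiv ℝ h p') =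
     InnerProductSpace.toDual ℝ (E n) (u q p t - u q' p' t) +
    ((fderiv ℝ (fun p' => H q p' t) (p + η) - (fderiv ℝ h p + InnerProductSpace.toDual ℝ (E n) (u q p t))) -
     (fderiv ℝ (fun p => H q' p t) (p' + η') - (fderiv ℝ h p' + InnerProductSpace.toDual ℝ (E n) (u q' p' t)))) by
       rw [map_sub]; abel]
  refine (norm_add_le _ _).trans (add_le_add ?_ h1)
  rw [toDual_sub]; exact h2

theorem Reg.Hth (r : Reg k Υ l e h R f H u v) (hD : D ⊆ ball 0 1)
    (h0 : ∀ q : E n, ∀ p ∈ D, R q p = 0 ∧ fderiv ℝ (fun p' => R q p') p = 0) (t : ℝ) (q : E n) {p η : E n} (hp : p ∈ D)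
    (hη : p + η ∈ ball (0:E n) 1) : HasFDerivAt (th (fun q p => H q p t) p η)
      (fderiv ℝ (fun q' => H q' (p + η) t) q - InnerProductSpace.toDual ℝ (E n) (v q p t)
        - (innerSL ℝ η).comp (fderiv ℝ (fun q => u q p t) q)) q := by
  have e1 : th (fun q p => H q p t) p η = fun q => H q (p + η) t - (h p + f q p t) - (fderiv ℝ h p η + innerSL ℝ η (u q p t)) := by
    funext q
    simp only [th]
    rw [r.PD hD h0 t q hp]
    simp only [r.hH, (h0 q p hp).1, add_zero, ContinuousLinearMap.add_apply, InnerProductSpace.toDual_apply_apply, innerSL_apply_apply]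
    rw [real_inner_comm]
  rw [e1]
  refine HasFDerivAt.sub (HasFDerivAt.sub ?_ ?_) ?_
  · exact (r.Hq t q hη).differentiableAt.hasFDerivAt
  · exact (r.fq p (hD hp) q t).hasFDerivAt.const_add _
  · have := ((r.uC p (hD hp) t).differentiable (by simp) q).hasFDerivAt
    exact ((innerSL ℝ η).hasFDerivAt.comp q this).const_add _

theorem Reg.G0 (r : Reg k Υ l e h R f H u v) (hΥ : 0 ≤ Υ) (hD : D ⊆ ball 0 1)
    (h0 : ∀ q : E n, ∀ p ∈ D, R q p = 0 ∧ fderiv ℝ (fun p' => R q p') p = 0) (t : ℝ) (q : E n) {p η : E n} (hp : p ∈ D)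
    (hη : p + η ∈ ball (0:E n) 1) :
    ‖fderiv ℝ (fun q' => H q' (p + η) t) q‖ ≤ e * bw (l + 2) t + e * bw (l + 1) t * ‖η‖ + Υ * ‖η‖ ^ 2 := by
  have h1 := (r.dat hΥ t).Dth0 hΥ (q := q) (hD hp) hη
  rw [(r.Hth hD h0 t q hp hη).fderiv] at h1
  have h2 := r.vB p (hD hp) t q 0 (by omega)
  rw [norm_iteratedFDeriv_zero] at h2
  have h3 := r.uB p (hD hp) t q 1 (by omega)
  rw [norm_iteratedFDeriv_one] at h3
  have h4 : ‖(innerSL ℝ η).comp (fderiv ℝ (fun q => u q p t) q)‖ ≤ e * bw (l + 1) t * ‖η‖ := by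
    refine (ContinuousLinearMap.opNorm_comp_le _ _).trans ?_
    rw [innerSL_apply_norm, mul_comm]; gcongr
  rw [← toDual_sub] at h2
  generalize fderiv ℝ (fun q' => H q' (p + η) t) q = A at *
  generalize InnerProductSpace.toDual ℝ (E n) (v q p t) = B at *
  generalize (innerSL ℝ η).comp (fderiv ℝ (fun q => u q p t) q) = C at *
  rw [show A = B + C + (A - B - C) by abel]
  exact (norm_add₃_le).trans (by gcongr)

theorem Reg.G1 (r : Reg k Υ l e h R f H u v) (hΥ : 0 ≤ Υ) (hD : D ⊆ ball 0 1)
    (h0 : ∀ q : E n, ∀ p ∈ D, R q p = 0 ∧ fderiv ℝ (fun p' => R q p') p = 0) (t : ℝ) (q q' : E n) {p η p' η' : E n} (hp : p ∈ D)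
    (hη : p + η ∈ ball (0:E n) 1) (hp' : p' ∈ D) (hη' : p' + η' ∈ ball (0:E n) 1) :
    ‖fderiv ℝ (fun q' => H q' (p + η) t) q - fderiv ℝ (fun q => H q (p' + η') t) q'‖ ≤
      (e * bw (l + 2) t * ‖q - q'‖ + e * bw (l + 1) t * ‖p - p'‖) +
      (‖η - η'‖ * (e * bw (l + 1) t) + ‖η'‖ * (e * bw (l + 1) t * ‖q - q'‖ + e * bw l t * ‖p - p'‖)) +
      (Υ * (‖q - q'‖ + (‖p - p'‖ + ‖η - η'‖)) * ‖η‖ ^ 2 + Υ * ‖η - η'‖ * (‖η‖ + ‖η'‖)) := by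
  have t1 := r.Hth hD h0 t q hp hη
  have t2 := r.Hth hD h0 t q' hp' hη'
  have h1 := (r.dat hΥ t).Dth1 hΥ (q := q) (q' := q') (hD hp) hη (hD hp') hη' t1.differentiableAt t2.differentiableAt
  rw [t1.fderiv, t2.fderiv] at h1
  have h2 := r.dv t q q' (hD hp) (hD hp')
  rw [← toDual_sub, map_sub] at h2
  have h3 := r.uB p (hD hp) t q 1 (by omega)
  rw [norm_iteratedFDeriv_one] at h3
  have h5 := r.ddu t q q' (hD hp) (hD hp')
  have h4 : ‖(innerSL ℝ η).comp (fderiv ℝ (fun q => u q p t) q) - (innerSL ℝ η').comp (fderiv ℝ (fun q => u q p' t) q')‖ ≤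
      ‖η - η'‖ * (e * bw (l + 1) t) + ‖η'‖ * (e * bw (l + 1) t * ‖q - q'‖ + e * bw l t * ‖p - p'‖) := by
    rw [show (innerSL ℝ η).comp (fderiv ℝ (fun q => u q p t) q) - (innerSL ℝ η').comp (fderiv ℝ (fun q => u q p' t) q') =
      (innerSL ℝ (η - η')).comp (fderiv ℝ (fun q => u q p t) q) + (innerSL ℝ η').comp (fderiv ℝ (fun q => u q p t) q - fderiv ℝ (fun q => u q p' t) q') by
        rw [map_sub, ContinuousLinearMap.sub_comp, ContinuousLinearMap.comp_sub]; abel]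
    refine (norm_add_le _ _).trans (add_le_add ?_ ?_)
    · refine (ContinuousLinearMap.opNorm_comp_le _ _).trans ?_
      rw [innerSL_apply_norm]; gcongr
    · refine (ContinuousLinearMap.opNorm_comp_le _ _).trans ?_
      rw [innerSL_apply_norm]; gcongr
  generalize fderiv ℝ (fun q' => H q' (p + η) t) q = A at *
  generalize InnerProductSpace.toDual ℝ (E n) (v q p t) = B at *
  generalize (innerSL ℝ η).comp (fderiv ℝ (fun q => u q p t) q) = C at *
  generalize fderiv ℝ (fun q' => H q' (p' + η') t) q' = A' at *
  generalize InnerProductSpace.toDual ℝ (E n) (v q' p' t) = B' at *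
  generalize (innerSL ℝ η').comp (fderiv ℝ (fun q => u q p' t) q') = C' at *
  rw [show A - A' = (B - B') + (C - C') + ((A - B - C) - (A' - B' - C')) by abel]
  exact (norm_add₃_le).trans (by gcongr)

end Dyn2Sec


section Dyn3Sec
set_option maxSynthPendingDepth 3
set_option linter.unusedVariables false
set_option linter.deprecated false

variable {k : ℕ} {Υ l e : ℝ} {h : E n → ℝ} {R : E n → E n → ℝ} {f H : E n → E n → ℝ → ℝ}
    {u v : E n → E n → ℝ → E n}

/-- rescaled angular field -/
def FF (s : ℝ) (h : E n → ℝ) (H : E n → E n → ℝ → ℝ) (q p η : E n) (t : ℝ) : E n :=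
  s • gradient (fun p' => H q p' (s * t)) (p + η) - s • gradient h p

/-- rescaled action field -/
def GG (s : ℝ) (H : E n → E n → ℝ → ℝ) (q p η : E n) (t : ℝ) : E n :=
  -(s • gradient (fun q' => H q' (p + η) (s * t)) q)

theorem bw_sgn {s : ℝ} (hs : |s| = 1) (m t : ℝ) : bw m (s * t) = bw m t := by
  unfold bw; rw [abs_mul, hs, one_mul]

theorem grad_def (g : E n → ℝ) (x : E n) : gradient g x = (InnerProductSpace.toDual ℝ (E n)).symm (fderiv ℝ g x) := rfl

theorem norm_sgn {s : ℝ} (hs : |s| = 1) (x : E n) : ‖s • x‖ = ‖x‖ := by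
  rw [norm_smul, Real.norm_eq_abs, hs, one_mul]

theorem Reg.cP (r : Reg k Υ l e h R f H u v) : ContinuousOn (fun x : E n × E n × ℝ => gradient (fun p' => H x.1 p' x.2.2) x.2.1)
    (univ ×ˢ (ball 0 1 ×ˢ univ)) := by
  have h1 : ContinuousOn (fderiv ℝ h) (ball 0 1) := (r.hh.fderiv_of_isOpen (m := 1) isOpen_ball (by norm_num)).continuousOn
  have h2 : ContinuousOn (fderiv ℝ (fun x : E n × E n => R x.1 x.2)) (univ ×ˢ ball 0 1) :=
    (r.hR.fderiv_of_isOpen (m := 1) isOpen_Om (by norm_num)).continuousOn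
  have g1 : ContinuousOn (fun x : E n × E n × ℝ => fderiv ℝ h x.2.1) (univ ×ˢ (ball 0 1 ×ˢ univ)) :=
    h1.comp (by fun_prop) fun x hx => hx.2.1
  have g2 : ContinuousOn (fun x : E n × E n × ℝ => (fderiv ℝ (fun x : E n × E n => R x.1 x.2) (x.1, x.2.1)).comp (ContinuousLinearMap.inr ℝ (E n) (E n)))
      (univ ×ˢ (ball 0 1 ×ˢ univ)) := by
    refine ContinuousOn.clm_comp ?_ continuousOn_const
    exact h2.comp (f := fun x : E n × E n × ℝ => (x.1, x.2.1)) (by fun_prop) fun x hx => ⟨mem_univ _, hx.2.1⟩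
  have g3 := (InnerProductSpace.toDual ℝ (E n)).continuous.comp_continuousOn r.cu
  have g4 := (InnerProductSpace.toDual ℝ (E n)).symm.continuous.comp_continuousOn ((g1.add g2).add g3)
  refine g4.congr fun x hx => ?_
  rw [grad_def, (r.Hp x.2.2 x.1 hx.2.1).fderiv]
  simp only [Function.comp, Pi.add_apply]
  congr 3
  have := (r.Rd x.1 hx.2.1).hasFDerivAt.comp (x.2.1) (hasFDerivAt_prodMk_right x.1 x.2.1)
  exact this.fderiv

theorem Reg.cQ (r : Reg k Υ l e h R f H u v) : ContinuousOn (fun x : E n × E n × ℝ => gradient (fun q' => H q' x.2.1 x.2.2) x.1)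
    (univ ×ˢ (ball 0 1 ×ˢ univ)) := by
  have h2 : ContinuousOn (fderiv ℝ (fun x : E n × E n => R x.1 x.2)) (univ ×ˢ ball 0 1) :=
    (r.hR.fderiv_of_isOpen (m := 1) isOpen_Om (by norm_num)).continuousOn
  have g2 : ContinuousOn (fun x : E n × E n × ℝ => (fderiv ℝ (fun x : E n × E n => R x.1 x.2) (x.1, x.2.1)).comp (ContinuousLinearMap.inl ℝ (E n) (E n)))
      (univ ×ˢ (ball 0 1 ×ˢ univ)) := by
    refine ContinuousOn.clm_comp ?_ continuousOn_const
    exact h2.comp (f := fun x : E n × E n × ℝ => (x.1, x.2.1)) (by fun_prop) fun x hx => ⟨mem_univ _, hx.2.1⟩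
  have g3 := (InnerProductSpace.toDual ℝ (E n)).continuous.comp_continuousOn r.cv
  have g4 := (InnerProductSpace.toDual ℝ (E n)).symm.continuous.comp_continuousOn (g2.add g3)
  refine g4.congr fun x hx => ?_
  rw [grad_def, (r.Hq x.2.2 x.1 hx.2.1).fderiv]
  simp only [Function.comp, Pi.add_apply]
  congr 2
  have := HasFDerivAt.comp (g := fun x : E n × E n => R x.1 x.2) (f := fun e => (e, x.2.1)) (x.1) (r.Rd x.1 hx.2.1).hasFDerivAt (hasFDerivAt_prodMk_left (𝕜 := ℝ) x.1 x.2.1)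
  exact this.fderiv

variable {D : Set (E n)}

theorem grad_sub_norm (g g' : E n → ℝ) (x x' : E n) : ‖gradient g x - gradient g' x'‖ = ‖fderiv ℝ g x - fderiv ℝ g' x'‖ := by
  rw [grad_def, grad_def, ← map_sub, LinearIsometryEquiv.norm_map]

theorem FF_norm {s : ℝ} (hs : |s| = 1) (q p η : E n) (t : ℝ) :
    ‖FF s h H q p η t‖ = ‖fderiv ℝ (fun p' => H q p' (s * t)) (p + η) - fderiv ℝ h p‖ := by
  rw [FF, ← smul_sub, norm_sgn hs, grad_sub_norm]

theorem FF_norm2 {s : ℝ} (hs : |s| = 1) (q p η q' p' η' : E n) (t : ℝ) :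
    ‖FF s h H q p η t - FF s h H q' p' η' t‖ = ‖(fderiv ℝ (fun p' => H q p' (s * t)) (p + η) - fderiv ℝ h p) -
      (fderiv ℝ (fun p => H q' p (s * t)) (p' + η') - fderiv ℝ h p')‖ := by
  rw [FF, FF, ← smul_sub, ← smul_sub, ← smul_sub, norm_sgn hs]
  simp only [grad_def]
  rw [← map_sub, ← map_sub, ← map_sub, LinearIsometryEquiv.norm_map]

theorem GG_norm {s : ℝ} (hs : |s| = 1) (q p η : E n) (t : ℝ) :
    ‖GG s H q p η t‖ = ‖fderiv ℝ (fun q' => H q' (p + η) (s * t)) q‖ := by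
  rw [GG, norm_neg, norm_sgn hs, grad_def, LinearIsometryEquiv.norm_map]

theorem GG_norm2 {s : ℝ} (hs : |s| = 1) (q p η q' p' η' : E n) (t : ℝ) :
    ‖GG s H q p η t - GG s H q' p' η' t‖ = ‖fderiv ℝ (fun q' => H q' (p + η) (s * t)) q -
      fderiv ℝ (fun q => H q (p' + η') (s * t)) q'‖ := by
  rw [GG, GG, neg_sub_neg, ← smul_sub, norm_sgn hs, norm_sub_rev, grad_sub_norm]

theorem Reg.hf {c K C ε s : ℝ} (hs : |s| = 1) (hΥ : 1 ≤ Υ) (hl : 1 < l) (hc : 1 ≤ c) (hε : 0 < ε) (hε1 : ε ≤ 1)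
    (r : Reg k Υ l (ε * c) h R f H u v) (hD : D ⊆ ball 0 1)
    (h0 : ∀ q : E n, ∀ p ∈ D, R q p = 0 ∧ fderiv ℝ (fun p' => R q p') p = 0)
    (hK : ∀ p ∈ D, ∀ p' ∈ D, ‖gradient h p - gradient h p'‖ ≤ K * ‖p - p'‖)
    (hr : ∀ p ∈ D, ‖p‖ + ε * (c + 1) < 1) (hsm : ε * (c * (c + 1) + Υ * (c + 1) ^ 2) ≤ 1)
    (hC1 : c + Υ * (c + 1) ≤ C) (hC2 : Υ + Υ * (c + 1) ≤ C)
    (hC3 : c + c * (c + 1) + Υ * (c + 1) ^ 2 + 2 * Υ * (c + 1) ≤ C) :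
    HF l K C (c + 1) ε D (fun p => s • gradient h p) (FF s h H) (GG s H) := by
  have hΥ0 : 0 ≤ Υ := by linarith
  set M := c + 1 with hM
  have hM1 : 1 ≤ M := by linarith
  have mem : ∀ p ∈ D, ∀ η t, ‖η‖ ≤ ε * M * bw (l + 1) t → p + η ∈ ball (0 : E n) 1 := by
    intro p hp η t hη
    rw [mem_ball_zero_iff]
    have := bw_le_one (m := l + 1) (by linarith) t
    have h2 : ε * M * bw (l + 1) t ≤ ε * M := by
      have : 0 ≤ ε * M := by positivity
      nlinarith
    linarith [norm_add_le p η, hr p hp]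
  have b2 : ∀ t, bw (l + 1) t * bw (l + 1) t ≤ bw (l + 2) t := fun t => by
    rw [← bw_add]; exact bw_anti (by linarith) t
  have b3 : ∀ t, bw l t * bw (l + 1) t ≤ bw (l + 1) t := fun t => by
    rw [← bw_add]; exact bw_anti (by linarith) t
  have b4 : ∀ t, bw (l + 2) t ≤ bw (l + 1) t := fun t => bw_anti (by linarith) t
  have b5 : ∀ t, bw (l + 1) t ≤ bw l t := fun t => bw_anti (by linarith) t
  have b6 : ∀ t, bw (l + 1) t ≤ 1 := fun t => bw_le_one (by linarith) t
  refine ⟨?_, ?_, ?_, ?_, ?_, ?_, ?_⟩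
  · intro p hp p' hp'
    rw [← smul_sub, norm_sgn hs]; exact hK p hp p' hp'
  · intro p hp
    unfold FF
    refine ContinuousOn.sub (ContinuousOn.const_smul ?_ s) continuousOn_const
    exact r.cP.comp (f := fun x : E n × E n × ℝ => (x.1, p + x.2.1, s * x.2.2)) (by fun_prop)
      fun x hx => ⟨mem_univ _, mem p hp _ _ hx.2, mem_univ _⟩
  · intro p hp
    unfold GG
    refine ContinuousOn.neg (ContinuousOn.const_smul ?_ s)
    exact r.cQ.comp (f := fun x : E n × E n × ℝ => (x.1, p + x.2.1, s * x.2.2)) (by fun_prop)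
      fun x hx => ⟨mem_univ _, mem p hp _ _ hx.2, mem_univ _⟩
  · intro p hp q η t ht hη
    rw [FF_norm hs]
    have h1 := r.F0 hΥ0 hD h0 (s * t) q hp (mem p hp η t hη)
    rw [bw_sgn hs] at h1
    have hb := bw_pos (l+1) t
    refine h1.trans ?_
    calc _ ≤ ε * c * bw (l + 1) t + Υ * (ε * M * bw (l + 1) t) := by gcongr
      _ = ε * (c + Υ * M) * bw (l + 1) t := by ring
      _ ≤ _ := by
        gcongr
  · intro p hp q η t ht hη
    rw [GG_norm hs]
    have h1 := r.G0 hΥ0 hD h0 (s * t) q hp (mem p hp η t hη)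
    rw [bw_sgn hs, bw_sgn hs] at h1
    have hb := bw_pos (l+1) t
    have hb2 := bw_pos (l+2) t
    refine h1.trans ?_
    calc _ ≤ ε * c * bw (l + 2) t + ε * c * bw (l + 1) t * (ε * M * bw (l + 1) t) + Υ * (ε * M * bw (l + 1) t) ^ 2 := by gcongr
      _ = ε * c * bw (l + 2) t + ε * (ε * (c * M + Υ * M ^ 2)) * (bw (l + 1) t * bw (l + 1) t) := by ring
      _ ≤ ε * c * bw (l + 2) t + ε * 1 * bw (l + 2) t := by
        have := b2 t
        gcongr
      _ = _ := by rw [hM]; ring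
  · intro p hp p' hp' q q' η η' t ht hη hη'
    rw [FF_norm2 hs]
    have h1 := r.F1 hΥ0 hD h0 (s * t) q q' hp (mem p hp η t hη) hp' (mem p' hp' η' t hη')
    rw [bw_sgn hs, bw_sgn hs] at h1
    refine h1.trans ?_
    have hb := bw_pos (l+1) t
    have hb1 := bw_pos l t
    have hb5 := b5 t
    have hb6 := b6 t
    have n1 := norm_nonneg (q - q')
    have n2 := norm_nonneg (p - p')
    have n3 := norm_nonneg (η - η')
    generalize ‖q - q'‖ = a at *
    generalize ‖p - p'‖ = b at *
    generalize ‖η - η'‖ = d at *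
    generalize ‖η'‖ = y at *
    generalize bw (l + 1) t = B at *
    generalize bw l t = B0 at *
    have e1 : ε * M * B ≤ M := by
      have : ε * B ≤ 1 := by nlinarith
      nlinarith
    calc _ ≤ (ε * c * B * a + ε * c * B0 * b) + (Υ * d + (Υ * (a + b) * (ε * M * B) + Υ * d * M)) := by
          have : Υ * (a + (b + d)) * y ≤ Υ * (a + b) * (ε * M * B) + Υ * d * M := by
            rw [show Υ * (a + (b + d)) * y = Υ * (a + b) * y + Υ * d * y by ring]
            gcongr
            linarith
          linarith
      _ ≤ (ε * c * B * a + ε * c * B0 * b) + (Υ * d + (Υ * a * (ε * M * B) + Υ * b * (ε * M * B0) + Υ * d * M)) := by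
          have : Υ * b * (ε * M * B) ≤ Υ * b * (ε * M * B0) := by gcongr
          linarith
      _ = (Υ + Υ * M) * d + ε * (c + Υ * M) * (B * a + B0 * b) := by ring
      _ ≤ _ := by
          have k0 := mul_nonneg hΥ0 (by positivity : 0 ≤ M ^ 2)
          have k1 := mul_nonneg hΥ0 (by positivity : 0 ≤ M)
          have k2 := mul_nonneg (by linarith : 0 ≤ c) (by positivity : 0 ≤ M)
          gcongr
  · intro p hp p' hp' q q' η η' t ht hη hη'
    rw [GG_norm2 hs]
    have h1 := r.G1 hΥ0 hD h0 (s * t) q q' hp (mem p hp η t hη) hp' (mem p' hp' η' t hη')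
    rw [bw_sgn hs, bw_sgn hs, bw_sgn hs] at h1
    refine h1.trans ?_
    have hb := bw_pos (l+1) t
    have hb1 := bw_pos l t
    have hb2 := bw_pos (l+2) t
    have hb3 := b3 t
    have hb4 := b4 t
    have hb6 := b6 t
    have hb7 := b2 t
    have n1 := norm_nonneg (q - q')
    have n2 := norm_nonneg (p - p')
    have n3 := norm_nonneg (η - η')
    have m1 := norm_nonneg η
    have m2 := norm_nonneg η'
    generalize ‖q - q'‖ = a at *
    generalize ‖p - p'‖ = b at *
    generalize ‖η - η'‖ = d at *
    generalize ‖η'‖ = y at *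
    generalize ‖η‖ = x at *
    generalize bw (l + 1) t = B at *
    generalize bw (l + 2) t = B2 at *
    generalize bw l t = B0 at *
    have x2 : x ^ 2 ≤ ε * M ^ 2 * B2 := by
      calc x ^ 2 ≤ (ε * M * B) ^ 2 := by gcongr
        _ = ε * (ε * M ^ 2 * (B * B)) := by ring
        _ ≤ 1 * (ε * M ^ 2 * B2) := by gcongr
        _ = _ := by ring
    have yB : y * B ≤ M * B2 := by
      calc y * B ≤ (ε * M * B) * B := by gcongr
        _ = ε * (M * (B * B)) := by ring
        _ ≤ 1 * (M * B2) := by gcongr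
        _ = _ := by ring
    have yB0 : y * B0 ≤ M * B := by
      calc y * B0 ≤ (ε * M * B) * B0 := by gcongr
        _ = ε * (M * (B0 * B)) := by ring
        _ ≤ 1 * (M * B) := by gcongr
        _ = _ := by ring
    have t1 : y * (ε * c * B * a + ε * c * B0 * b) ≤ ε * (c * M) * (B2 * a + B * b) := by
      calc _ = ε * c * ((y * B) * a + (y * B0) * b) := by ring
        _ ≤ ε * c * ((M * B2) * a + (M * B) * b) := by gcongr
        _ = _ := by ring
    have t2 : Υ * (a + (b + d)) * x ^ 2 ≤ ε * (Υ * M ^ 2) * (B2 * a + B * (b + d)) := by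
      calc _ ≤ Υ * (a + (b + d)) * (ε * M ^ 2 * B2) := by gcongr
        _ = ε * (Υ * M ^ 2) * (B2 * a + B2 * (b + d)) := by ring
        _ ≤ _ := by gcongr
    have t3 : Υ * d * (x + y) ≤ ε * (2 * Υ * M) * (B * d) := by
      calc _ ≤ Υ * d * (ε * M * B + ε * M * B) := by gcongr
        _ = _ := by ring
    calc _ ≤ (ε * c * B2 * a + ε * c * B * b) + (d * (ε * c * B) + ε * (c * M) * (B2 * a + B * b)) +
          (ε * (Υ * M ^ 2) * (B2 * a + B * (b + d)) + ε * (2 * Υ * M) * (B * d)) := by linarith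
      _ ≤ (ε * c * B2 * a + ε * c * B * b) + (d * (ε * c * B) + ε * (c * M) * (B2 * a + B * (b + d))) +
          (ε * (Υ * M ^ 2) * (B2 * a + B * (b + d)) + ε * (2 * Υ * M) * (B2 * a + B * (b + d))) := by
          gcongr
          · linarith
          · have : 0 ≤ B2 * a := by positivity
            have : 0 ≤ B * b := by positivity
            nlinarith
      _ = ε * (c + c * M + Υ * M ^ 2 + 2 * Υ * M) * (B2 * a + B * (b + d)) := by ring
      _ ≤ _ := by
          have k0 := mul_nonneg hΥ0 (by positivity : 0 ≤ M ^ 2)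
          have k1 := mul_nonneg hΥ0 (by positivity : 0 ≤ M)
          have k2 := mul_nonneg (by linarith : 0 ≤ c) (by positivity : 0 ≤ M)
          gcongr

end Dyn3Sec


section CurveSec
set_option maxSynthPendingDepth 3
set_option linter.unusedVariables false
set_option linter.deprecated false

/-- half-orbits -/
def Curve (s ε A M : ℝ) (D : Set (E n)) (ω : E n → E n) (X : E n → E n → ℝ → E n × E n) (Z : E n × E n → E n × E n) : Prop :=
  (∀ x y : E n × E n, x.2 ∈ D → y.2 ∈ D → ‖Z x - Z y‖ ≤ ε * A * ‖x - y‖) ∧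
  (∀ x : E n × E n, x.2 ∈ D → ‖(Z x).1‖ ≤ ε * A ∧ ‖(Z x).2‖ ≤ ε * M) ∧
  ∀ x : E n × E n, x.2 ∈ D → ∃ γ : ℝ → E n × E n, γ 0 = x + Z x ∧
    (∀ t, 0 ≤ t → HasDerivAt γ (s • X (γ t).1 (γ t).2 (s * t)) t ∧ (γ t).2 ∈ ball (0 : E n) 1) ∧
    Tendsto (fun t => ‖(γ t).1 - (x.1 + (s * t) • ω x.2)‖ + ‖(γ t).2 - x.2‖) atTop (𝓝 0)

theorem curve_ex (n : ℕ) {Υ l c K : ℝ} (hΥ : 1 ≤ Υ) (hl : 1 < l) (hc : 1 ≤ c) (hK0 : 0 ≤ K) :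
    ∃ A > 0, ∃ ε₀ > 0, ∀ ε, 0 < ε → ε ≤ ε₀ → ∀ (k : ℕ) (h : E n → ℝ) (R : E n → E n → ℝ) (f H : E n → E n → ℝ → ℝ)
      (u v : E n → E n → ℝ → E n) (D : Set (E n)), Reg k Υ l (ε * c) h R f H u v → D ⊆ ball 0 1 →
      (∀ q : E n, ∀ p ∈ D, R q p = 0 ∧ fderiv ℝ (fun p' => R q p') p = 0) →
      (∀ p ∈ D, ∀ p' ∈ D, ‖gradient h p - gradient h p'‖ ≤ K * ‖p - p'‖) →
      (∀ p ∈ D, ‖p‖ + ε * (c + 1) < 1) →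
      ∀ s : ℝ, |s| = 1 → ∃ Z, Curve s ε A (c + 1) D (gradient h) (XH H) Z := by
  obtain ⟨C, hC⟩ : ∃ C : ℝ, C = c + c * (c + 1) + Υ * (c + 1) ^ 2 + 2 * Υ * (c + 1) + Υ := ⟨_, rfl⟩
  have k1 : 0 ≤ Υ * (c + 1) := by positivity
  have k2 : 0 ≤ Υ * (c + 1) ^ 2 := by positivity
  have k3 : 0 ≤ c * (c + 1) := by positivity
  have C1 : 1 ≤ C := by rw [hC]; nlinarith
  have hl1 : 0 < l - 1 := by linarith
  have hB : 0 < C * (8 * C / (l - 1) + 2) := by positivity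
  have hN : 0 < c * (c + 1) + Υ * (c + 1) ^ 2 := by positivity
  obtain ⟨A, hA, hh⟩ := half (X := E n) (K := K) hl C1 (by linarith : 0 < c + 1) hK0
  refine ⟨A, hA, min 1 (min (1 / 4 / (C * (8 * C / (l - 1) + 2))) (1 / (c * (c + 1) + Υ * (c + 1) ^ 2))),
    lt_min one_pos (lt_min (by positivity) (by positivity)), ?_⟩
  intro ε hε hε0 k h R f H u v D r hD h0 hK hr s hs
  have e1 : ε ≤ 1 := hε0.trans (min_le_left _ _)
  have e2 := hε0.trans ((min_le_right _ _).trans (min_le_left _ _))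
  have e3 := hε0.trans ((min_le_right _ _).trans (min_le_right _ _))
  rw [le_div_iff₀ hB] at e2
  rw [le_div_iff₀ hN] at e3
  have hf := r.hf (C := C) hs hΥ hl hc hε e1 hD h0 hK hr e3 (by rw [hC]; nlinarith) (by rw [hC]; nlinarith) (by rw [hC]; nlinarith)
  obtain ⟨ξ, η, hx⟩ := hh ε hε e2 D _ _ _ hf
  have ηb : ∀ p ∈ D, ∀ q t, 0 ≤ t → ‖η q p t‖ ≤ ε * (c + 1) := by
    intro p hp q t ht
    refine ((hx p hp q).1 t ht).trans ?_
    have := bw_le_one (m := l + 1) (by linarith) t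
    have h2 : 0 ≤ ε * (c + 1) := by positivity
    nlinarith
  refine ⟨fun x => (ξ x.1 x.2 0, η x.1 x.2 0), ?_, ?_, ?_⟩
  · rintro ⟨q, p⟩ ⟨q', p'⟩ hp hp'
    obtain ⟨-, -, -, -, -, -, hL⟩ := hx p hp q
    rw [Prod.norm_def, Prod.norm_def]
    exact max_le (hL p' hp' q').1 (hL p' hp' q').2
  · rintro ⟨q, p⟩ hp
    exact ⟨(hx p hp q).2.2.2.2.2.1, ηb p hp q 0 le_rfl⟩
  · rintro ⟨q, p⟩ hp
    obtain ⟨-, dξ, dη, tξ, tη, -, -⟩ := hx p hp q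
    refine ⟨fun t => (q + t • (s • gradient h p) + ξ q p t, p + η q p t), by simp, fun t ht => ⟨?_, ?_⟩, ?_⟩
    · have d1 := dξ t ht
      have d2 := (dη t ht).const_add p
      have d3 : HasDerivAt (fun t : ℝ => q + t • (s • gradient h p)) (s • gradient h p) t := by
        simpa using ((hasDerivAt_id t).smul_const (s • gradient h p)).const_add q
      have d4 := (d3.add d1).prodMk d2
      have ee : s • XH H (q + t • (s • gradient h p) + ξ q p t) (p + η q p t) (s * t) =
        (s • gradient h p + FF s h H (q + t • s • gradient h p + ξ q p t) p (η q p t) t, GG s H (q + t • s • gradient h p + ξ q p t) p (η q p t) t) := by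
        simp only [XH, FF, GG, Prod.smul_mk, smul_neg]
        rw [add_sub_cancel]
      simp only [ee]
      exact d4
    · rw [mem_ball_zero_iff]
      linarith [norm_add_le p (η q p t), hr p hp, ηb p hp q t ht]
    · have := tξ.norm.add tη.norm
      simp only [norm_zero, add_zero] at this
      refine this.congr fun t => ?_
      congr 2
      · simp only; rw [smul_smul, mul_comm t s]; abel
      · simp only; abel

theorem distT_le (x y : E n) : distT x y ≤ ‖x - y‖ := by
  have h0 : latt (0 : Fin n → ℤ) = 0 := by
    ext i; simp [latt]
  refine (ciInf_le ⟨0, ?_⟩ (0 : Fin n → ℤ)).trans (by rw [h0, sub_zero])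
  rintro _ ⟨k, rfl⟩; exact norm_nonneg _

theorem distT_nonneg (x y : E n) : 0 ≤ distT x y := Real.iInf_nonneg fun _ => norm_nonneg _

theorem glue {ε A M : ℝ} {D : Set (E n)} {ω : E n → E n} {X : E n → E n → ℝ → E n × E n} {Zp Zm : E n × E n → E n × E n}
    (hp : Curve 1 ε A M D ω X Zp) (hm : Curve (-1) ε A M D ω X Zm) {x a b : E n × E n} (ha : a.2 ∈ D) (hb : b.2 ∈ D)
    (xa : a + Zp a = x) (xb : b + Zm b = x) :
    ∃ g : ℝ → E n × E n,
                g 0 = x ∧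
                (∀ t : ℝ, (g t).2 ∈ ball (0 : E n) 1) ∧
                (∀ t : ℝ, HasDerivAt g (X (g t).1 (g t).2 t) t) ∧
                ∃ qp qm : E n,
                  Tendsto (fun t : ℝ =>
                      distT (g t).1 (qp + t • ω a.2) + ‖(g t).2 - a.2‖) atTop (𝓝 0) ∧
                  Tendsto (fun t : ℝ =>
                      distT (g t).1 (qm + t • ω b.2) + ‖(g t).2 - b.2‖) atBot (𝓝 0) := by
  obtain ⟨γ, γ0, γd, γt⟩ := hp.2.2 a ha
  obtain ⟨δ, δ0, δd, δt⟩ := hm.2.2 b hb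
  rw [xa] at γ0
  rw [xb] at δ0
  have gp : ∀ t, 0 ≤ t → (fun t : ℝ => if 0 ≤ t then γ t else δ (-t)) t = γ t := fun t ht => if_pos ht
  have gm : ∀ t, t ≤ 0 → (fun t : ℝ => if 0 ≤ t then γ t else δ (-t)) t = δ (-t) := by
    intro t ht
    rcases ht.lt_or_eq with h | h
    · exact if_neg (not_le.2 h)
    · subst h; simp [γ0, δ0]
  have dd : ∀ t, t ≤ 0 → HasDerivAt (fun t => δ (-t)) (X (δ (-t)).1 (δ (-t)).2 t) t := by
    intro t ht
    have := (δd (-t) (by linarith)).1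
    have := HasDerivAt.scomp t this (hasDerivAt_neg t)
    have h2 : (-1:ℝ) • ((-1:ℝ) • X (δ (-t)).1 (δ (-t)).2 (-1 * -t)) = X (δ (-t)).1 (δ (-t)).2 t := by simp
    rw [h2] at this
    exact this
  refine ⟨fun t => if 0 ≤ t then γ t else δ (-t), by simp [γ0], fun t => ?_, fun t => ?_, a.1, b.1, ?_, ?_⟩
  · rcases le_total 0 t with ht | ht
    · rw [gp t ht]; exact (γd t ht).2
    · rw [gm t ht]; exact (δd (-t) (by linarith)).2
  · rcases lt_trichotomy t 0 with ht | ht | ht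
    · rw [gm t ht.le]
      refine (dd t ht.le).congr_of_eventuallyEq ?_
      filter_upwards [gt_mem_nhds ht] with s hs using gm s hs.le
    · subst ht
      have h1 : HasDerivWithinAt (fun t : ℝ => if 0 ≤ t then γ t else δ (-t)) (X x.1 x.2 0) (Ici 0) 0 := by
        have := (γd 0 le_rfl).1
        rw [γ0, one_smul, mul_zero] at this
        exact this.hasDerivWithinAt.congr (fun s hs => gp s hs) (gp 0 le_rfl)
      have h2 : HasDerivWithinAt (fun t : ℝ => if 0 ≤ t then γ t else δ (-t)) (X x.1 x.2 0) (Iic 0) 0 := by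
        have := dd 0 le_rfl
        rw [neg_zero, δ0] at this
        exact this.hasDerivWithinAt.congr (fun s hs => gm s hs) (gm 0 le_rfl)
      rw [gp 0 le_rfl, γ0]
      have := h1.union h2
      rw [Ici_union_Iic] at this
      exact hasDerivWithinAt_univ.1 this
    · rw [gp t ht.le]
      have := (γd t ht.le).1
      rw [one_smul, one_mul] at this
      refine this.congr_of_eventuallyEq ?_
      filter_upwards [lt_mem_nhds ht] with s hs using gp s hs.le
  · refine squeeze_zero' (Eventually.of_forall fun t => add_nonneg (distT_nonneg _ _) (norm_nonneg _)) ?_ γt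
    filter_upwards [eventually_ge_atTop 0] with t ht
    simp only [if_pos ht]
    rw [one_mul]
    exact add_le_add (distT_le _ _) le_rfl
  · refine squeeze_zero' (Eventually.of_forall fun t => add_nonneg (distT_nonneg _ _) (norm_nonneg _)) ?_ (δt.comp tendsto_neg_atBot_atTop)
    filter_upwards [eventually_le_atBot 0] with t ht
    have e := gm t ht
    simp only at e
    rw [e]
    simp only [Function.comp, neg_mul, one_mul, neg_neg]
    exact add_le_add (distT_le _ _) le_rfl

end CurveSec


section MeasSec
set_option maxSynthPendingDepth 3
set_option linter.unusedVariables false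
set_option linter.deprecated false

/-- closed box -/
def QQ (n : ℕ) (δ : ℝ) : Set (E n) := {x | ∀ i, δ ≤ x i ∧ x i ≤ 1 - δ}

theorem vol_fund (n : ℕ) : volume (fund n) = 1 := by
  have h := (PiLp.volume_preserving_ofLp (Fin n)).measure_preimage
    (s := Set.univ.pi fun _ : Fin n => Set.Ico (0:ℝ) 1) (MeasurableSet.univ_pi fun _ => measurableSet_Ico).nullMeasurableSet
  rw [Real.volume_pi_Ico] at h
  simp at h
  rw [← h]
  congr 1
  ext x
  simp [fund]

theorem vol_QQ (n : ℕ) {δ : ℝ} (hδ : 2 * δ ≤ 1) : volume (QQ n δ) = ENNReal.ofReal ((1 - 2 * δ) ^ n) := by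
  have h := (PiLp.volume_preserving_ofLp (Fin n)).measure_preimage
    (s := Set.Icc (fun _ : Fin n => δ) (fun _ => 1 - δ)) measurableSet_Icc.nullMeasurableSet
  rw [Real.volume_Icc_pi] at h
  simp only [Finset.prod_const, Finset.card_univ, Fintype.card_fin] at h
  rw [ENNReal.ofReal_pow (by linarith), show 1 - 2 * δ = 1 - δ - δ by ring, ← h]
  congr 1
  ext x
  simp only [QQ, mem_setOf_eq, mem_preimage, mem_Icc, Pi.le_def]
  exact forall_and

theorem compact_QQ (n : ℕ) (δ : ℝ) : IsCompact (QQ n δ) := by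
  have h := (isCompact_Icc (a := fun _ : Fin n => δ) (b := fun _ => 1 - δ)).image (EuclideanSpace.equiv (Fin n) ℝ).symm.continuous
  convert h
  ext x
  simp only [QQ, mem_setOf_eq, mem_image, mem_Icc, Pi.le_def]
  constructor
  · intro hx
    exact ⟨EuclideanSpace.equiv (Fin n) ℝ x, ⟨fun i => (hx i).1, fun i => (hx i).2⟩, by simp⟩
  · rintro ⟨y, hy, rfl⟩ i
    exact ⟨hy.1 i, hy.2 i⟩

theorem choice_r (n : ℕ) (V μ : ℝ) (hμ : 0 < μ) : ∃ r : ℝ, 0 < r ∧ r < 1/4 ∧ V * (1 - (1 - r) ^ n) < μ / 4 ∧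
    (1 - (1 - r) * (1 - 2 * r) ^ n) * V < μ / 4 := by
  have h1 : Tendsto (fun r : ℝ => V * (1 - (1 - r) ^ n)) (𝓝 0) (𝓝 0) := by
    have : Continuous (fun r : ℝ => V * (1 - (1 - r) ^ n)) := by fun_prop
    simpa using this.tendsto 0
  have h2 : Tendsto (fun r : ℝ => (1 - (1 - r) * (1 - 2 * r) ^ n) * V) (𝓝 0) (𝓝 0) := by
    have : Continuous (fun r : ℝ => (1 - (1 - r) * (1 - 2 * r) ^ n) * V) := by fun_prop
    simpa using this.tendsto 0
  have h3 := (h1.eventually (gt_mem_nhds (show 0 < μ / 4 by linarith))).and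
    ((h2.eventually (gt_mem_nhds (show 0 < μ / 4 by linarith))).and (gt_mem_nhds (show (0:ℝ) < 1/4 by norm_num)))
  obtain ⟨r, hr, hr0⟩ := ((h3.filter_mono nhdsWithin_le_nhds).and (self_mem_nhdsWithin (s := Ioi (0:ℝ)))).exists
  exact ⟨r, hr0, hr.2.2, hr.1, hr.2.1⟩

theorem compact_D {μ r : ℝ} (hμ : 0 < μ) (hr0 : 0 < r) (hr1 : r < 1/4)
    (hr : (volume (ball (0 : E n) 1)).toReal * (1 - (1 - r) ^ n) < μ / 4) {D : Set (E n)} (hD : D ⊆ ball 0 1)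
    (hv : volume (ball (0 : E n) 1 \ D) < ENNReal.ofReal μ) :
    ∃ C ⊆ D, IsCompact C ∧ (∀ p ∈ C, ‖p‖ ≤ 1 - r) ∧ volume (ball (0 : E n) 1 \ C) ≤ ENNReal.ofReal (3 / 2 * μ) := by
  set T := toMeasurable volume (ball (0 : E n) 1 \ D)
  have hT : volume T < ENNReal.ofReal μ := by rw [measure_toMeasurable]; exact hv
  set D2 := (ball (0 : E n) 1 \ T) ∩ closedBall 0 (1 - r)
  have mD2 : MeasurableSet D2 := (measurableSet_ball.diff (measurableSet_toMeasurable _ _)).inter measurableSet_closedBall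
  have fB : volume (ball (0 : E n) 1) ≠ ⊤ := measure_ball_lt_top.ne
  have fD2 : volume D2 ≠ ⊤ := ((measure_mono (inter_subset_left.trans diff_subset)).trans_lt measure_ball_lt_top).ne
  obtain ⟨C, hC, cC, vC⟩ := mD2.exists_isCompact_sdiff_lt (μ := volume) fD2 (ε := ENNReal.ofReal (μ / 4)) (by simpa using hμ)
  refine ⟨C, fun p hp => ?_, cC, fun p hp => by simpa using (hC hp).2, ?_⟩
  · by_contra h
    exact (hC hp).1.2 (subset_toMeasurable _ _ ⟨(hC hp).1.1, h⟩)
  · have v3 : volume (ball (0 : E n) 1 \ closedBall 0 (1 - r)) ≤ ENNReal.ofReal (μ / 4) := by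
      rw [measure_sdiff_le_iff_le_add measurableSet_closedBall.nullMeasurableSet
        (closedBall_subset_ball (by linarith)) (isCompact_closedBall _ _).measure_lt_top.ne,
        Measure.addHaar_closedBall _ _ (by linarith), finrank_euclideanSpace, Fintype.card_fin,
        ← ENNReal.ofReal_toReal fB, ← ENNReal.ofReal_mul (pow_nonneg (by linarith) _),
        ← ENNReal.ofReal_add (mul_nonneg (pow_nonneg (by linarith) _) ENNReal.toReal_nonneg) (by linarith)]
      apply ENNReal.ofReal_le_ofReal
      nlinarith
    have hsub : ball (0 : E n) 1 \ C ⊆ T ∪ (ball (0 : E n) 1 \ closedBall 0 (1 - r)) ∪ (D2 \ C) := by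
      intro p hp
      by_cases h1 : p ∈ T
      · exact .inl (.inl h1)
      · by_cases h2 : p ∈ closedBall (0 : E n) (1 - r)
        · exact .inr ⟨⟨⟨hp.1, h1⟩, h2⟩, hp.2⟩
        · exact .inl (.inr ⟨hp.1, h2⟩)
    calc _ ≤ _ := measure_mono hsub
      _ ≤ volume T + volume (ball (0 : E n) 1 \ closedBall 0 (1 - r)) + volume (D2 \ C) :=
        (measure_union_le _ _).trans (add_le_add (measure_union_le _ _) le_rfl)
      _ ≤ ENNReal.ofReal μ + ENNReal.ofReal (μ / 4) + ENNReal.ofReal (μ / 4) := add_le_add (add_le_add hT.le v3) vC.le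
      _ = _ := by
        rw [← ENNReal.ofReal_add hμ.le (by linarith), ← ENNReal.ofReal_add (by linarith) (by linarith)]
        congr 1; ring

theorem meas_main (n : ℕ) {μ : ℝ} (hμ : 0 < μ) : ∃ r > 0, r < 1/4 ∧ ∃ η > 0, ∀ D : Set (E n), D ⊆ ball 0 1 →
    volume (ball (0 : E n) 1 \ D) < ENNReal.ofReal μ → ∃ C ⊆ D, (∀ p ∈ C, ‖p‖ ≤ 1 - r) ∧
    ∀ Z : E n × E n → E n × E n, (∀ x y, x.2 ∈ C → y.2 ∈ C → ‖Z x - Z y‖ ≤ η * ‖x - y‖) →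
      (∀ x, x.2 ∈ C → ‖(Z x).1‖ ≤ η ∧ ‖(Z x).2‖ ≤ r / 2) →
      ∃ W : Set (E n × E n), (∀ x ∈ W, x.2 ∈ ball (0 : E n) 1 ∧ ∃ a : E n × E n, a.2 ∈ C ∧ a + Z a = x) ∧
        volume ((fund n ×ˢ ball (0 : E n) 1) \ W) ≤ ENNReal.ofReal (2 * μ) := by
  obtain ⟨r, r0, r1, hr, hd⟩ := choice_r n (volume (ball (0 : E n) 1)).toReal μ hμ
  refine ⟨r, r0, r1, ?_⟩
  have ih : (volume : Measure (E n × E n)).IsAddHaarMeasure :=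
    (inferInstance : ((volume : Measure (E n)).prod (volume : Measure (E n))).IsAddHaarMeasure)
  have ev := mul_le_addHaar_image_of_lt_det (volume : Measure (E n × E n)) (ContinuousLinearMap.id ℝ (E n × E n))
    (m := (1 - r).toNNReal) (by
      have : (ContinuousLinearMap.id ℝ (E n × E n)).det = 1 := by simp [ContinuousLinearMap.det]
      rw [this, abs_one]
      change ENNReal.ofReal (1 - r) < _
      rw [ENNReal.ofReal_lt_ofReal_iff one_pos]; linarith)
  obtain ⟨η, ⟨hη, hηr⟩, hη0⟩ := ((ev.and ((gt_mem_nhds (show (0:ℝ≥0) < r.toNNReal by simpa using r0)).filter_mono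
    nhdsWithin_le_nhds)).and (self_mem_nhdsWithin (s := Ioi (0:ℝ≥0)))).exists
  have hηr' : (η : ℝ) < r := by rwa [Real.lt_toNNReal_iff_coe_lt] at hηr
  refine ⟨η, hη0, fun D hD hv => ?_⟩
  obtain ⟨C, CD, cC, Cr, Cv⟩ := compact_D hμ r0 r1 hr hD hv
  refine ⟨C, CD, Cr, fun Z Zl Zb => ?_⟩
  have fB : volume (ball (0 : E n) 1) ≠ ⊤ := measure_ball_lt_top.ne
  have hCB : C ⊆ ball (0 : E n) 1 := CD.trans hD
  have mem : ∀ a ∈ QQ n r ×ˢ C, a + Z a ∈ fund n ×ˢ ball (0 : E n) 1 := by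
    rintro a ⟨h1, h2⟩
    have hb := Zb a h2
    refine ⟨fun i => ?_, ?_⟩
    · have h3 := (PiLp.norm_apply_le (Z a).1 i).trans hb.1
      rw [Real.norm_eq_abs, abs_le] at h3
      have h4 := h1 i
      have h5 : (a + Z a).1 i = a.1 i + (Z a).1 i := rfl
      rw [h5]
      constructor <;> linarith [h4.1, h4.2, h3.1, h3.2]
    · have h5 : (a + Z a).2 = a.2 + (Z a).2 := rfl
      rw [mem_ball_zero_iff, h5]
      linarith [norm_add_le a.2 (Z a).2, Cr a.2 h2]
  have cZ : ContinuousOn (fun a => a + Z a) (QQ n r ×ˢ C) := by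
    refine continuousOn_id.add (LipschitzOnWith.continuousOn (K := η) ?_)
    refine LipschitzOnWith.of_dist_le_mul fun x hx y hy => ?_
    rw [dist_eq_norm, dist_eq_norm]; exact Zl x y hx.2 hy.2
  have cW : IsCompact ((fun a => a + Z a) '' (QQ n r ×ˢ C)) := ((compact_QQ n r).prod cC).image_of_continuousOn cZ
  refine ⟨(fun a => a + Z a) '' (QQ n r ×ˢ C), ?_, ?_⟩
  · rintro _ ⟨a, ha, rfl⟩
    exact ⟨(mem a ha).2, a, ha.2, rfl⟩
  · have hle := hη (QQ n r ×ˢ C) (fun a => a + Z a) (by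
      intro x hx y hy
      have : x + Z x - (y + Z y) - (ContinuousLinearMap.id ℝ (E n × E n)) (x - y) = Z x - Z y := by
        simp only [ContinuousLinearMap.id_apply]; abel
      rw [this]; exact Zl x y hx.2 hy.2)
    have pv : ∀ (s t : Set (E n)), volume (s ×ˢ t) = volume s * volume t := fun s t => Measure.prod_prod s t
    rw [measure_sdiff_le_iff_le_add cW.isClosed.measurableSet.nullMeasurableSet
      (by rintro _ ⟨a, ha, rfl⟩; exact mem a ha) cW.measure_lt_top.ne, pv, vol_fund, one_mul]
    refine le_trans ?_ (add_le_add hle le_rfl)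
    rw [pv, vol_QQ n (by linarith)]
    change _ ≤ ENNReal.ofReal (1 - r) * _ + _
    rw [measure_sdiff_le_iff_le_add cC.isClosed.measurableSet.nullMeasurableSet hCB cC.measure_lt_top.ne] at Cv
    have fC : volume C ≠ ⊤ := cC.measure_lt_top.ne
    have hCm : (volume C).toReal ≤ (volume (ball (0 : E n) 1)).toReal := ENNReal.toReal_mono fB (measure_mono hCB)
    rw [← ENNReal.ofReal_toReal fB, ← ENNReal.ofReal_toReal fC] at Cv ⊢
    have p1 : 0 ≤ (1 - 2 * r) ^ n := pow_nonneg (by linarith) _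
    have p1' : (1 - 2 * r) ^ n ≤ 1 := pow_le_one₀ (by linarith) (by linarith)
    have p2 : 0 ≤ (volume C).toReal := ENNReal.toReal_nonneg
    rw [← ENNReal.ofReal_add p2 (by linarith), ENNReal.ofReal_le_ofReal_iff (by linarith)] at Cv
    have p3 : 0 ≤ (1 - r) * ((1 - 2 * r) ^ n * (volume C).toReal) := mul_nonneg (by linarith) (mul_nonneg p1 p2)
    rw [← ENNReal.ofReal_mul p1, ← ENNReal.ofReal_mul (by linarith), ← ENNReal.ofReal_add p3 (by linarith)]
    apply ENNReal.ofReal_le_ofReal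
    generalize (volume C).toReal = c at *
    generalize (volume (ball (0 : E n) 1)).toReal = V at *
    generalize (1 - 2 * r) ^ n = w at *
    have : (1 - (1 - r) * w) * c ≤ (1 - (1 - r) * w) * V := mul_le_mul_of_nonneg_left hCm (by nlinarith)
    nlinarith

end MeasSec


section AnaSec
set_option maxSynthPendingDepth 3
set_option linter.unusedVariables false
set_option linter.deprecated false

variable {X Y : Type*} [NormedAddCommGroup X] [NormedSpace ℝ X] [NormedAddCommGroup Y] [NormedSpace ℝ Y]

theorem iter_hasFDerivAt {Ω : Set X} (ho : IsOpen Ω) {g : X → Y} {N m : ℕ} (hg : ContDiffOn ℝ N g Ω) (hm : m < N) {x : X} (hx : x ∈ Ω) :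
    HasFDerivAt (iteratedFDerivWithin ℝ m g Ω) (iteratedFDerivWithin ℝ (m + 1) g Ω x).curryLeft x := by
  have := (hg.ftaylorSeriesWithin ho.uniqueDiffOn).fderivWithin m (by exact_mod_cast hm) x hx
  exact this.hasFDerivAt (ho.mem_nhds hx)

/-- interpolation inequality -/
theorem interp0 {Ω : Set X} (ho : IsOpen Ω) (hc : Convex ℝ Ω) {r : ℝ} (hr : 0 < r)
    (hin : ∀ x ∈ Ω, ∃ x' ∈ Ω, ‖x - x'‖ ≤ r ∧ closedBall x' r ⊆ Ω) {g : X → Y} {g' : X → X →L[ℝ] Y}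
    (hg : ∀ x ∈ Ω, HasFDerivAt g (g' x) x) {δ M : ℝ} (hδ : 0 ≤ δ) (hM : 0 ≤ M) (hb : ∀ x ∈ Ω, ‖g x‖ ≤ δ)
    (hl : ∀ x ∈ Ω, ∀ y ∈ Ω, ‖g' x - g' y‖ ≤ M * ‖x - y‖) {x : X} (hx : x ∈ Ω) : ‖g' x‖ ≤ 2 * δ / r + 2 * M * r := by
  obtain ⟨y, hy, hxy, hB⟩ := hin x hx
  have h1 : ‖g' x - g' y‖ ≤ M * r := (hl x hx y hy).trans (by gcongr)
  have h2 : ‖g' y‖ ≤ 2 * δ / r + M * r := by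
    refine ContinuousLinearMap.opNorm_le_bound _ (by positivity) fun e => ?_
    by_cases he : e = 0
    · simp [he]
    have hn : 0 < ‖e‖ := norm_pos_iff.2 he
    set w : X := (r / ‖e‖) • e
    have hw : ‖w‖ = r := by rw [norm_smul, Real.norm_of_nonneg (by positivity)]; field_simp
    have hz : y + w ∈ closedBall y r := by rw [mem_closedBall, dist_eq_norm, add_sub_cancel_left, hw]
    have hyB : y ∈ closedBall y r := mem_closedBall_self hr.le
    have h3 := (convex_closedBall y r).norm_image_sub_le_of_norm_hasFDerivWithin_le' (f := g) (f' := g') (φ := g' y) (C := M * r)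
      (fun z hz => (hg z (hB hz)).hasFDerivWithinAt)
      (fun z hz => (hl z (hB hz) y hy).trans (by
        gcongr; rwa [mem_closedBall, dist_eq_norm] at hz)) hyB hz
    rw [add_sub_cancel_left, hw] at h3
    have h4 : ‖g' y w‖ ≤ 2 * δ + M * r * r := by
      have : g' y w = g (y + w) - g y - (g (y + w) - g y - g' y w) := by abel
      rw [this]
      refine (norm_sub_le _ _).trans (add_le_add ((norm_sub_le _ _).trans ?_) h3)
      linarith [hb _ (hB hz), hb y hy]
    rw [map_smul, norm_smul, Real.norm_of_nonneg (by positivity)] at h4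
    have h5 : ‖g' y e‖ = (‖e‖ / r) * (r / ‖e‖ * ‖g' y e‖) := by field_simp
    rw [h5]
    calc _ ≤ ‖e‖ / r * (2 * δ + M * r * r) := by gcongr
      _ = _ := by field_simp
  have : g' x = g' y + (g' x - g' y) := by abel
  rw [this]
  refine (norm_add_le _ _).trans ?_
  linarith

theorem interp1 {Ω : Set X} (ho : IsOpen Ω) (hc : Convex ℝ Ω)
    (hin : ∀ r : ℝ, 0 < r → r < 1 → ∀ x ∈ Ω, ∃ x' ∈ Ω, ‖x - x'‖ ≤ r ∧ closedBall x' r ⊆ Ω) (M : ℝ) (hM : 0 ≤ M) (N : ℕ) :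
    ∀ i ≤ N, ∀ η > 0, ∃ δ > 0, ∀ g : X → Y, ContDiffOn ℝ ((N + 1 : ℕ)) g Ω →
      (∀ i ≤ N + 1, ∀ x ∈ Ω, ‖iteratedFDerivWithin ℝ i g Ω x‖ ≤ M) → (∀ x ∈ Ω, ‖g x‖ ≤ δ) →
      ∀ x ∈ Ω, ‖iteratedFDerivWithin ℝ i g Ω x‖ ≤ η := by
  intro i
  induction i with
  | zero =>
    intro _ η hη
    exact ⟨η, hη, fun g _ _ hb x hx => by rw [norm_iteratedFDerivWithin_zero]; exact hb x hx⟩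
  | succ i ih =>
    intro hi η hη
    obtain ⟨r, hr, hr1, hr2⟩ : ∃ r : ℝ, 0 < r ∧ r < 1 ∧ 2 * M * r ≤ η / 2 := by
      refine ⟨min (1/2) (η / (4 * M + 1)), by positivity, (min_le_left _ _).trans_lt (by norm_num), ?_⟩
      calc 2 * M * min (1/2) (η / (4 * M + 1)) ≤ 2 * M * (η / (4 * M + 1)) := by gcongr; exact min_le_right _ _
        _ ≤ _ := by
          rw [← mul_div_assoc, div_le_div_iff₀ (by positivity) (by norm_num)]
          nlinarith
    obtain ⟨δ, hδ, H⟩ := ih (by omega) (η * r / 4) (by positivity)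
    refine ⟨δ, hδ, fun g hg hM' hb x hx => ?_⟩
    have := interp0 ho hc hr (hin r hr hr1) (g := iteratedFDerivWithin ℝ i g Ω)
      (g' := fun x => (iteratedFDerivWithin ℝ (i + 1) g Ω x).curryLeft) (δ := η * r / 4) (M := M)
      (fun x hx => iter_hasFDerivAt ho hg (by omega) hx) (by positivity) hM (H g hg hM' hb)
      (fun y hy z hz => ?_) hx
    · rw [ContinuousMultilinearMap.curryLeft_norm] at this
      refine this.trans ?_
      have : 2 * (η * r / 4) / r = η / 2 := by field_simp; norm_num
      linarith
    · have h1 := hc.norm_image_sub_le_of_norm_hasFDerivWithin_le (f := iteratedFDerivWithin ℝ (i + 1) g Ω) (C := M)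
        (fun x hx => (iter_hasFDerivAt ho hg (by omega) hx).hasFDerivWithinAt)
        (fun x hx => by rw [ContinuousMultilinearMap.curryLeft_norm]; exact hM' _ (by omega) x hx) hz hy
      have h2 : (iteratedFDerivWithin ℝ (i + 1) g Ω y).curryLeft - (iteratedFDerivWithin ℝ (i + 1) g Ω z).curryLeft =
        (iteratedFDerivWithin ℝ (i + 1) g Ω y - iteratedFDerivWithin ℝ (i + 1) g Ω z).curryLeft := by
        ext; simp
      rw [h2, ContinuousMultilinearMap.curryLeft_norm]
      exact h1

theorem interp {Ω : Set X} (ho : IsOpen Ω) (hc : Convex ℝ Ω)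
    (hin : ∀ r : ℝ, 0 < r → r < 1 → ∀ x ∈ Ω, ∃ x' ∈ Ω, ‖x - x'‖ ≤ r ∧ closedBall x' r ⊆ Ω) (M : ℝ) (hM : 0 ≤ M) (N : ℕ) :
    ∀ η > 0, ∃ δ > 0, ∀ g : X → Y, ContDiffOn ℝ ((N + 1 : ℕ)) g Ω →
      (∀ i ≤ N + 1, ∀ x ∈ Ω, ‖iteratedFDerivWithin ℝ i g Ω x‖ ≤ M) → (∀ x ∈ Ω, ‖g x‖ ≤ δ) →
      ∀ i ≤ N, ∀ x ∈ Ω, ‖iteratedFDerivWithin ℝ i g Ω x‖ ≤ η := by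
  intro η hη
  have := interp1 (Y := Y) ho hc hin M hM N
  choose! δ hδ H using fun i (hi : i ≤ N) => this i hi η hη
  refine ⟨Finset.inf' (Finset.range (N + 1)) (by simp) δ, ?_, fun g hg hM' hb i hi => ?_⟩
  · rw [gt_iff_lt, Finset.lt_inf'_iff]
    intro i hi; exact hδ i (by simpa [Nat.lt_succ_iff] using hi)
  · exact H i hi g hg hM' fun x hx => (hb x hx).trans (Finset.inf'_le _ (by simpa [Nat.lt_succ_iff] using hi))

/-- limits of `C^k` functions -/
theorem limit_iter [CompleteSpace Y] {Ω : Set X} (ho : IsOpen Ω) {k : ℕ} {g : ℕ → X → Y} {g₀ : X → Y}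
    (hg : ∀ j, ContDiffOn ℝ k (g j) Ω)
    (hC : ∀ η > 0, ∃ J, ∀ i ≥ J, ∀ j ≥ J, ∀ m ≤ k, ∀ x ∈ Ω,
      ‖iteratedFDerivWithin ℝ m (g i) Ω x - iteratedFDerivWithin ℝ m (g j) Ω x‖ ≤ η)
    (h0 : ∀ x ∈ Ω, Tendsto (fun j => g j x) atTop (𝓝 (g₀ x))) :
    ∀ m ≤ k, ∀ x ∈ Ω, Tendsto (fun j => iteratedFDerivWithin ℝ m (g j) Ω x) atTop (𝓝 (iteratedFDerivWithin ℝ m g₀ Ω x)) := by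
  have hca : ∀ m ≤ k, ∀ x ∈ Ω, CauchySeq (fun j => iteratedFDerivWithin ℝ m (g j) Ω x) := by
    intro m hm x hx
    rw [Metric.cauchySeq_iff]
    intro ε hε
    obtain ⟨J, hJ⟩ := hC (ε / 2) (by positivity)
    refine ⟨J, fun i hi j hj => ?_⟩
    rw [dist_eq_norm]
    exact (hJ i hi j hj m hm x hx).trans_lt (by linarith)
  choose! P hP using fun m (hm : m ≤ k) x (hx : x ∈ Ω) => cauchySeq_tendsto_of_complete (hca m hm x hx)
  have hU : ∀ m ≤ k, TendstoUniformlyOn (fun j => iteratedFDerivWithin ℝ m (g j) Ω) (P m) atTop Ω := by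
    intro m hm
    rw [Metric.tendstoUniformlyOn_iff]
    intro ε hε
    obtain ⟨J, hJ⟩ := hC (ε / 2) (by positivity)
    filter_upwards [eventually_ge_atTop J] with j hj x hx
    rw [dist_eq_norm]
    have := le_of_tendsto (((hP m hm x hx).sub_const (iteratedFDerivWithin ℝ m (g j) Ω x)).norm)
      ((eventually_ge_atTop J).mono fun i hi => hJ i hi j hj m hm x hx)
    linarith
  have hT : HasFTaylorSeriesUpToOn k g₀ (fun x m => P m x) Ω := by
    refine ⟨fun x hx => ?_, fun m hm x hx => ?_, fun m hm => ?_⟩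
    · have h1 := ((continuousMultilinearCurryFin0 ℝ X Y).continuous.tendsto _).comp (hP 0 (Nat.zero_le _) x hx)
      refine tendsto_nhds_unique ?_ (h0 x hx)
      refine h1.congr fun j => ?_
      simp [iteratedFDerivWithin_zero_eq_comp]
    · have hm' : m < k := by exact_mod_cast hm
      refine (hasFDerivAt_of_tendstoUniformlyOn ho (f := fun j => iteratedFDerivWithin ℝ m (g j) Ω)
        (f' := fun j x => (iteratedFDerivWithin ℝ (m + 1) (g j) Ω x).curryLeft) (g' := fun x => (P (m + 1) x).curryLeft) (l := atTop) ?_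
        (fun j x hx => iter_hasFDerivAt ho (hg j) hm' hx) (fun x hx => hP m hm'.le x hx) hx).hasFDerivWithinAt
      have := (continuousMultilinearCurryLeftEquiv ℝ (fun _ : Fin (m + 1) => X) Y).isometry.uniformContinuous.comp_tendstoUniformlyOn (hU (m + 1) hm')
      exact this
    · have hm' : m ≤ k := by exact_mod_cast hm
      refine (hU m hm').continuousOn (Eventually.frequently (Eventually.of_forall fun j => ?_))
      exact (hg j).continuousOn_iteratedFDerivWithin (by exact_mod_cast hm') ho.uniqueDiffOn
  intro m hm x hx
  rw [← hT.eq_iteratedFDerivWithin_of_uniqueDiffOn (by exact_mod_cast hm) ho.uniqueDiffOn hx]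
  exact hP m hm x hx

/-- integrals of `C^N` functions -/
theorem integral_iter [CompleteSpace Y] {Ω : Set X} (ho : IsOpen Ω) {N : ℕ} {G : ℝ → X → Y}
    (hg : ∀ τ ∈ Icc (0:ℝ) 1, ContDiffOn ℝ N (G τ) Ω)
    {B : ℝ} (hB : ∀ m ≤ N, ∀ τ ∈ Icc (0:ℝ) 1, ∀ x ∈ Ω, ‖iteratedFDerivWithin ℝ m (G τ) Ω x‖ ≤ B)
    (hc : ∀ m ≤ N, ∀ x ∈ Ω, ContinuousOn (fun τ => iteratedFDerivWithin ℝ m (G τ) Ω x) (Icc 0 1)) :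
    ContDiffOn ℝ N (fun x => ∫ τ in (0:ℝ)..1, G τ x) Ω ∧ ∀ m ≤ N, ∀ x ∈ Ω,
      iteratedFDerivWithin ℝ m (fun x => ∫ τ in (0:ℝ)..1, G τ x) Ω x = ∫ τ in (0:ℝ)..1, iteratedFDerivWithin ℝ m (G τ) Ω x := by
  have hI : uIoc (0:ℝ) 1 ⊆ Icc 0 1 := by rw [uIoc_of_le zero_le_one]; exact Ioc_subset_Icc_self
  have int : ∀ m ≤ N, ∀ x ∈ Ω, IntervalIntegrable (fun τ => iteratedFDerivWithin ℝ m (G τ) Ω x) volume 0 1 := fun m hm x hx =>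
    ContinuousOn.intervalIntegrable (by rw [uIcc_of_le zero_le_one]; exact hc m hm x hx)
  have meas : ∀ m ≤ N, ∀ x ∈ Ω, AEStronglyMeasurable (fun τ => iteratedFDerivWithin ℝ m (G τ) Ω x) (volume.restrict (uIoc (0:ℝ) 1)) :=
    fun m hm x hx => (int m hm x hx).def'.aestronglyMeasurable
  have hT : HasFTaylorSeriesUpToOn N (fun x => ∫ τ in (0:ℝ)..1, G τ x)
      (fun x m => ∫ τ in (0:ℝ)..1, iteratedFDerivWithin ℝ m (G τ) Ω x) Ω := by
    refine ⟨fun x hx => ?_, fun m hm x hx => ?_, fun m hm => ?_⟩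
    · have h1 := ((continuousMultilinearCurryFin0 ℝ X Y).toContinuousLinearEquiv.toContinuousLinearMap).intervalIntegral_comp_comm (int 0 (Nat.zero_le _) x hx)
      refine Eq.trans ?_ (h1.symm.trans ?_)
      · rfl
      · rfl
    · have hm' : m < N := by exact_mod_cast hm
      have h1 := ((continuousMultilinearCurryLeftEquiv ℝ (fun _ : Fin (m + 1) => X) Y).toContinuousLinearEquiv.toContinuousLinearMap).intervalIntegral_comp_comm
        (int (m + 1) hm' x hx)
      have h2 := intervalIntegral.hasFDerivAt_integral_of_dominated_of_fderiv_le (𝕜 := ℝ) (μ := volume) (a := 0) (b := 1)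
        (F := fun x τ => iteratedFDerivWithin ℝ m (G τ) Ω x)
        (F' := fun x τ => (iteratedFDerivWithin ℝ (m + 1) (G τ) Ω x).curryLeft) (bound := fun _ => B) (ho.mem_nhds hx)
        ((show ∀ᶠ y in 𝓝 x, y ∈ Ω from ho.mem_nhds hx).mono fun y hy => meas m hm'.le y hy) (int m hm'.le x hx)
        ((continuousMultilinearCurryLeftEquiv ℝ (fun _ : Fin (m + 1) => X) Y).continuous.comp_aestronglyMeasurable (meas (m + 1) hm' x hx))
        (Eventually.of_forall fun τ hτ y hy => by
          rw [ContinuousMultilinearMap.curryLeft_norm]; exact hB _ hm' τ (hI hτ) y hy)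
        intervalIntegrable_const
        (Eventually.of_forall fun τ hτ y hy => iter_hasFDerivAt ho (hg τ (hI hτ)) hm' hy)
      refine HasFDerivAt.hasFDerivWithinAt ?_
      refine h2.congr_fderiv ?_
      exact h1
    · have hm' : m ≤ N := by exact_mod_cast hm
      intro x hx
      refine ContinuousAt.continuousWithinAt ?_
      refine intervalIntegral.continuousAt_of_dominated_interval (bound := fun _ => B)
        ((show ∀ᶠ y in 𝓝 x, y ∈ Ω from ho.mem_nhds hx).mono fun y hy => meas m hm' y hy)
        ((show ∀ᶠ y in 𝓝 x, y ∈ Ω from ho.mem_nhds hx).mono fun y hy => Eventually.of_forall fun τ hτ => hB m hm' τ (hI hτ) y hy)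
        intervalIntegrable_const (Eventually.of_forall fun τ hτ => ?_)
      exact ((hg τ (hI hτ)).continuousOn_iteratedFDerivWithin (by exact_mod_cast hm') ho.uniqueDiffOn).continuousAt (ho.mem_nhds hx)
  exact ⟨hT.contDiffOn, fun m hm x hx => (hT.eq_iteratedFDerivWithin_of_uniqueDiffOn (by exact_mod_cast hm) ho.uniqueDiffOn hx).symm⟩

end AnaSec


section PrimSec
set_option maxSynthPendingDepth 3
set_option linter.unusedVariables false
set_option linter.deprecated false

variable {Y : Type*} [NormedAddCommGroup Y] [NormedSpace ℝ Y]

/-- the domain -/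
abbrev Om (n : ℕ) : Set (E n × E n) := (univ : Set (E n)) ×ˢ ball (0 : E n) 1

theorem Om_in (r : ℝ) (h0 : 0 < r) (h1 : r < 1) (x : E n × E n) (hx : x ∈ Om n) :
    ∃ x' ∈ Om n, ‖x - x'‖ ≤ r ∧ closedBall x' r ⊆ Om n := by
  have hp : ‖x.2‖ < 1 := by simpa using hx.2
  have hn : ‖(1 - r) • x.2‖ = (1 - r) * ‖x.2‖ := by rw [norm_smul, Real.norm_of_nonneg (by linarith)]
  have hn0 := norm_nonneg x.2
  refine ⟨(x.1, (1 - r) • x.2), ⟨mem_univ _, ?_⟩, ?_, ?_⟩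
  · rw [mem_ball_zero_iff]; simp only; rw [hn]; nlinarith
  · have : x - (x.1, (1 - r) • x.2) = (0, r • x.2) := by
      ext1
      · simp
      · simp only [Prod.snd_sub]; module
    rw [this, Prod.norm_mk, norm_zero, norm_smul, Real.norm_of_nonneg h0.le]
    refine max_le h0.le ?_
    nlinarith
  · intro y hy
    refine ⟨mem_univ _, ?_⟩
    rw [mem_closedBall, dist_eq_norm] at hy
    have h2 : ‖y.2 - (1 - r) • x.2‖ ≤ r := (norm_snd_le (y - (x.1, (1 - r) • x.2))).trans hy
    rw [mem_ball_zero_iff]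
    have := norm_add_le (y.2 - (1 - r) • x.2) ((1 - r) • x.2)
    rw [sub_add_cancel, hn] at this
    nlinarith

/-- partial dilation -/
def LL (n : ℕ) (τ : ℝ) : E n × E n →L[ℝ] E n × E n :=
  (ContinuousLinearMap.fst ℝ (E n) (E n)).prod (τ • ContinuousLinearMap.snd ℝ (E n) (E n))

theorem LL_apply (τ : ℝ) (x : E n × E n) : LL n τ x = (x.1, τ • x.2) := rfl

theorem LL_norm {τ : ℝ} (h : τ ∈ Icc (0:ℝ) 1) : ‖LL n τ‖ ≤ 1 := by
  refine ContinuousLinearMap.opNorm_le_bound _ zero_le_one fun x => ?_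
  rw [LL_apply, one_mul, Prod.norm_mk, norm_smul, Real.norm_of_nonneg h.1]
  refine max_le (norm_fst_le x) ?_
  have := norm_snd_le x
  nlinarith [norm_nonneg x.2, h.2]

theorem LL_mem {τ : ℝ} (h : τ ∈ Icc (0:ℝ) 1) {x : E n × E n} (hx : x ∈ Om n) : LL n τ x ∈ Om n := by
  refine ⟨mem_univ _, ?_⟩
  have hp : ‖x.2‖ < 1 := by simpa using hx.2
  rw [mem_ball_zero_iff, LL_apply]
  simp only
  rw [norm_smul, Real.norm_of_nonneg h.1]
  nlinarith [norm_nonneg x.2, h.2]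

theorem LL_cont : Continuous (LL n) := by
  have : LL n = fun τ => (ContinuousLinearMap.inl ℝ (E n) (E n)).comp (ContinuousLinearMap.fst ℝ (E n) (E n)) +
      τ • (ContinuousLinearMap.inr ℝ (E n) (E n)).comp (ContinuousLinearMap.snd ℝ (E n) (E n)) := by
    funext τ
    refine ContinuousLinearMap.ext fun x => ?_
    rw [LL_apply]
    simp
  rw [this]
  fun_prop

theorem LL_iter {N : ℕ} {V : E n × E n → Y} (hV : ContDiffOn ℝ N V (Om n)) {τ : ℝ} (h : τ ∈ Icc (0:ℝ) 1) {m : ℕ} (hm : m ≤ N)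
    {x : E n × E n} (hx : x ∈ Om n) : iteratedFDerivWithin ℝ m (fun x => V (LL n τ x)) (Om n) x =
      (iteratedFDerivWithin ℝ m V (Om n) (LL n τ x)).compContinuousLinearMap fun _ => LL n τ := by
  have o2 : IsOpen (LL n τ ⁻¹' (Om n)) := isOpen_Om.preimage (LL n τ).continuous
  have h1 := (LL n τ).iteratedFDerivWithin_comp_right hV isOpen_Om.uniqueDiffOn o2.uniqueDiffOn (x := x) (LL_mem h hx) (i := m) (by exact_mod_cast hm)
  rw [iteratedFDerivWithin_of_isOpen m o2 (LL_mem h hx : x ∈ LL n τ ⁻¹' (Om n))] at h1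
  rw [iteratedFDerivWithin_of_isOpen m isOpen_Om hx]
  exact h1

theorem prim [CompleteSpace Y] {N : ℕ} {φ : E n × E n → Y} {V : E n × E n → E n →L[ℝ] Y}
    (hd : ∀ q, ∀ p ∈ ball (0 : E n) 1, HasFDerivAt (fun p' => φ (q, p')) (V (q, p)) p) (hV : ContDiffOn ℝ N V (Om n))
    {B : ℝ} (hB : ∀ i ≤ N, ∀ x ∈ Om n, ‖iteratedFDerivWithin ℝ i V (Om n) x‖ ≤ B)
    (h0 : ContDiff ℝ N (fun q => φ (q, 0))) :
    ContDiffOn ℝ N φ (Om n) ∧ ∀ m ≤ N, ∀ b b' : ℝ, (∀ i ≤ m, ∀ x ∈ Om n, ‖iteratedFDerivWithin ℝ i V (Om n) x‖ ≤ b) →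
      (∀ q, ‖iteratedFDeriv ℝ m (fun q => φ (q, 0)) q‖ ≤ b') → ∀ x ∈ Om n, ‖iteratedFDerivWithin ℝ m φ (Om n) x‖ ≤ b' + 2 ^ m * b := by
  have hO := (isOpen_Om (n := n))
  have hu := hO.uniqueDiffOn (𝕜 := ℝ)
  have nb : ∀ m ≤ N, ∀ τ ∈ Icc (0:ℝ) 1, ∀ x ∈ Om n, ∀ b, (∀ x ∈ Om n, ‖iteratedFDerivWithin ℝ m V (Om n) x‖ ≤ b) →
      ‖iteratedFDerivWithin ℝ m (fun x => V (LL n τ x)) (Om n) x‖ ≤ b := by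
    intro m hm τ hτ x hx b hb
    rw [LL_iter hV hτ hm hx]
    refine (ContinuousMultilinearMap.norm_compContinuousLinearMap_le _ _).trans ?_
    rw [Finset.prod_const]
    have h1 := hb _ (LL_mem hτ hx)
    have h2 : ‖LL n τ‖ ^ (Finset.univ : Finset (Fin m)).card ≤ 1 := pow_le_one₀ (norm_nonneg _) (LL_norm hτ)
    exact (mul_le_of_le_one_right (norm_nonneg _) h2).trans h1
  obtain ⟨cI, dI⟩ := integral_iter hO (N := N) (G := fun τ x => V (LL n τ x)) (B := B)
    (fun τ hτ => hV.comp (LL n τ).contDiff.contDiffOn fun x hx => LL_mem hτ hx)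
    (fun m hm τ hτ x hx => nb m hm τ hτ x hx B (hB m hm))
    (fun m hm x hx => by
      have h1 : ContinuousOn (fun τ => iteratedFDerivWithin ℝ m V (Om n) (LL n τ x)) (Icc 0 1) :=
        (hV.continuousOn_iteratedFDerivWithin (by exact_mod_cast hm) hu).comp
          ((LL_cont.clm_apply continuous_const).continuousOn) fun τ hτ => LL_mem hτ hx
      have h2 : ContinuousOn (fun τ => (ContinuousMultilinearMap.compContinuousLinearMapL (𝕜 := ℝ) (F := E n →L[ℝ] Y)
          (fun _ : Fin m => LL n τ)) (iteratedFDerivWithin ℝ m V (Om n) (LL n τ x))) (Icc 0 1) := by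
        refine ContinuousOn.clm_apply ?_ h1
        have h3 : Continuous (fun τ : ℝ => fun _ : Fin m => LL n τ) := continuous_pi fun _ => LL_cont
        exact ((ContinuousMultilinearMap.compContinuousLinearMapContinuousMultilinear ℝ (fun _ : Fin m => E n × E n)
          (fun _ : Fin m => E n × E n) (E n →L[ℝ] Y)).cont.comp h3).continuousOn
      refine h2.congr fun τ hτ => ?_
      rw [LL_iter hV hτ hm hx]; rfl)
  set I : E n × E n → E n →L[ℝ] Y := fun x => ∫ τ in (0:ℝ)..1, V (LL n τ x) with hI
  have bI : ∀ m ≤ N, ∀ x ∈ Om n, ∀ b, (∀ x ∈ Om n, ‖iteratedFDerivWithin ℝ m V (Om n) x‖ ≤ b) → ‖iteratedFDerivWithin ℝ m I (Om n) x‖ ≤ b := by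
    intro m hm x hx b hb
    rw [dI m hm x hx]
    have := intervalIntegral.norm_integral_le_of_norm_le_const (a := 0) (b := 1) (C := b)
      (f := fun τ => iteratedFDerivWithin ℝ m (fun x => V (LL n τ x)) (Om n) x) fun τ hτ =>
        nb m hm τ (by rw [uIoc_of_le zero_le_one] at hτ; exact Ioc_subset_Icc_self hτ) x hx b hb
    simpa using this
  have eqφ : ∀ x ∈ Om n, φ x = φ (x.1, 0) + I x x.2 := by
    intro x hx
    have cV : ContinuousOn (fun τ => V (LL n τ x)) (Icc 0 1) := hV.continuousOn.comp
          ((LL_cont.clm_apply continuous_const).continuousOn) fun τ hτ => LL_mem hτ hx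
    have h1 := intervalIntegral.integral_eq_sub_of_hasDerivAt (a := 0) (b := 1) (f := fun τ => φ (x.1, τ • x.2))
      (f' := fun τ => V (LL n τ x) x.2) (fun τ hτ => by
        rw [uIcc_of_le zero_le_one] at hτ
        have h2 := hd x.1 (τ • x.2) (LL_mem hτ hx).2
        have h3 : HasDerivAt (fun τ : ℝ => τ • x.2) x.2 τ := by simpa using (hasDerivAt_id τ).smul_const x.2
        exact h2.comp_hasDerivAt τ h3) (by
        refine ContinuousOn.intervalIntegrable ?_
        rw [uIcc_of_le zero_le_one]
        exact cV.clm_apply continuousOn_const)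
    have h4 := (ContinuousLinearMap.apply ℝ Y x.2).intervalIntegral_comp_comm (μ := volume) (a := 0) (b := 1) (f := fun τ => V (LL n τ x))
      (ContinuousOn.intervalIntegrable (by rw [uIcc_of_le zero_le_one]; exact cV))
    simp only [ContinuousLinearMap.apply_apply] at h4
    rw [h4, one_smul, zero_smul] at h1
    rw [hI]; simp only
    rw [h1]; abel
  have c1 : ContDiffOn ℝ N (fun x : E n × E n => φ (x.1, 0)) (Om n) := (h0.comp contDiff_fst).contDiffOn
  have c2 : ContDiffOn ℝ N (fun x : E n × E n => I x x.2) (Om n) := cI.clm_apply contDiff_snd.contDiffOn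
  refine ⟨(c1.add c2).congr eqφ, fun m hm b b' hb hb' x hx => ?_⟩
  have hb0 : 0 ≤ b := (norm_nonneg _).trans (hb 0 (Nat.zero_le _) x hx)
  rw [iteratedFDerivWithin_congr eqφ hx, fun_iteratedFDerivWithin_add_apply ((c1 x hx).of_le (by exact_mod_cast hm)) ((c2 x hx).of_le (by exact_mod_cast hm)) hu hx]
  refine (norm_add_le _ _).trans (add_le_add ?_ ?_)
  · rw [iteratedFDerivWithin_of_isOpen m hO hx]
    have := (ContinuousLinearMap.fst ℝ (E n) (E n)).iteratedFDeriv_comp_right h0 x (i := m) (by exact_mod_cast hm)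
    have e : (fun x : E n × E n => φ (x.1, 0)) = (fun q => φ (q, 0)) ∘ (ContinuousLinearMap.fst ℝ (E n) (E n)) := rfl
    rw [e, this]
    refine (ContinuousMultilinearMap.norm_compContinuousLinearMap_le _ _).trans ?_
    rw [Finset.prod_const]
    refine (mul_le_of_le_one_right (norm_nonneg _) (pow_le_one₀ (norm_nonneg _) (ContinuousLinearMap.norm_fst_le ..))).trans (hb' _)
  · refine (norm_iteratedFDerivWithin_clm_apply cI contDiff_snd.contDiffOn hu hx (by exact_mod_cast hm)).trans ?_
    have hs : ∀ j, ‖iteratedFDerivWithin ℝ j (Prod.snd : E n × E n → E n) (Om n) x‖ ≤ 1 := by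
      intro j
      rw [iteratedFDerivWithin_of_isOpen j hO hx]
      rcases j with _ | _ | j
      · rw [norm_iteratedFDeriv_zero]; have : ‖x.2‖ < 1 := by simpa using hx.2
        exact this.le
      · rw [zero_add, norm_iteratedFDeriv_one, fderiv_snd]; exact ContinuousLinearMap.norm_snd_le ..
      · rw [← norm_iteratedFDeriv_fderiv]
        have : fderiv ℝ (Prod.snd : E n × E n → E n) = fun _ => ContinuousLinearMap.snd ℝ (E n) (E n) := by
          funext y; exact fderiv_snd
        rw [this, iteratedFDeriv_const_of_ne (by omega)]; simp
    have e2 : (2:ℝ) ^ m = ∑ i ∈ Finset.range (m + 1), (m.choose i : ℝ) := by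
      exact_mod_cast (Nat.sum_range_choose m).symm
    rw [e2, Finset.sum_mul]
    refine Finset.sum_le_sum fun i hi => ?_
    have hi' : i ≤ m := by simpa [Nat.lt_succ_iff] using hi
    have h1 := bI i (hi'.trans hm) x hx b (hb i hi')
    calc _ ≤ (m.choose i : ℝ) * b * 1 := by gcongr; exact hs _
      _ = _ := mul_one _

end PrimSec


section HoeSec
set_option maxSynthPendingDepth 3
set_option linter.unusedVariables false
set_option linter.deprecated false

theorem absA (n : ℕ) (k : ℕ) {Υ : ℝ} (hΥ : 0 ≤ Υ) : ∃ M : ℝ, 0 ≤ M ∧ ∀ η > 0, ∃ δ > 0,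
    ∀ (φ : E n × E n → ℝ) (P : E n × E n → E n →L[ℝ] ℝ) (V : E n × E n → E n →L[ℝ] E n →L[ℝ] ℝ),
    ContDiffOn ℝ ((k + 2 : ℕ)) V (Om n) → (∀ i ≤ k + 2, ∀ x ∈ Om n, ‖iteratedFDerivWithin ℝ i V (Om n) x‖ ≤ 2 * Υ) →
    (∀ q, ∀ p ∈ ball (0 : E n) 1, HasFDerivAt (fun p' => P (q, p')) (V (q, p)) p) →
    (∀ q, ∀ p ∈ ball (0 : E n) 1, HasFDerivAt (fun p' => φ (q, p')) (P (q, p)) p) →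
    (∀ x ∈ Om n, ‖V x‖ ≤ δ) →
    ContDiff ℝ ((k + 2 : ℕ)) (fun q => P (q, 0)) → (∀ i ≤ k + 2, ∀ q, ‖iteratedFDeriv ℝ i (fun q => P (q, 0)) q‖ ≤ δ) →
    ContDiff ℝ ((k + 2 : ℕ)) (fun q => φ (q, 0)) → (∀ i ≤ k + 1, ∀ q, ‖iteratedFDeriv ℝ (i + 1) (fun q => φ (q, 0)) q‖ ≤ δ) →
    ContDiffOn ℝ ((k + 2 : ℕ)) φ (Om n) ∧ (∀ i ≤ k, ∀ x ∈ Om n, ‖iteratedFDerivWithin ℝ (i + 1) φ (Om n) x‖ ≤ η) ∧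
      ∀ x ∈ Om n, ‖iteratedFDerivWithin ℝ (k + 2) φ (Om n) x‖ ≤ M := by
  set Q : ℝ := 2 ^ (k + 2) with hQ
  have hQ1 : 1 ≤ Q := one_le_pow₀ (by norm_num)
  have hQi : ∀ i ≤ k + 2, (2:ℝ) ^ i ≤ Q := fun i hi => pow_le_pow_right₀ (by norm_num) hi
  refine ⟨1 + Q * (1 + Q * (2 * Υ)), by positivity, fun η hη => ?_⟩
  obtain ⟨δ₁, hδ₁, H1⟩ := interp (Y := E n →L[ℝ] E n →L[ℝ] ℝ) (isOpen_Om (n := n)) convex_Om Om_in (2 * Υ) (by positivity) (k + 1)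
    (η / (4 * Q ^ 2)) (by positivity)
  refine ⟨min δ₁ (min 1 (η / (4 * Q))), by positivity, ?_⟩
  set δ := min δ₁ (min 1 (η / (4 * Q))) with hδ
  have d1 : δ ≤ δ₁ := min_le_left _ _
  have d2 : δ ≤ 1 := (min_le_right _ _).trans (min_le_left _ _)
  have d3 : δ ≤ η / (4 * Q) := (min_le_right _ _).trans (min_le_right _ _)
  have d0 : 0 < δ := by positivity
  clear_value δ
  intro φ P V cV bV hP hφ V0 cP bP cφ bφ
  have s1 := H1 V cV (fun i hi x hx => bV i hi x hx) (fun x hx => (V0 x hx).trans d1)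
  obtain ⟨CP, BP⟩ := prim hP cV bV cP
  have t1 : ∀ i ≤ k + 1, ∀ x ∈ Om n, ‖iteratedFDerivWithin ℝ i P (Om n) x‖ ≤ δ + Q * (η / (4 * Q ^ 2)) := by
    intro i hi x hx
    refine (BP i (by omega) (η / (4 * Q ^ 2)) δ (fun j hj => s1 j (by omega)) (bP i (by omega)) x hx).trans ?_
    gcongr; exact hQi i (by omega)
  have t2 : ∀ i ≤ k + 2, ∀ x ∈ Om n, ‖iteratedFDerivWithin ℝ i P (Om n) x‖ ≤ 1 + Q * (2 * Υ) := by
    intro i hi x hx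
    refine (BP i hi (2 * Υ) δ (fun j hj => bV j (by omega)) (bP i hi) x hx).trans ?_
    gcongr; exact hQi i hi
  obtain ⟨Cφ, Bφ⟩ := prim hφ CP t2 cφ
  refine ⟨Cφ, fun i hi x hx => ?_, fun x hx => ?_⟩
  · refine (Bφ (i + 1) (by omega) _ δ (fun j hj => t1 j (by omega)) (bφ i (by omega)) x hx).trans ?_
    calc δ + 2 ^ (i + 1) * (δ + Q * (η / (4 * Q ^ 2))) ≤ δ + Q * (δ + Q * (η / (4 * Q ^ 2))) := by
          gcongr; exact hQi _ (by omega)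
      _ = (1 + Q) * δ + η / 4 := by field_simp; ring
      _ ≤ (Q + Q) * (η / (4 * Q)) + η / 4 := by gcongr
      _ = 3 * η / 4 := by field_simp; ring
      _ ≤ η := by linarith
  · refine (Bφ (k + 2) le_rfl _ δ (fun j hj => t2 j hj) (bφ (k + 1) le_rfl) x hx).trans ?_
    gcongr

variable {X Z : Type*} [NormedAddCommGroup X] [NormedSpace ℝ X] [NormedAddCommGroup Z] [NormedSpace ℝ Z]

theorem absB [CompleteSpace Z] {Ω : Set X} (ho : IsOpen Ω) (hc : Convex ℝ Ω) {k : ℕ} (w : ℝ → X → Z)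
    (hw : ∀ t s, ContDiffOn ℝ ((k + 1 : ℕ)) (fun x => w t x - w s x) Ω) {M : ℝ} (hM : 0 ≤ M)
    (hs : ∀ η > 0, ∃ T : ℝ, ∀ t s, T ≤ |t| → T ≤ |s| → (∀ i ≤ k, ∀ x ∈ Ω, ‖iteratedFDerivWithin ℝ i (fun x => w t x - w s x) Ω x‖ ≤ η) ∧
      ∀ x ∈ Ω, ‖iteratedFDerivWithin ℝ (k + 1) (fun x => w t x - w s x) Ω x‖ ≤ M)
    (h0 : ∀ x ∈ Ω, Tendsto (fun j : ℕ => w j x) atTop (𝓝 0)) :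
    ∀ η > 0, ∃ T : ℝ, ∀ t, T ≤ |t| → (∀ i ≤ k, ∀ x ∈ Ω, ‖iteratedFDerivWithin ℝ i (w t) Ω x‖ ≤ η) ∧
      ∀ x ∈ Ω, ∀ y ∈ Ω, ‖iteratedFDerivWithin ℝ k (w t) Ω x - iteratedFDerivWithin ℝ k (w t) Ω y‖ ≤ M * ‖x - y‖ := by
  intro η hη
  obtain ⟨T, hT⟩ := hs η hη
  refine ⟨T, fun t ht => ?_⟩
  have hu := ho.uniqueDiffOn (𝕜 := ℝ)
  have lim := limit_iter ho (k := k) (g := fun j x => w t x - w j x) (g₀ := w t)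
    (fun j => (hw t j).of_le (by exact_mod_cast Nat.le_succ k)) (by
      intro η' hη'
      obtain ⟨T', hT'⟩ := hs η' hη'
      refine ⟨⌈T'⌉₊, fun i hi j hj m hm x hx => ?_⟩
      have a1 : ∀ i ≥ ⌈T'⌉₊, T' ≤ |(i:ℝ)| := fun i hi => by
        rw [Nat.abs_cast]; exact (Nat.le_ceil T').trans (by exact_mod_cast hi)
      have h1 := (hT' j i (a1 j hj) (a1 i hi)).1 m hm x hx
      have e : (fun x => w j x - w i x) = (fun x => (w t x - w i x) - (w t x - w j x)) := by funext x; abel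
      have c1 : ∀ j : ℕ, ContDiffWithinAt ℝ m (fun x => w t x - w j x) Ω x := fun j =>
        ((hw t j) x hx).of_le (by exact_mod_cast (by omega : m ≤ k + 1))
      rw [e] at h1
      rw [← fun_iteratedFDerivWithin_sub_apply (c1 i) (c1 j) hu hx]
      exact h1) (by
      intro x hx
      have := (tendsto_const_nhds (x := w t x)).sub (h0 x hx)
      simpa using this)
  have ev : ∀ᶠ j : ℕ in atTop, T ≤ |(j:ℝ)| := by
    filter_upwards [eventually_ge_atTop ⌈T⌉₊] with j hj
    rw [Nat.abs_cast]; exact (Nat.le_ceil T).trans (by exact_mod_cast hj)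
  refine ⟨fun i hi x hx => ?_, fun x hx y hy => ?_⟩
  · refine le_of_tendsto (lim i hi x hx).norm (ev.mono fun j hj => ?_)
    exact (hT t j ht hj).1 i hi x hx
  · refine le_of_tendsto ((lim k le_rfl x hx).sub (lim k le_rfl y hy)).norm (ev.mono fun j hj => ?_)
    have b := (hT t j ht hj).2
    refine hc.norm_image_sub_le_of_norm_hasFDerivWithin_le
      (fun z hz => (iter_hasFDerivAt ho (hw t j) (Nat.lt_succ_self k) hz).hasFDerivWithinAt) (fun z hz => ?_) hy hx
    simpa using b z hz

theorem absC {Ω : Set X} {σ M : ℝ} (hσ : 0 ≤ σ) (hM : 0 ≤ M) (w : ℝ → X → Z)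
    (hs : ∀ η > 0, ∃ T : ℝ, ∀ t, T ≤ |t| → (∀ i ≤ ⌊σ⌋₊, ∀ x ∈ Ω, ‖iteratedFDerivWithin ℝ i (w t) Ω x‖ ≤ η) ∧
      ∀ x ∈ Ω, ∀ y ∈ Ω, ‖iteratedFDerivWithin ℝ ⌊σ⌋₊ (w t) Ω x - iteratedFDerivWithin ℝ ⌊σ⌋₊ (w t) Ω y‖ ≤ M * ‖x - y‖) :
    ∀ ζ : ℝ≥0∞, 0 < ζ → ∃ T : ℝ, ∀ t, T ≤ |t| → holderNormOn σ Ω (w t) ≤ ζ := by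
  intro ζ hζ
  set α := σ - ⌊σ⌋₊ with hα
  have a0 : 0 ≤ α := sub_nonneg.2 (Nat.floor_le hσ)
  have a1 : α < 1 := by have := Nat.lt_floor_add_one σ; linarith
  have lim : Tendsto (fun η : ℝ => ENNReal.ofReal (η + M ^ α * (2 * η) ^ (1 - α))) (𝓝[>] 0) (𝓝 0) := by
    have : Continuous (fun η : ℝ => ENNReal.ofReal (η + M ^ α * (2 * η) ^ (1 - α))) := by
      refine ENNReal.continuous_ofReal.comp (continuous_id.add (continuous_const.mul ?_))
      exact (continuous_const.mul continuous_id).rpow_const fun x => Or.inr (by linarith)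
    have h := (this.tendsto 0).mono_left (nhdsWithin_le_nhds (s := Ioi 0))
    have e : ENNReal.ofReal (0 + M ^ α * (2 * 0) ^ (1 - α)) = 0 := by
      rw [mul_zero, Real.zero_rpow (by linarith)]; simp
    rwa [e] at h
  obtain ⟨η, hη1, hη⟩ := ((lim.eventually (Iic_mem_nhds hζ)).and self_mem_nhdsWithin).exists
  have hη : 0 < η := hη
  obtain ⟨T, hT⟩ := hs η hη
  refine ⟨T, fun t ht => le_trans ?_ hη1⟩
  obtain ⟨b1, b2⟩ := hT t ht
  rw [ENNReal.ofReal_add hη.le (by positivity)]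
  refine add_le_add ?_ ?_
  · refine iSup_le fun i => iSup₂_le fun x hx => ?_
    rw [← enorm_eq_nnnorm, ← ofReal_norm_eq_enorm]
    exact ENNReal.ofReal_le_ofReal (b1 i (by have := i.2; omega) x hx)
  · split_ifs with hi
    · exact zero_le
    · refine iSup₂_le fun x hx => iSup₂_le fun y hy => iSup_le fun hxy => ENNReal.ofReal_le_ofReal ?_
      have hn : 0 < ‖x - y‖ := norm_pos_iff.2 (sub_ne_zero.2 hxy)
      rw [div_le_iff₀ (by positivity)]
      set A := ‖iteratedFDerivWithin ℝ ⌊σ⌋₊ (w t) Ω x - iteratedFDerivWithin ℝ ⌊σ⌋₊ (w t) Ω y‖ with hA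
      have A0 : 0 ≤ A := norm_nonneg _
      have A1 : A ≤ M * ‖x - y‖ := b2 x hx y hy
      have A2 : A ≤ 2 * η := by
        refine (norm_sub_le _ _).trans ?_
        have := b1 _ le_rfl x hx
        have := b1 _ le_rfl y hy
        linarith
      calc A = A ^ α * A ^ (1 - α) := by
            rw [← Real.rpow_add_of_nonneg A0 a0 (by linarith)]; simp
        _ ≤ (M * ‖x - y‖) ^ α * (2 * η) ^ (1 - α) := by
            gcongr
        _ = _ := by rw [Real.mul_rpow hM hn.le]; ring

theorem absD {g : ℝ → ℝ≥0∞} (hs : ∀ ζ : ℝ≥0∞, 0 < ζ → ∃ T : ℝ, ∀ t, T ≤ |t| → g t ≤ ζ) :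
    Tendsto g atTop (𝓝 0) ∧ Tendsto g atBot (𝓝 0) := by
  constructor
  · rw [ENNReal.tendsto_nhds_zero]
    intro ζ hζ
    obtain ⟨T, hT⟩ := hs ζ hζ
    filter_upwards [eventually_ge_atTop T] with t ht using hT t (ht.trans (le_abs_self t))
  · rw [ENNReal.tendsto_nhds_zero]
    intro ζ hζ
    obtain ⟨T, hT⟩ := hs ζ hζ
    filter_upwards [eventually_le_atBot (-T)] with t ht using hT t (by have := neg_le_abs t; linarith)

end HoeSec


section HapSec
set_option maxSynthPendingDepth 3
set_option linter.unusedVariables false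
set_option linter.deprecated false

structure Tri (n k : ℕ) (Υ δ : ℝ) (φ : E n × E n → ℝ) (P : E n × E n → E n →L[ℝ] ℝ) (V : E n × E n → E n →L[ℝ] E n →L[ℝ] ℝ) : Prop where
  cV : ContDiffOn ℝ ((k + 2 : ℕ)) V (Om n)
  bV : ∀ i ≤ k + 2, ∀ x ∈ Om n, ‖iteratedFDerivWithin ℝ i V (Om n) x‖ ≤ 2 * Υ
  hP : ∀ q, ∀ p ∈ ball (0 : E n) 1, HasFDerivAt (fun p' => P (q, p')) (V (q, p)) p
  hφ : ∀ q, ∀ p ∈ ball (0 : E n) 1, HasFDerivAt (fun p' => φ (q, p')) (P (q, p)) p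
  V0 : ∀ x ∈ Om n, ‖V x‖ ≤ δ
  cP : ContDiff ℝ ((k + 2 : ℕ)) (fun q => P (q, 0))
  bP : ∀ i ≤ k + 2, ∀ q, ‖iteratedFDeriv ℝ i (fun q => P (q, 0)) q‖ ≤ δ
  cφ : ContDiff ℝ ((k + 2 : ℕ)) (fun q => φ (q, 0))
  bφ : ∀ i ≤ k + 1, ∀ q, ‖iteratedFDeriv ℝ (i + 1) (fun q => φ (q, 0)) q‖ ≤ δ

theorem Tri.cd {k : ℕ} {Υ δ : ℝ} {φ : E n × E n → ℝ} {P : E n × E n → E n →L[ℝ] ℝ} {V : E n × E n → E n →L[ℝ] E n →L[ℝ] ℝ}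
    (T : Tri n k Υ δ φ P V) (hΥ : 0 ≤ Υ) : ContDiffOn ℝ ((k + 2 : ℕ)) φ (Om n) := by
  obtain ⟨CP, BP⟩ := prim T.hP T.cV T.bV T.cP
  have t2 : ∀ i ≤ k + 2, ∀ x ∈ Om n, ‖iteratedFDerivWithin ℝ i P (Om n) x‖ ≤ δ + 2 ^ (k + 2) * (2 * Υ) := by
    intro i hi x hx
    refine (BP i hi (2 * Υ) δ (fun j hj => T.bV j (by omega)) (T.bP i hi) x hx).trans ?_
    gcongr; norm_num
  exact (prim T.hφ CP t2 T.cφ).1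

/-- the musical maps, as real-linear maps -/
def Js (n : ℕ) : (E n →L[ℝ] ℝ) →L[ℝ] E n :=
  LinearMap.mkContinuous
    { toFun := fun ψ => (InnerProductSpace.toDual ℝ (E n)).symm ψ
      map_add' := fun a b => by simp
      map_smul' := fun c a => by simp } 1 fun ψ => by simp

def Jd (n : ℕ) : E n →L[ℝ] (E n →L[ℝ] ℝ) :=
  LinearMap.mkContinuous
    { toFun := fun ψ => (InnerProductSpace.toDual ℝ (E n)) ψ
      map_add' := fun a b => by simp
      map_smul' := fun c a => by simp } 1 fun ψ => by simp

theorem Js_apply (ψ : E n →L[ℝ] ℝ) : Js n ψ = (InnerProductSpace.toDual ℝ (E n)).symm ψ := rfl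
theorem Jd_apply (ψ : E n) : Jd n ψ = (InnerProductSpace.toDual ℝ (E n)) ψ := rfl
theorem Jd_norm : ‖Jd n‖ ≤ 1 := LinearMap.mkContinuous_norm_le _ zero_le_one _
theorem Js_Jd (x : E n) : Js n (Jd n x) = x := by rw [Js_apply, Jd_apply]; simp

/-- the symplectic map -/
def AA (n : ℕ) : (E n × E n →L[ℝ] ℝ) →L[ℝ] E n × E n :=
  ((Js n).comp ((ContinuousLinearMap.compL ℝ (E n) (E n × E n) ℝ).flip (ContinuousLinearMap.inr ℝ (E n) (E n)))).prod
    (-(Js n).comp ((ContinuousLinearMap.compL ℝ (E n) (E n × E n) ℝ).flip (ContinuousLinearMap.inl ℝ (E n) (E n))))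

theorem AA_apply (ψ : E n × E n →L[ℝ] ℝ) : AA n ψ = (Js n (ψ.comp (ContinuousLinearMap.inr ℝ (E n) (E n))),
   -Js n (ψ.comp (ContinuousLinearMap.inl ℝ (E n) (E n)))) := rfl

variable {k : ℕ} {Υ l e : ℝ} {h : E n → ℝ} {R : E n → E n → ℝ} {f H : E n → E n → ℝ → ℝ} {u v : E n → E n → ℝ → E n}

/-- the difference of the perturbation at two times -/
def ph (f : E n → E n → ℝ → ℝ) (t s : ℝ) : E n × E n → ℝ := fun x => f x.1 x.2 t - f x.1 x.2 s
def Ph (u : E n → E n → ℝ → E n) (t s : ℝ) : E n × E n → E n →L[ℝ] ℝ := fun x => Jd n (u x.1 x.2 t - u x.1 x.2 s)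
def Vh (H : E n → E n → ℝ → ℝ) (t s : ℝ) : E n × E n → E n →L[ℝ] E n →L[ℝ] ℝ := fun x => SS H t x - SS H s x

theorem Reg.hVP (r : Reg k Υ l e h R f H u v) (t s : ℝ) (q : E n) {p : E n} (hp : p ∈ ball (0 : E n) 1) :
    HasFDerivAt (fun p' => Ph u t s (q, p')) (Vh H t s (q, p)) p := by
  have h1 := (r.SH t q p hp).hasFDerivAt.sub (r.SH s q p hp).hasFDerivAt
  have h2 : (fun p' => Ph u t s (q, p')) =ᶠ[𝓝 p] fun p' => fderiv ℝ (fun p' => H q p' t) p' - fderiv ℝ (fun p' => H q p' s) p' := by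
    filter_upwards [isOpen_ball.mem_nhds hp] with p' hp'
    rw [(r.Hp t q hp').fderiv, (r.Hp s q hp').fderiv]
    simp only [Ph]
    rw [map_sub, Jd_apply, Jd_apply]; abel
  exact h1.congr_of_eventuallyEq h2

theorem dif_norm {X Y : Type*} [NormedAddCommGroup X] [NormedSpace ℝ X] [NormedAddCommGroup Y] [NormedSpace ℝ Y] {N m : ℕ}
    {a b : X → Y} (ha : ContDiff ℝ N a) (hb : ContDiff ℝ N b) (hm : m ≤ N) {x : X} {A B : ℝ} (hA : ‖iteratedFDeriv ℝ m a x‖ ≤ A)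
    (hB : ‖iteratedFDeriv ℝ m b x‖ ≤ B) : ‖iteratedFDeriv ℝ m (fun x => a x - b x) x‖ ≤ A + B := by
  have hm' : (m : WithTop ℕ∞) ≤ N := by exact_mod_cast hm
  rw [fun_iteratedFDeriv_sub_apply (ha.contDiffAt.of_le hm') (hb.contDiffAt.of_le hm')]
  exact (norm_sub_le _ _).trans (add_le_add hA hB)

theorem Jd_iter {X : Type*} [NormedAddCommGroup X] [NormedSpace ℝ X] {N m : ℕ}
    {a : X → E n} (ha : ContDiff ℝ N a) (hm : m ≤ N) {x : X} {A : ℝ} (hA : ‖iteratedFDeriv ℝ m a x‖ ≤ A) :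
    ‖iteratedFDeriv ℝ m (fun x => Jd n (a x)) x‖ ≤ A := by
  have := (Jd n).norm_iteratedFDeriv_comp_left (ha.contDiffAt (x := x)) (n := m) (by exact_mod_cast hm)
  refine this.trans ((mul_le_of_le_one_left (norm_nonneg _) Jd_norm).trans hA)

theorem Reg.tri (r : Reg k Υ l e h R f H u v) (he : 0 ≤ e) (t s : ℝ) :
    Tri n k Υ (e * bw l t + e * bw l s) (ph f t s) (Ph u t s) (Vh H t s) := by
  have m0 : (0 : E n) ∈ ball (0 : E n) 1 := by simp
  have b1 : ∀ t, e * bw (l + 1) t ≤ e * bw l t := fun t => mul_le_mul_of_nonneg_left (bw_anti (by linarith) t) he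
  have b2 : ∀ t, e * bw (l + 2) t ≤ e * bw l t := fun t => mul_le_mul_of_nonneg_left (bw_anti (by linarith) t) he
  have b0 : ∀ t, 0 ≤ e * bw l t := fun t => mul_nonneg he (bw_pos _ _).le
  have hu := (isOpen_Om (n := n)).uniqueDiffOn (𝕜 := ℝ)
  constructor
  · exact (r.SC t).sub (r.SC s)
  · intro i hi x hx
    have hi' : (i : WithTop ℕ∞) ≤ ((k + 2 : ℕ)) := by exact_mod_cast hi
    unfold Vh
    rw [fun_iteratedFDerivWithin_sub_apply ((r.SC t x hx).of_le hi') ((r.SC s x hx).of_le hi') hu hx]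
    refine (norm_sub_le _ _).trans ?_
    have := r.SB t x hx i hi
    have := r.SB s x hx i hi
    linarith
  · exact fun q p hp => r.hVP t s q hp
  · intro q p hp
    have := (r.fp p hp q t).hasFDerivAt.sub (r.fp p hp q s).hasFDerivAt
    rw [← map_sub] at this
    exact this
  · intro x hx
    refine (r.hVP t s x.1 hx.2).le_of_lip' (add_nonneg (b0 t) (b0 s)) ?_
    filter_upwards [isOpen_ball.mem_nhds hx.2] with p' hp'
    simp only [Ph]
    rw [← map_sub]
    refine ((Jd n).le_opNorm _).trans ((mul_le_of_le_one_left (norm_nonneg _) Jd_norm).trans ?_)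
    have h1 := r.uL p' hp' x.2 hx.2 t x.1
    have h2 := r.uL p' hp' x.2 hx.2 s x.1
    rw [sub_sub_sub_comm, add_mul]
    exact (norm_sub_le _ _).trans (add_le_add h1 h2)
  · exact (Jd n).contDiff.comp ((r.uC 0 m0 t).sub (r.uC 0 m0 s))
  · intro i hi q
    refine Jd_iter ((r.uC 0 m0 t).sub (r.uC 0 m0 s)) hi ?_
    exact dif_norm (r.uC 0 m0 t) (r.uC 0 m0 s) hi ((r.uB 0 m0 t q i hi).trans (b1 t)) ((r.uB 0 m0 s q i hi).trans (b1 s))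
  · exact (r.fC 0 m0 t).sub (r.fC 0 m0 s)
  · intro i hi q
    rw [← norm_iteratedFDeriv_fderiv]
    have e1 : fderiv ℝ (fun q => ph f t s (q, 0)) = fun q => Jd n (v q 0 t - v q 0 s) := by
      funext q
      have := (r.fq 0 m0 q t).hasFDerivAt.sub (r.fq 0 m0 q s).hasFDerivAt
      rw [← map_sub] at this
      exact this.fderiv
    rw [e1]
    refine Jd_iter ((r.vC t m0).sub (r.vC s m0)) hi ?_
    exact dif_norm (r.vC t m0) (r.vC s m0) hi ((r.vB 0 m0 t q i hi).trans (b2 t)) ((r.vB 0 m0 s q i hi).trans (b2 s))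

/-- the difference of the vector fields -/
def ww (h : E n → ℝ) (R : E n → E n → ℝ) (H : E n → E n → ℝ → ℝ) (t : ℝ) (x : E n × E n) : E n × E n :=
  XH H x.1 x.2 t - XH (fun q p _ => h p + R q p) x.1 x.2 t

theorem Reg.ww_eq (r : Reg k Υ l e h R f H u v) (t : ℝ) {x : E n × E n} (hx : x ∈ Om n) :
    ww h R H t x = (u x.1 x.2 t, -v x.1 x.2 t) := by
  have hp := hx.2
  have a1 : DifferentiableAt ℝ h x.2 := (r.hh.differentiableOn (by norm_num)).differentiableAt (isOpen_ball.mem_nhds hp)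
  have a2 : DifferentiableAt ℝ (fun p => R x.1 p) x.2 :=
      ((slice_R r.hR x.1).differentiableOn (by norm_num)).differentiableAt (isOpen_ball.mem_nhds hp)
  have c1 : fderiv ℝ (fun p => h p + R x.1 p) x.2 = fderiv ℝ h x.2 + fderiv ℝ (fun p => R x.1 p) x.2 :=
    (a1.hasFDerivAt.add a2.hasFDerivAt).fderiv
  have c2 : fderiv ℝ (fun q => h x.2 + R q x.2) x.1 = fderiv ℝ (fun q => R q x.2) x.1 := fderiv_const_add _
  simp only [ww, XH, grad_def]
  rw [(r.Hp t x.1 hp).fderiv, (r.Hq t x.1 hp).fderiv, c1, c2, Prod.mk_sub_mk, map_add, map_add, map_add]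
  simp

theorem Reg.ww_sub (r : Reg k Υ l e h R f H u v) (he : 0 ≤ e) (hΥ : 0 ≤ Υ) (t s : ℝ) {x : E n × E n} (hx : x ∈ Om n) :
    ww h R H t x - ww h R H s x = AA n (fderivWithin ℝ (ph f t s) (Om n) x) := by
  have T := r.tri he t s
  have hp := hx.2
  rw [fderivWithin_of_isOpen isOpen_Om hx]
  have d : DifferentiableAt ℝ (ph f t s) x := ((T.cd hΥ).differentiableOn (by simp)).differentiableAt (isOpen_Om.mem_nhds hx)
  have d1 : (fderiv ℝ (ph f t s) x).comp (ContinuousLinearMap.inr ℝ (E n) (E n)) = Jd n (u x.1 x.2 t - u x.1 x.2 s) := by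
    have h1 := HasFDerivAt.comp (g := ph f t s) (f := fun p' => (x.1, p')) x.2 d.hasFDerivAt (hasFDerivAt_prodMk_right (𝕜 := ℝ) x.1 x.2)
    exact h1.unique (T.hφ x.1 x.2 hp)
  have d2 : (fderiv ℝ (ph f t s) x).comp (ContinuousLinearMap.inl ℝ (E n) (E n)) = Jd n (v x.1 x.2 t - v x.1 x.2 s) := by
    have h1 := HasFDerivAt.comp (g := ph f t s) (f := fun q' => (q', x.2)) x.1 d.hasFDerivAt (hasFDerivAt_prodMk_left (𝕜 := ℝ) x.1 x.2)
    have h2 := (r.fq x.2 hp x.1 t).hasFDerivAt.sub (r.fq x.2 hp x.1 s).hasFDerivAt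
    rw [← map_sub] at h2
    exact h1.unique h2
  rw [AA_apply, d1, d2, Js_Jd, Js_Jd, r.ww_eq t hx, r.ww_eq s hx, Prod.mk_sub_mk]
  congr 1; abel

theorem bw_small {l : ℝ} (hl : 0 < l) {δ : ℝ} (hδ : 0 < δ) (e : ℝ) : ∃ T : ℝ, ∀ t, T ≤ |t| → e * bw l t ≤ δ := by
  have h1 := (bw_tendsto hl).const_mul e
  rw [mul_zero] at h1
  obtain ⟨T, hT⟩ := eventually_atTop.1 (h1.eventually (Iic_mem_nhds hδ))
  refine ⟨T, fun t ht => ?_⟩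
  have := hT |t| ht
  simpa [bw] using this

theorem Reg.hoe {σ : ℝ} (hσ : 0 ≤ σ) (hl : 1 < l) (he : 0 ≤ e) (hΥ : 0 ≤ Υ) (r : Reg ⌊σ⌋₊ Υ l e h R f H u v) :
    Tendsto (fun t => holderNormOn σ (Om n) (ww h R H t)) atTop (𝓝 0) ∧
    Tendsto (fun t => holderNormOn σ (Om n) (ww h R H t)) atBot (𝓝 0) := by
  have hu := (isOpen_Om (n := n)).uniqueDiffOn (𝕜 := ℝ)
  obtain ⟨M, hM, HM⟩ := absA n ⌊σ⌋₊ hΥ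
  generalize hk : ⌊σ⌋₊ = k at *
  have cf : ∀ t s, ContDiffOn ℝ ((k + 1 : ℕ)) (fderivWithin ℝ (ph f t s) (Om n)) (Om n) := fun t s =>
    ((r.tri he t s).cd hΥ).fderivWithin hu (by exact_mod_cast le_rfl)
  have cg : ∀ t s, ContDiffOn ℝ ((k + 1 : ℕ)) (fun x => ww h R H t x - ww h R H s x) (Om n) := fun t s =>
    ((AA n).contDiff.comp_contDiffOn (cf t s)).congr fun x hx => r.ww_sub he hΥ t s hx
  have bg : ∀ t s, ∀ i ≤ k + 1, ∀ x ∈ Om n, ‖iteratedFDerivWithin ℝ i (fun x => ww h R H t x - ww h R H s x) (Om n) x‖ ≤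
      ‖AA n‖ * ‖iteratedFDerivWithin ℝ (i + 1) (ph f t s) (Om n) x‖ := by
    intro t s i hi x hx
    rw [iteratedFDerivWithin_congr (fun x hx => r.ww_sub he hΥ t s hx) hx, ← norm_iteratedFDerivWithin_fderivWithin hu hx]
    exact (AA n).norm_iteratedFDerivWithin_comp_left (cf t s x hx) hu hx (by exact_mod_cast hi)
  refine absD (absC hσ (M := ‖AA n‖ * M) (by positivity) (ww h R H) ?_)
  rw [hk]
  refine absB isOpen_Om convex_Om (ww h R H) cg (by positivity) ?_ ?_
  · intro η hη
    obtain ⟨δ, hδ, HH⟩ := HM (η / (‖AA n‖ + 1)) (by positivity)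
    obtain ⟨T, hT⟩ := bw_small (l := l) (by linarith) (half_pos hδ) e
    refine ⟨T, fun t s ht hs => ?_⟩
    have hle : e * bw l t + e * bw l s ≤ δ := by have := hT t ht; have := hT s hs; linarith
    have K := r.tri he t s
    obtain ⟨-, k1, k2⟩ := HH _ _ _ K.cV K.bV K.hP K.hφ (fun x hx => (K.V0 x hx).trans hle) K.cP
      (fun i hi q => (K.bP i hi q).trans hle) K.cφ (fun i hi q => (K.bφ i hi q).trans hle)
    refine ⟨fun i hi x hx => ?_, fun x hx => ?_⟩
    · refine (bg t s i (by omega) x hx).trans ?_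
      have := k1 i hi x hx
      calc _ ≤ ‖AA n‖ * (η / (‖AA n‖ + 1)) := by gcongr
        _ ≤ (‖AA n‖ + 1) * (η / (‖AA n‖ + 1)) := by gcongr; linarith
        _ = η := by field_simp
    · refine (bg t s (k + 1) le_rfl x hx).trans ?_
      exact mul_le_mul_of_nonneg_left (k2 x hx) (norm_nonneg _)
  · intro x hx
    rw [tendsto_zero_iff_norm_tendsto_zero]
    have l1 : Tendsto (fun j : ℕ => e * bw l j) atTop (𝓝 0) := by
      have := ((bw_tendsto (m := l) (by linarith)).comp tendsto_natCast_atTop_atTop).const_mul e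
      rwa [mul_zero] at this
    refine squeeze_zero (fun _ => norm_nonneg _) (fun j => ?_) l1
    rw [r.ww_eq _ hx, Prod.norm_mk, norm_neg]
    have b1 : ∀ t, e * bw (l + 1) t ≤ e * bw l t := fun t => mul_le_mul_of_nonneg_left (bw_anti (by linarith) t) he
    have b2 : ∀ t, e * bw (l + 2) t ≤ e * bw l t := fun t => mul_le_mul_of_nonneg_left (bw_anti (by linarith) t) he
    have h1 := r.uB x.2 hx.2 j x.1 0 (Nat.zero_le _)
    have h2 := r.vB x.2 hx.2 j x.1 0 (Nat.zero_le _)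
    rw [norm_iteratedFDeriv_zero] at h1 h2
    exact max_le (h1.trans (b1 _)) (h2.trans (b2 _))

end HapSec


/-- **Theorem B.** Time-dependent perturbations of a near-integrable Hamiltonian:
existence of a large set of initial conditions giving rise to biasymptotically
quasiperiodic solutions. -/
theorem biasymptotic_near_integrable
    (n : ℕ) (σ Υ l K μ : ℝ) (hσ : 1 ≤ σ) (hΥ : 1 ≤ Υ) (hl : 1 < l) (hμ : 0 < μ) (hK : 0 ≤ K) :
    ∃ ε₀ : ℝ, 0 < ε₀ ∧
    ∀ (ε : ℝ) (h : E n → ℝ) (R : E n → E n → ℝ) (f H : E n → E n → ℝ → ℝ) (D : Set (E n)),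
      0 < ε → ε < 1 → ε ≤ ε₀ →
      H = (fun q p t => h p + R q p + f q p t) →
      ContDiffOn ℝ 2 h (ball 0 1) →
      -- |∂_p h|_{L(D)} ≤ K
      lipNormOn D (gradient h) ≤ ENNReal.ofReal K →
      -- f, ∂_p f ∈ D̄_{σ,2}
      MemDbar σ 2 (ball 0 1) f →
      MemDbar σ 2 (ball 0 1) (fun q p t => gradient (fun p' => f q p' t) p) →
      -- |f|_{σ+2,0,L(B₁)} + ‖∂_q f‖_{σ,1,l+2,L(B₁)} + ‖∂_p f‖_{σ,2,l+1,L(B₁)} < ε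
      wnormD (σ + 2) 0 (ball 0 1) f
          + wnormDbar σ 1 (l + 2) (ball 0 1) (fun q p t => gradient (fun q' => f q' p t) q)
          + wnormDbar σ 2 (l + 1) (ball 0 1) (fun q p t => gradient (fun p' => f q p' t) p)
        < ENNReal.ofReal ε →
      -- D ⊂ B₁ with Leb(B₁ \ D) < μ
      D ⊆ ball 0 1 →
      volume (ball (0 : E n) 1 \ D) < ENNReal.ofReal μ →
      -- R ∈ C²(𝕋ⁿ × B₁), periodic, with R = ∂_p R = 0 on 𝕋ⁿ × D
      ContDiffOn ℝ 2 (fun x : E n × E n => R x.1 x.2) (univ ×ˢ ball 0 1) →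
      (∀ (q p : E n) (k : Fin n → ℤ), R (q + latt k) p = R q p) →
      (∀ q : E n, ∀ p ∈ D, R q p = 0 ∧ fderiv ℝ (fun p' => R q p') p = 0) →
      -- ∂_p² H^t ∈ C^{σ+2}(𝕋ⁿ × B₁) for all fixed t
      (∀ t : ℝ, HolderOn (σ + 2) (univ ×ˢ ball 0 1)
          (fun x : E n × E n => iteratedFDeriv ℝ 2 (fun p' => H x.1 p' t) x.2)) →
      -- ∂^i_{qp} (∂_p² H) continuous for 0 ≤ i ≤ 2
      (∀ i : ℕ, i ≤ 2 → ContinuousOn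
          (fun x : E n × E n × ℝ => iteratedFDerivWithin ℝ i
              (fun y : E n × E n => iteratedFDeriv ℝ 2 (fun p' => H y.1 p' x.2.2) y.2)
              (univ ×ˢ ball 0 1) (x.1, x.2.1))
          (univ ×ˢ (ball 0 1 ×ˢ univ))) →
      -- sup_t |∂_p² H^t|_{C^{σ+2}} ≤ Υ
      ((⨆ t : ℝ, holderNormOn (σ + 2) (univ ×ˢ ball 0 1)
          (fun x : E n × E n => iteratedFDeriv ℝ 2 (fun p' => H x.1 p' t) x.2))
        ≤ ENNReal.ofReal Υ) →
      -- conclusion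
      ∃ (ht : E n → E n → ℝ → ℝ) (ω : E n → E n),
        Per ht ∧
        Tendsto (fun t => holderNormOn σ (univ ×ˢ ball 0 1)
            (fun x : E n × E n => XH H x.1 x.2 t - XH ht x.1 x.2 t)) atTop (𝓝 0) ∧
        Tendsto (fun t => holderNormOn σ (univ ×ˢ ball 0 1)
            (fun x : E n × E n => XH H x.1 x.2 t - XH ht x.1 x.2 t)) atBot (𝓝 0) ∧
        -- a set W ⊂ 𝕋ⁿ × B₁ with Leb((𝕋ⁿ × B₁) \ W) ≤ 4μ
        ∃ W : Set (E n × E n),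
          (∀ x ∈ W, x.2 ∈ ball (0 : E n) 1) ∧
          volume ((fund n ×ˢ ball (0 : E n) 1) \ W) ≤ ENNReal.ofReal (4 * μ) ∧
          ∀ x ∈ W,
            ∃ pp pm : E n, pp ∈ D ∧ pm ∈ D ∧
              (∀ (q' : E n) (t : ℝ), XH ht q' pp t = (ω pp, 0)) ∧
              (∀ (q' : E n) (t : ℝ), XH ht q' pm t = (ω pm, 0)) ∧
              ∃ g : ℝ → E n × E n,
                g 0 = x ∧
                (∀ t : ℝ, (g t).2 ∈ ball (0 : E n) 1) ∧
                (∀ t : ℝ, HasDerivAt g (XH H (g t).1 (g t).2 t) t) ∧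
                ∃ qp qm : E n,
                  Tendsto (fun t : ℝ =>
                      distT (g t).1 (qp + t • ω pp) + ‖(g t).2 - pp‖) atTop (𝓝 0) ∧
                  Tendsto (fun t : ℝ =>
                      distT (g t).1 (qm + t • ω pm) + ‖(g t).2 - pm‖) atBot (𝓝 0) := by
  have hc : (1:ℝ) ≤ 2 ^ (l + 2) := Real.one_le_rpow (by norm_num) (by linarith)
  generalize hcc : (2:ℝ) ^ (l + 2) = c at hc
  obtain ⟨A, hA, ε₁, hε₁, HC⟩ := curve_ex n hΥ hl hc hK
  obtain ⟨r, hr, hr4, η, hη, HM⟩ := meas_main n hμ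
  refine ⟨min ε₁ (min (η / A) (r / 2 / (c + 1))), by positivity, ?_⟩
  intro ε h R f H D hε hε1 hεm hH hh hlip hf hu hs hD hvol hR hRp hR0 hU hUc hUb
  have e1 : ε ≤ ε₁ := hεm.trans (min_le_left _ _)
  have e2 : ε * A ≤ η := (le_div_iff₀ hA).1 (hεm.trans ((min_le_right _ _).trans (min_le_left _ _)))
  have e3 : ε * (c + 1) ≤ r / 2 := (le_div_iff₀ (by linarith)).1 (hεm.trans ((min_le_right _ _).trans (min_le_right _ _)))
  have reg := reg_of_hyp hσ hΥ hl hε hH hh hf hu hs hR hU hUb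
  rw [hcc] at reg
  have hLip : ∀ p ∈ D, ∀ p' ∈ D, ‖gradient h p - gradient h p'‖ ≤ K * ‖p - p'‖ := by
    intro p hp p' hp'
    by_cases hpp : p = p'
    · subst hpp; simp
    have h1 : ENNReal.ofReal (‖gradient h p - gradient h p'‖ / ‖p - p'‖) ≤ ENNReal.ofReal K := by
      refine le_trans ?_ (le_trans le_self_add hlip)
      exact le_iSup_of_le p (le_iSup_of_le hp (le_iSup_of_le p' (le_iSup_of_le hp' (le_iSup_of_le hpp le_rfl))))
    have h2 := (ENNReal.ofReal_le_ofReal_iff hK).1 h1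
    exact (div_le_iff₀ (norm_pos_iff.2 (sub_ne_zero.2 hpp))).1 h2
  obtain ⟨C, hCD, hCr, HW⟩ := HM D hD hvol
  have HZ := HC ε hε e1 _ h R f H _ _ C reg (hCD.trans hD) (fun q p hp => hR0 q p (hCD hp))
    (fun p hp p' hp' => hLip p (hCD hp) p' (hCD hp')) (fun p hp => by have := hCr p hp; linarith)
  obtain ⟨Zp, hZp⟩ := HZ 1 (by simp)
  obtain ⟨Zm, hZm⟩ := HZ (-1) (by simp)
  have app : ∀ s Z, Curve s ε A (c + 1) C (gradient h) (XH H) Z →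
      ∃ W : Set (E n × E n), (∀ x ∈ W, x.2 ∈ ball (0 : E n) 1 ∧ ∃ a : E n × E n, a.2 ∈ C ∧ a + Z a = x) ∧
        volume ((fund n ×ˢ ball (0 : E n) 1) \ W) ≤ ENNReal.ofReal (2 * μ) := by
    intro s Z hZ
    refine HW Z (fun x y hx hy => (hZ.1 x y hx hy).trans ?_) (fun x hx => ?_)
    · exact mul_le_mul_of_nonneg_right e2 (norm_nonneg _)
    · exact ⟨(hZ.2.1 x hx).1.trans e2, (hZ.2.1 x hx).2.trans e3⟩
  obtain ⟨Wp, hWp, vWp⟩ := app 1 Zp hZp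
  obtain ⟨Wm, hWm, vWm⟩ := app (-1) Zm hZm
  have hX : ∀ p ∈ D, ∀ (q' : E n) (t : ℝ), XH (fun q p (_ : ℝ) => h p + R q p) q' p t = (gradient h p, 0) := by
    intro p hp q' t
    have hb := hD hp
    have a1 : DifferentiableAt ℝ h p := (hh.differentiableOn (by norm_num)).differentiableAt (isOpen_ball.mem_nhds hb)
    have a2 : DifferentiableAt ℝ (fun p => R q' p) p :=
      ((slice_R hR q').differentiableOn (by norm_num)).differentiableAt (isOpen_ball.mem_nhds hb)
    have c1 : fderiv ℝ (fun p => h p + R q' p) p = fderiv ℝ h p := by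
      have a3 : fderiv ℝ (fun p => h p + R q' p) p = fderiv ℝ h p + fderiv ℝ (fun p => R q' p) p :=
        (a1.hasFDerivAt.add a2.hasFDerivAt).fderiv
      rw [a3, (hR0 q' p hp).2, add_zero]
    have c2 : (fun q => h p + R q p) = fun _ => h p := by
      funext q; rw [(hR0 q p hp).1, add_zero]
    have c3 : fderiv ℝ (fun q => h p + R q p) q' = 0 := by rw [c2]; simp
    simp only [XH, grad_def]
    rw [c1, c3]; simp
  obtain ⟨l1, l2⟩ := reg.hoe (by linarith) hl (by positivity) (by linarith)
  refine ⟨fun q p _ => h p + R q p, gradient h, fun q p t k => by simp only [hRp], l1, l2, Wp ∩ Wm,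
    fun x hx => (hWp x hx.1).1, ?_, ?_⟩
  · rw [diff_inter]
    refine (measure_union_le _ _).trans ((add_le_add vWp vWm).trans ?_)
    rw [← ENNReal.ofReal_add (by positivity) (by positivity)]
    exact ENNReal.ofReal_le_ofReal (by linarith)
  · rintro x ⟨hx1, hx2⟩
    obtain ⟨-, a, ha, xa⟩ := hWp x hx1
    obtain ⟨-, b, hb, xb⟩ := hWm x hx2
    exact ⟨a.2, b.2, hCD ha, hCD hb, hX _ (hCD ha), hX _ (hCD hb), glue hZp hZm ha hb xa xb⟩

end Bias
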